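/- arXiv:1402.6496 — 3 statements merged into one kernel-verified Lean document; each statement's English description precedes it below -/
import Mathlib

section
/- Let d ≥ 2, let V ⊂ S^{d-1} be finite, and suppose P = conv V is a d-dimensional polytope whose vertex set is V, which satisfies Property Z, and every facet of which is a simplex (has exactly d extreme points). Fix p ∈ V. For each facet F of P containing p, let W_F be the set of the d−1 extreme points of F other than p; whenever W_F is linearly independent, let u_F be the unit vector orthogonal to the linear span of W_F satisfying ⟨u_F, p⟩ > 0, and let A_F be the (d−1)-dimensional Hausdorff measure of conv(W_F ∪ {o}). Set m = Σ A_F · u_F, summed over all facets F of P containing p for which W_F is linearly independent. Then m ≠ 0 and p = m/‖m‖. -/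
open MeasureTheory Real RealInnerProductSpace

/-- Property Z for a polytope inscribed in the unit sphere with vertex set `V`. -/
def PropertyZ {d : ℕ} (V : Set (EuclideanSpace ℝ (Fin d))) : Prop :=
  ∀ p ∈ V, ∃ ε > (0 : ℝ), ∀ q ∈ Metric.sphere (0 : EuclideanSpace ℝ (Fin d)) 1,
    dist q p < ε →
      volume (convexHull ℝ ((V \ {p}) ∪ {q})) ≤ volume (convexHull ℝ V)

/-- A facet of a `d`-dimensional polytope `P ⊆ ℝ^d` is a `(d-1)`-dimensional exposed face. -/
def IsFacet {d : ℕ} (P F : Set (EuclideanSpace ℝ (Fin d))) : Prop :=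
  IsExposed ℝ P F ∧ Module.finrank ℝ (affineSpan ℝ F).direction = d - 1

/-- a functional bounded on `V` is bounded on the convex hull -/
lemma hull_le {d : ℕ} {V : Set (EuclideanSpace ℝ (Fin d))} (f : EuclideanSpace ℝ (Fin d) →L[ℝ] ℝ)
    {b : ℝ} (h : ∀ v ∈ V, f v ≤ b) : ∀ x ∈ convexHull ℝ V, f x ≤ b := by
  have : convexHull ℝ V ⊆ {x | f x ≤ b} :=
    convexHull_min h (convex_halfSpace_le f.toLinearMap.isLinear b)
  exact this

lemma hull_ge {d : ℕ} {V : Set (EuclideanSpace ℝ (Fin d))} (f : EuclideanSpace ℝ (Fin d) →L[ℝ] ℝ)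
    {b : ℝ} (h : ∀ v ∈ V, b ≤ f v) : ∀ x ∈ convexHull ℝ V, b ≤ f x := by
  have : convexHull ℝ V ⊆ {x | b ≤ f x} :=
    convexHull_min h (convex_halfSpace_ge f.toLinearMap.isLinear b)
  exact this

/-- a functional with a maximum on `conv V` at an interior point vanishes -/
lemma interior_max_zero {d : ℕ} {P : Set (EuclideanSpace ℝ (Fin d))}
    (f : EuclideanSpace ℝ (Fin d) →L[ℝ] ℝ)
    {c : EuclideanSpace ℝ (Fin d)} (hc : c ∈ interior P) (h : ∀ x ∈ P, f x ≤ f c) : f = 0 := by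
  have hm : IsLocalMax f c := by
    filter_upwards [mem_interior_iff_mem_nhds.1 hc] with x hx using h x hx
  have := hm.fderiv_eq_zero
  rwa [f.fderiv] at this

lemma facet_hull {d : ℕ} {V : Set (EuclideanSpace ℝ (Fin d))} (hfin : V.Finite)
    (hvert : (convexHull ℝ V).extremePoints ℝ = V) {F : Set (EuclideanSpace ℝ (Fin d))}
    (hF : IsExposed ℝ (convexHull ℝ V) F) :
    F.extremePoints ℝ = F ∩ V ∧ F = convexHull ℝ (F.extremePoints ℝ) := by
  have h1 : F.extremePoints ℝ = F ∩ V := by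
    rw [hF.isExtreme.extremePoints_eq, hvert]
  refine ⟨h1, ?_⟩
  have hK := closure_convexHull_extremePoints (hF.isCompact (hfin.isCompact_convexHull ℝ))
    (hF.convex (convex_convexHull ℝ V))
  have hf : (F.extremePoints ℝ).Finite := by
    rw [h1]; exact hfin.subset Set.inter_subset_right
  rw [(hf.isCompact_convexHull ℝ).isClosed.closure_eq] at hK
  exact hK.symm

lemma facet_data {d : ℕ} (hd : 2 ≤ d) {V : Set (EuclideanSpace ℝ (Fin d))} (hfin : V.Finite)
    (hdim : affineSpan ℝ V = ⊤)
    (hvert : (convexHull ℝ V).extremePoints ℝ = V)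
    {F : Set (EuclideanSpace ℝ (Fin d))} (hF : IsFacet (convexHull ℝ V) F)
    (hcard : (F.extremePoints ℝ).ncard = d)
    {c : EuclideanSpace ℝ (Fin d)} (hc : c ∈ interior (convexHull ℝ V)) :
    ∃ (ℓ : EuclideanSpace ℝ (Fin d) →L[ℝ] ℝ)
      (φ : EuclideanSpace ℝ (Fin d) → EuclideanSpace ℝ (Fin d) →L[ℝ] ℝ),
      (∀ v ∈ F.extremePoints ℝ, ℓ (v - c) = 1) ∧
      (∀ v ∈ V, v ∉ F.extremePoints ℝ → ℓ (v - c) < 1) ∧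
      (∀ v ∈ F.extremePoints ℝ, φ v (v - c) = 1) ∧
      (∀ v ∈ F.extremePoints ℝ, ∀ w ∈ F.extremePoints ℝ, w ≠ v → φ v (w - c) = 0) ∧
      (∀ v, v ∉ F.extremePoints ℝ → φ v = 0) ∧
      (∀ x, ∑ v ∈ hfin.toFinset, φ v x = ℓ x) ∧
      LinearIndependent ℝ (fun v : F.extremePoints ℝ => (v : EuclideanSpace ℝ (Fin d)) - c) ∧
      Submodule.span ℝ (Set.range fun v : F.extremePoints ℝ =>
        (v : EuclideanSpace ℝ (Fin d)) - c) = ⊤ := by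
  classical
  obtain ⟨hS, hFS⟩ := facet_hull hfin hvert hF.1
  set S := F.extremePoints ℝ with hSdef
  have hSfin : S.Finite := by rw [hS]; exact hfin.subset Set.inter_subset_right
  have hSV : S ⊆ V := by rw [hS]; exact Set.inter_subset_right
  have hSne : S.Nonempty := by
    rw [← Set.ncard_pos hSfin]; omega
  obtain ⟨v0, hv0⟩ := hSne
  have hv0F : v0 ∈ F := by rw [hS] at hv0; exact hv0.1
  obtain ⟨l, hl⟩ := hF.1 ⟨v0, hv0F⟩
  have hmem : ∀ x, x ∈ F ↔ x ∈ convexHull ℝ V ∧ ∀ y ∈ convexHull ℝ V, l y ≤ l x := by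
    intro x; rw [hl]; rfl
  have hmax : ∀ y ∈ convexHull ℝ V, l y ≤ l v0 := ((hmem v0).1 hv0F).2
  have hcP := interior_subset hc
  have hpos : 0 < l v0 - l c := by
    by_contra hcon
    have hcm : ∀ y ∈ convexHull ℝ V, l y ≤ l c := fun y hy => by linarith [hmax y hy]
    have hl0 := interior_max_zero l hc hcm
    have hFP : F = convexHull ℝ V := by
      ext x; rw [hmem, hl0]; simp
    have h2 := hF.2
    rw [hFP, affineSpan_convexHull, hdim, AffineSubspace.direction_top, finrank_top,
      finrank_euclideanSpace_fin] at h2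
    omega
  set ℓ : EuclideanSpace ℝ (Fin d) →L[ℝ] ℝ := (l v0 - l c)⁻¹ • l with hℓ
  have hℓS : ∀ v ∈ S, ℓ (v - c) = 1 := by
    intro v hv
    have hvF : v ∈ F := by rw [hS] at hv; exact hv.1
    have : l v = l v0 := le_antisymm (hmax v ((hmem v).1 hvF).1)
      (((hmem v).1 hvF).2 v0 ((hmem v0).1 hv0F).1)
    change (l v0 - l c)⁻¹ * l (v - c) = 1
    rw [map_sub, this]
    exact inv_mul_cancel₀ hpos.ne'
  have hℓV : ∀ v ∈ V, v ∉ S → ℓ (v - c) < 1 := by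
    intro v hv hvS
    have hvF : v ∉ F := fun h => hvS (by rw [hS]; exact ⟨h, hv⟩)
    have hvP := subset_convexHull ℝ V hv
    have : l v < l v0 := by
      by_contra hcon
      exact hvF ((hmem v).2 ⟨hvP, fun y hy => by linarith [hmax y hy]⟩)
    change (l v0 - l c)⁻¹ * l (v - c) < 1
    rw [map_sub, inv_mul_lt_iff₀ hpos]; linarith
  have hspan : Submodule.span ℝ (Set.range fun v : S =>
        (v : EuclideanSpace ℝ (Fin d)) - c) = ⊤ := by
    set T := Submodule.span ℝ (Set.range fun v : S =>
        (v : EuclideanSpace ℝ (Fin d)) - c) with hT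
    have hvT : ∀ v ∈ S, v - c ∈ T := fun v hv => Submodule.subset_span ⟨⟨v, hv⟩, rfl⟩
    have hdirE : (affineSpan ℝ F).direction = vectorSpan ℝ S := by
      conv_lhs => rw [hFS]
      rw [affineSpan_convexHull, direction_affineSpan]
    have hle : vectorSpan ℝ S ≤ T ⊓ LinearMap.ker ℓ.toLinearMap := by
      rw [vectorSpan_def, Submodule.span_le]
      rintro _ ⟨a, ha, b, hb, rfl⟩
      simp only [vsub_eq_sub]
      have hab : a - b = (a - c) - (b - c) := by abel
      refine ⟨?_, ?_⟩
      · rw [hab]; exact T.sub_mem (hvT a ha) (hvT b hb)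
      · change ℓ (a - b) = 0
        rw [hab, map_sub, hℓS a ha, hℓS b hb, sub_self]
    have hlt : vectorSpan ℝ S < T := by
      refine lt_of_le_of_ne (hle.trans inf_le_left) ?_
      intro h
      have h3 : v0 - c ∈ vectorSpan ℝ S := by rw [h]; exact hvT v0 hv0
      have h4 : ℓ (v0 - c) = 0 := (hle h3).2
      rw [hℓS v0 hv0] at h4; exact one_ne_zero h4
    have h5 := Submodule.finrank_lt_finrank_of_lt hlt
    have h2 := hF.2
    rw [hdirE] at h2
    apply Submodule.eq_top_of_finrank_eq
    have h6 := Submodule.finrank_le T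
    rw [finrank_euclideanSpace_fin] at h6 ⊢
    omega
  have : Fintype S := hSfin.fintype
  have hc' : Fintype.card S = Module.finrank ℝ (EuclideanSpace ℝ (Fin d)) := by
    rw [finrank_euclideanSpace_fin, ← Nat.card_eq_fintype_card, Nat.card_coe_set_eq, hcard]
  have hli := linearIndependent_of_top_le_span_of_card_eq_finrank hspan.ge hc'
  let b : Module.Basis S ℝ (EuclideanSpace ℝ (Fin d)) := Module.Basis.mk hli hspan.ge
  have hb : ∀ v : S, b v = (v : EuclideanSpace ℝ (Fin d)) - c := fun v => by
    simp [b]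
  let φ : EuclideanSpace ℝ (Fin d) → EuclideanSpace ℝ (Fin d) →L[ℝ] ℝ := fun v =>
    if h : v ∈ S then LinearMap.toContinuousLinearMap (b.coord ⟨v, h⟩) else 0
  have hφ : ∀ v (h : v ∈ S), ∀ x, φ v x = b.coord ⟨v, h⟩ x := by
    intro v h x; simp [φ, h]
  have hφ1 : ∀ v ∈ S, φ v (v - c) = 1 := by
    intro v hv
    rw [hφ v hv, ← hb ⟨v, hv⟩]; simp
  have hφ0 : ∀ v ∈ S, ∀ w ∈ S, w ≠ v → φ v (w - c) = 0 := by
    intro v hv w hw hne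
    rw [hφ v hv, ← hb ⟨w, hw⟩, Module.Basis.coord_apply, Module.Basis.repr_self,
      Finsupp.single_apply, if_neg]
    intro h; exact hne (congrArg Subtype.val h)
  have hφz : ∀ v, v ∉ S → φ v = 0 := by
    intro v hv; simp [φ, hv]
  refine ⟨ℓ, φ, hℓS, hℓV, hφ1, hφ0, hφz, ?_, hli, hspan⟩
  intro x
  have hlin : (∑ v ∈ hfin.toFinset, (φ v).toLinearMap) = ℓ.toLinearMap := by
    apply b.ext
    intro w
    rw [hb w, LinearMap.sum_apply]
    change ∑ v ∈ hfin.toFinset, φ v ((w : EuclideanSpace ℝ (Fin d)) - c) = ℓ (w - c)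
    rw [hℓS w w.2, Finset.sum_eq_single (w : EuclideanSpace ℝ (Fin d))]
    · exact hφ1 w w.2
    · intro v _ hvw
      by_cases hv : v ∈ S
      · exact hφ0 v hv w w.2 hvw.symm
      · rw [hφz v hv]; rfl
    · intro h; exact absurd (hfin.mem_toFinset.2 (hSV w.2)) h
  have := LinearMap.congr_fun hlin x
  rw [LinearMap.sum_apply] at this
  exact this

/-- almost every point of `P` lies in one of the simplices over the facets -/
lemma facet_cover {d : ℕ} (hd : 2 ≤ d) {V : Set (EuclideanSpace ℝ (Fin d))} (hfin : V.Finite)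
    (hvert : (convexHull ℝ V).extremePoints ℝ = V)
    {c : EuclideanSpace ℝ (Fin d)} (hc : c ∈ interior (convexHull ℝ V)) :
    ∀ᵐ x : EuclideanSpace ℝ (Fin d), x ∈ convexHull ℝ V →
      ∃ F, IsFacet (convexHull ℝ V) F ∧ x ∈ convexHull ℝ (insert c (F.extremePoints ℝ)) := by
  classical
  set P := convexHull ℝ V with hP
  have hPc : IsCompact P := hfin.isCompact_convexHull ℝ
  -- exceptional null set
  have hnull : ∀ᵐ x : EuclideanSpace ℝ (Fin d), ∀ S ∈ hfin.toFinset.powerset,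
      affineSpan ℝ (insert c (S : Set (EuclideanSpace ℝ (Fin d)))) ≠ ⊤ →
      x ∉ affineSpan ℝ (insert c (S : Set (EuclideanSpace ℝ (Fin d)))) := by
    rw [Filter.eventually_all_finset]
    intro S _
    by_cases h : affineSpan ℝ (insert c (S : Set (EuclideanSpace ℝ (Fin d)))) = ⊤
    · simp [h]
    · have := Measure.addHaar_affineSubspace volume _ h
      filter_upwards [measure_eq_zero_iff_ae_notMem.1 this] with x hx _ using hx
  filter_upwards [hnull] with x hx hxP
  -- x ≠ c
  have hxc : x - c ≠ 0 := by
    intro h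
    have hxc : x = c := sub_eq_zero.1 h
    refine hx ∅ (by simp) ?_ ?_
    · intro h
      rw [Finset.coe_empty, insert_empty_eq] at h
      have h1 : Module.finrank ℝ (affineSpan ℝ {c}).direction =
        Module.finrank ℝ (⊤ : AffineSubspace ℝ (EuclideanSpace ℝ (Fin d))).direction := by rw [h]
      rw [direction_affineSpan, AffineSubspace.direction_top, finrank_top,
        finrank_euclideanSpace_fin, vectorSpan_singleton, finrank_bot] at h1
      omega
    · rw [hxc]; exact mem_affineSpan ℝ (by simp)
  have hconvP : Convex ℝ P := convex_convexHull ℝ V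
  set P' : Set (EuclideanSpace ℝ (Fin d)) := (fun z => c + z) ⁻¹' P with hP'
  have hP'conv : Convex ℝ P' := hconvP.translate_preimage_right c
  have hP'nhd : P' ∈ nhds (0 : EuclideanSpace ℝ (Fin d)) := by
    apply (continuous_const.add continuous_id).continuousAt.preimage_mem_nhds
    simpa using mem_interior_iff_mem_nhds.1 hc
  have hP'b : Bornology.IsVonNBounded ℝ P' := by
    rw [NormedSpace.isVonNBounded_iff]
    have : P' = (Homeomorph.addLeft c) ⁻¹' P := rfl
    rw [this]
    exact ((Homeomorph.isCompact_preimage _).2 hPc).isBounded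
  set g := gauge P' (x - c) with hg
  have hgpos : 0 < g := (gauge_pos (absorbent_nhds_zero hP'nhd) hP'b).2 hxc
  have hgle : g ≤ 1 := gauge_le_one_of_mem (by simpa [hP'] using hxP)
  set y' := g⁻¹ • (x - c) with hy'
  have hy'1 : gauge P' y' = 1 := by
    rw [hy', gauge_smul_of_nonneg (inv_nonneg.2 hgpos.le), ← hg, smul_eq_mul,
      inv_mul_cancel₀ hgpos.ne']
  have hy'f : y' ∈ frontier P' := (gauge_eq_one_iff_mem_frontier hP'conv hP'nhd).1 hy'1
  have hyf : c + y' ∈ frontier P := by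
    have : P' = (Homeomorph.addLeft c) ⁻¹' P := rfl
    rw [this, ← Homeomorph.preimage_frontier] at hy'f
    exact hy'f
  set y := c + y' with hy
  have hyP : y ∈ P := hPc.isClosed.frontier_subset hyf
  have hyi : y ∉ interior P := hyf.2
  obtain ⟨f, hf⟩ := geometric_hahn_banach_open_point hconvP.interior isOpen_interior hyi
  have hfle : ∀ z ∈ P, f z ≤ f y := by
    intro z hz
    have hcl : z ∈ closure (interior P) := by
      rw [hconvP.closure_interior_eq_closure_of_nonempty_interior ⟨c, hc⟩]
      exact subset_closure hz
    have : closure (interior P) ⊆ {z | f z ≤ f y} :=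
      closure_minimal (fun a ha => (hf a ha).le) (isClosed_le f.continuous continuous_const)
    exact this hcl
  set F : Set (EuclideanSpace ℝ (Fin d)) := {z | z ∈ P ∧ ∀ w ∈ P, f w ≤ f z} with hF
  have hFexp : IsExposed ℝ P F := fun _ => ⟨f, rfl⟩
  have hyF : y ∈ F := ⟨hyP, hfle⟩
  obtain ⟨hS, hFS⟩ := facet_hull hfin hvert hFexp
  set S := F.extremePoints ℝ with hSdef
  have hSfin : S.Finite := by rw [hS]; exact hfin.subset Set.inter_subset_right
  have hxS : x ∈ convexHull ℝ (insert c S) := by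
    have h1 : c ∈ convexHull ℝ (insert c S) := subset_convexHull ℝ _ (Set.mem_insert _ _)
    have h2 : y ∈ convexHull ℝ (insert c S) := by
      rw [hFS] at hyF
      exact convexHull_mono (Set.subset_insert _ _) hyF
    have h3 : x = (1 - g) • c + g • y := by
      rw [hy, hy', smul_add, smul_smul, mul_inv_cancel₀ hgpos.ne', one_smul, sub_smul, one_smul]
      abel
    rw [h3]
    exact convex_convexHull ℝ _ h1 h2 (by linarith) hgpos.le (by ring)
  refine ⟨F, ⟨hFexp, ?_⟩, hxS⟩
  have htop : affineSpan ℝ (insert c S) = ⊤ := by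
    by_contra hne
    refine hx hSfin.toFinset ?_ ?_ ?_
    · rw [Finset.mem_powerset]
      intro v hv
      rw [hfin.mem_toFinset]
      have := hSfin.mem_toFinset.1 hv
      rw [hS] at this; exact this.2
    · rwa [hSfin.coe_toFinset]
    · rw [hSfin.coe_toFinset]
      exact convexHull_subset_affineSpan _ hxS
  have hdirE : (affineSpan ℝ F).direction = vectorSpan ℝ S := by
    conv_lhs => rw [hFS]
    rw [affineSpan_convexHull, direction_affineSpan]
  rw [hdirE]
  have hup := finrank_vectorSpan_insert_le_set ℝ S c
  rw [← direction_affineSpan, htop, AffineSubspace.direction_top, finrank_top,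
    finrank_euclideanSpace_fin] at hup
  have hker : vectorSpan ℝ S ≤ LinearMap.ker f.toLinearMap := by
    rw [vectorSpan_def, Submodule.span_le]
    rintro _ ⟨a, ha, b, hb, rfl⟩
    rw [hS] at ha hb
    change f (a - b) = 0
    rw [map_sub, sub_eq_zero]
    exact le_antisymm (hb.1.2 a ha.1.1) (ha.1.2 b hb.1.1)
  have hlt : vectorSpan ℝ S < ⊤ := by
    refine lt_of_le_of_lt hker (lt_top_iff_ne_top.2 ?_)
    intro h
    have h1 : c - y ∈ LinearMap.ker f.toLinearMap := by rw [h]; trivial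
    have h2 : f (c - y) = 0 := h1
    have h3 := hf c hc
    rw [map_sub] at h2
    linarith
  have h5 := Submodule.finrank_lt_finrank_of_lt hlt
  rw [finrank_top, finrank_euclideanSpace_fin] at h5
  omega

/-- the fan over supporting functionals is essentially disjoint -/
lemma fan_lower_bound {d : ℕ} {V : Set (EuclideanSpace ℝ (Fin d))} (hfin : V.Finite)
    (ρ : EuclideanSpace ℝ (Fin d) → EuclideanSpace ℝ (Fin d))
    {c : EuclideanSpace ℝ (Fin d)} (hc : c ∈ convexHull ℝ (ρ '' V))
    (𝒢 : Finset (Set (EuclideanSpace ℝ (Fin d))))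
    (S : Set (EuclideanSpace ℝ (Fin d)) → Set (EuclideanSpace ℝ (Fin d)))
    (hSV : ∀ F ∈ 𝒢, S F ⊆ V) (hinj : ∀ F ∈ 𝒢, ∀ F' ∈ 𝒢, S F = S F' → F = F')
    (hL : ∀ F ∈ 𝒢, ∃ L : EuclideanSpace ℝ (Fin d) →L[ℝ] ℝ,
      (∀ v ∈ S F, L (ρ v - c) = 1) ∧ ∀ v ∈ V, v ∉ S F → L (ρ v - c) < 1) :
    ∑ F ∈ 𝒢, volume (convexHull ℝ (insert c (ρ '' S F))) ≤ volume (convexHull ℝ (ρ '' V)) := by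
  classical
  have hfinS : ∀ F ∈ 𝒢, (insert c (ρ '' S F)).Finite := fun F hF =>
    ((hfin.subset (hSV F hF)).image ρ).insert c
  have hle : ∀ F ∈ 𝒢, ∀ L : EuclideanSpace ℝ (Fin d) →L[ℝ] ℝ, (∀ v ∈ S F, L (ρ v - c) = 1) →
      (∀ v ∈ V, v ∉ S F → L (ρ v - c) < 1) → ∀ v ∈ V, L (ρ v - c) ≤ 1 := by
    intro F hF L h1 h2 v hv
    by_cases h : v ∈ S F
    · exact (h1 v h).le
    · exact (h2 v hv h).le
  rw [← measure_biUnion_finset₀]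
  · apply measure_mono
    refine Set.iUnion₂_subset fun F hF => convexHull_min ?_ (convex_convexHull ℝ _)
    refine Set.insert_subset hc ?_
    exact (Set.image_mono (hSV F hF)).trans (subset_convexHull ℝ _)
  · intro F hF F' hF' hne
    have hF : F ∈ 𝒢 := hF
    have hF' : F' ∈ 𝒢 := hF'
    obtain ⟨L, hL1, hL2⟩ := hL F hF
    obtain ⟨L', hL1', hL2'⟩ := hL F' hF'
    have hLle := hle F hF L hL1 hL2
    have hLle' := hle F' hF' L' hL1' hL2'
    have hne0 : L - L' ≠ 0 := by
      intro h0
      have hEq : L = L' := sub_eq_zero.1 h0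
      apply hne
      apply hinj F hF F' hF'
      ext v
      constructor
      · intro hv
        by_contra hv'
        have := hL2' v (hSV F hF hv) hv'
        rw [← hEq, hL1 v hv] at this
        exact lt_irrefl _ this
      · intro hv
        by_contra hv'
        have := hL2 v (hSV F' hF' hv) hv'
        rw [hEq, hL1' v hv] at this
        exact lt_irrefl _ this
    have hK : LinearMap.ker (L - L').toLinearMap ≠ ⊤ := by
      intro h
      apply hne0
      ext x
      have : x ∈ LinearMap.ker (L - L').toLinearMap := by rw [h]; trivial
      exact this
    have hsub : convexHull ℝ (insert c (ρ '' S F)) ∩ convexHull ℝ (insert c (ρ '' S F')) ⊆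
        (fun x => x + (-c)) ⁻¹' (LinearMap.ker (L - L').toLinearMap : Set _) := by
      rintro x ⟨hx, hx'⟩
      have h1 : (L - L') c ≤ (L - L') x := by
        refine hull_ge (L - L') ?_ x hx
        rintro v (rfl | ⟨w, hw, rfl⟩)
        · exact le_rfl
        · have e1 := hL1 w hw
          have e2 := hLle' w (hSV F hF hw)
          rw [map_sub] at e1 e2
          rw [sub_apply, sub_apply]; linarith
      have h2 : (L - L') x ≤ (L - L') c := by
        refine hull_le (L - L') ?_ x hx'
        rintro v (rfl | ⟨w, hw, rfl⟩)
        · exact le_rfl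
        · have e1 := hL1' w hw
          have e2 := hLle w (hSV F' hF' hw)
          rw [map_sub] at e1 e2
          rw [sub_apply, sub_apply]; linarith
      change (L - L') (x + -c) = 0
      rw [map_add, map_neg]; linarith
    refine measure_mono_null hsub ?_
    rw [measure_preimage_add_right]
    exact Measure.addHaar_submodule _ _ hK
  · intro F hF
    exact ((hfinS F hF).isCompact_convexHull ℝ).measurableSet.nullMeasurableSet

/-- volume under a shear -/
lemma vol_shear {d : ℕ} {T : Set (EuclideanSpace ℝ (Fin d))}
    (φ : EuclideanSpace ℝ (Fin d) →L[ℝ] ℝ) (z a : EuclideanSpace ℝ (Fin d))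
    (ρ : EuclideanSpace ℝ (Fin d) → EuclideanSpace ℝ (Fin d))
    (h : ∀ x ∈ T, ρ x = x + φ x • z + a) :
    (volume (convexHull ℝ (ρ '' T))).toReal = |1 + φ z| * (volume (convexHull ℝ T)).toReal := by
  have h1 : ρ '' T = (fun x => x + a) '' (LinearMap.transvection φ.toLinearMap z '' T) := by
    rw [Set.image_image]
    apply Set.image_congr
    intro x hx
    rw [h x hx, LinearMap.transvection.apply]; rfl
  have h2 : (fun x => x + a) '' (LinearMap.transvection φ.toLinearMap z '' T) =
     (AffineEquiv.constVAdd ℝ (EuclideanSpace ℝ (Fin d)) a).toAffineMap ''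
      (LinearMap.transvection φ.toLinearMap z '' T) := by
    apply Set.image_congr
    intro x _
    simp [add_comm]
  rw [h1, h2, ← AffineMap.image_convexHull, ← LinearMap.image_convexHull]
  have h3 : ∀ K : Set (EuclideanSpace ℝ (Fin d)),
      (AffineEquiv.constVAdd ℝ (EuclideanSpace ℝ (Fin d)) a).toAffineMap '' K =
      (fun x => x + (-a)) ⁻¹' K := by
    intro K
    ext x
    constructor
    · rintro ⟨y, hy, rfl⟩
      simpa using hy
    · intro hx
      exact ⟨x + -a, hx, by simp⟩
  rw [h3, measure_preimage_add_right, Measure.addHaar_image_linearMap, LinearMap.transvection.det,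
    ENNReal.toReal_mul, ENNReal.toReal_ofReal (abs_nonneg _)]
  rfl

/-- local maximum of a linear functional on the sphere -/
lemma sphere_max {d : ℕ} (y p : EuclideanSpace ℝ (Fin d)) (hp : ‖p‖ = 1)
    {ε : ℝ} (hε : 0 < ε)
    (h : ∀ q ∈ Metric.sphere (0 : EuclideanSpace ℝ (Fin d)) 1, dist q p < ε → ⟪y, q⟫ ≤ ⟪y, p⟫) :
    y = ⟪y, p⟫ • p := by
  by_contra hne
  set w := y - ⟪y, p⟫ • p with hw
  have hw0 : w ≠ 0 := fun h0 => hne (sub_eq_zero.1 h0)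
  have hpp : ⟪p, p⟫ = 1 := by rw [real_inner_self_eq_norm_sq, hp]; norm_num
  have hwp : ⟪w, p⟫ = 0 := by
    rw [hw, inner_sub_left, inner_smul_left, hpp]; simp
  have hpw : ⟪p, w⟫ = 0 := by rw [real_inner_comm]; exact hwp
  have hyw : ⟪y, w⟫ = ‖w‖ ^ 2 := by
    have : y = w + ⟪y, p⟫ • p := by rw [hw]; abel
    conv_lhs => rw [this]
    rw [inner_add_left, inner_smul_left, hpw, real_inner_self_eq_norm_sq]; simp
  have hnw : 0 < ‖w‖ := norm_pos_iff.2 hw0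
  let q : ℝ → EuclideanSpace ℝ (Fin d) := fun t => cos t • p + (sin t * ‖w‖⁻¹) • w
  have hq0 : q 0 = p := by simp [q]
  have hqc : Continuous q := by fun_prop
  have hqn : ∀ t, q t ∈ Metric.sphere (0 : EuclideanSpace ℝ (Fin d)) 1 := by
    intro t
    rw [mem_sphere_zero_iff_norm, ← sq_eq_sq₀ (norm_nonneg _) zero_le_one,
      ← real_inner_self_eq_norm_sq]
    simp only [q, inner_add_left, inner_add_right, inner_smul_left, inner_smul_right, hpp, hwp, hpw,
      real_inner_self_eq_norm_sq w]
    simp only [conj_trivial]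
    field_simp
    nlinarith [sin_sq_add_cos_sq t]
  have hmax : IsLocalMax (fun t => ⟪y, q t⟫) 0 := by
    have : ∀ᶠ t in nhds (0 : ℝ), dist (q t) p < ε := by
      have h1 : Filter.Tendsto (fun t => dist (q t) p) (nhds 0) (nhds (dist (q 0) p)) :=
        (hqc.dist continuous_const).continuousAt
      rw [hq0, dist_self] at h1
      exact h1.eventually (gt_mem_nhds hε)
    filter_upwards [this] with t ht
    rw [hq0]
    exact h (q t) (hqn t) ht
  have hder : HasDerivAt (fun t => ⟪y, q t⟫) ‖w‖ 0 := by
    have e : (fun t => ⟪y, q t⟫) = fun t => cos t * ⟪y, p⟫ + sin t * ‖w‖ := by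
      funext t
      simp only [q, inner_add_right, inner_smul_right, hyw]
      field_simp
    rw [e]
    have := ((hasDerivAt_cos 0).mul_const ⟪y, p⟫).add ((hasDerivAt_sin 0).mul_const ‖w‖)
    exact this.congr_deriv (by simp)
  exact hnw.ne' (hmax.hasDerivAt_eq_zero hder)

/-- an interior point stays in the polytope when one vertex moves a little -/
lemma mem_perturbed {d : ℕ} {V : Set (EuclideanSpace ℝ (Fin d))} (hfin : V.Finite)
    {c : EuclideanSpace ℝ (Fin d)} (hc : c ∈ interior (convexHull ℝ V)) :
    ∃ ε > 0, ∀ ρ : EuclideanSpace ℝ (Fin d) → EuclideanSpace ℝ (Fin d),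
      (∀ v, dist (ρ v) v < ε) → c ∈ convexHull ℝ (ρ '' V) := by
  obtain ⟨r, hr, hball⟩ := Metric.mem_nhds_iff.1 (mem_interior_iff_mem_nhds.1 hc)
  refine ⟨r / 2, by positivity, fun ρ hρ => ?_⟩
  by_contra hcon
  obtain ⟨f, b, hfb, hfV⟩ := geometric_hahn_banach_point_closed (convex_convexHull ℝ (ρ '' V))
    (((hfin.image ρ).isCompact_convexHull ℝ).isClosed) hcon
  set y := (InnerProductSpace.toDual ℝ (EuclideanSpace ℝ (Fin d))).symm f with hy
  have hfy : ∀ x, f x = ⟪y, x⟫ := fun x => by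
    rw [hy, InnerProductSpace.toDual_symm_apply]
  have hV : ∀ v ∈ V, f c - r / 2 * ‖y‖ ≤ f v := by
    intro v hv
    have h1 : f c < f (ρ v) := hfb.trans (hfV _ (subset_convexHull ℝ _ ⟨v, hv, rfl⟩))
    have h2 : f (ρ v) - f v ≤ r / 2 * ‖y‖ := by
      rw [← map_sub, hfy]
      calc ⟪y, ρ v - v⟫ ≤ ‖y‖ * ‖ρ v - v‖ := real_inner_le_norm _ _
        _ ≤ ‖y‖ * (r / 2) := by
          gcongr
          rw [← dist_eq_norm]; exact (hρ v).le
        _ = _ := mul_comm _ _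
    linarith
  have hy0 : y ≠ 0 := by
    intro h0
    obtain ⟨v, hv⟩ : V.Nonempty := by
      rw [← convexHull_nonempty_iff (𝕜 := ℝ)]; exact ⟨c, interior_subset hc⟩
    have h1 := hfV _ (subset_convexHull ℝ _ ⟨v, hv, rfl⟩)
    rw [hfy, h0, inner_zero_left] at hfb h1
    linarith
  have hyn : 0 < ‖y‖ := norm_pos_iff.2 hy0
  have hx : c - (3 * r / 4 * ‖y‖⁻¹) • y ∈ convexHull ℝ V := by
    apply hball
    rw [Metric.mem_ball, dist_eq_norm, sub_sub_cancel_left, norm_neg, norm_smul, norm_mul,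
      norm_inv, norm_norm, mul_assoc, inv_mul_cancel₀ hyn.ne', Real.norm_of_nonneg (by positivity)]
    linarith
  have h3 := hull_ge f hV _ hx
  rw [map_sub, map_smul, hfy y, real_inner_self_eq_norm_sq, smul_eq_mul] at h3
  have : 3 * r / 4 * ‖y‖⁻¹ * ‖y‖ ^ 2 = 3 * r / 4 * ‖y‖ := by field_simp
  rw [this] at h3
  nlinarith [mul_pos hr hyn]

open Classical in
/-- moving the vertex `p` to `q` -/
noncomputable def moveVertex {d : ℕ} (p q v : EuclideanSpace ℝ (Fin d)) :
    EuclideanSpace ℝ (Fin d) := if v = p then q else v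

lemma moveVertex_self {d : ℕ} (p q : EuclideanSpace ℝ (Fin d)) : moveVertex p q p = q := by
  simp [moveVertex]

lemma moveVertex_ne {d : ℕ} (p q : EuclideanSpace ℝ (Fin d)) {v : EuclideanSpace ℝ (Fin d)}
    (h : v ≠ p) : moveVertex p q v = v := by
  simp [moveVertex, h]

lemma moveVertex_dist {d : ℕ} {p q : EuclideanSpace ℝ (Fin d)} {ε : ℝ} (h : dist q p < ε)
    (v : EuclideanSpace ℝ (Fin d)) : dist (moveVertex p q v) v < ε := by
  by_cases hv : v = p
  · rw [hv, moveVertex_self]; exact h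
  · rw [moveVertex_ne p q hv, dist_self]; exact lt_of_le_of_lt dist_nonneg h

lemma moveVertex_image {d : ℕ} {p q : EuclideanSpace ℝ (Fin d)} {V : Set (EuclideanSpace ℝ (Fin d))}
    (hp : p ∈ V) : moveVertex p q '' V = (V \ {p}) ∪ {q} := by
  ext x
  constructor
  · rintro ⟨v, hv, rfl⟩
    by_cases h : v = p
    · right; rw [h, moveVertex_self]; rfl
    · left; rw [moveVertex_ne p q h]; exact ⟨hv, h⟩
  · rintro (⟨hx, hxp⟩ | hx)
    · exact ⟨x, hx, moveVertex_ne p q hxp⟩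
    · exact ⟨p, hp, by rw [moveVertex_self]; exact hx.symm⟩

lemma perturb_functional {d : ℕ} {V S : Set (EuclideanSpace ℝ (Fin d))} (hfin : V.Finite)
    {p c : EuclideanSpace ℝ (Fin d)} (ℓ φ : EuclideanSpace ℝ (Fin d) →L[ℝ] ℝ)
    (h1 : ∀ v ∈ S, ℓ (v - c) = 1) (h2 : ∀ v ∈ V, v ∉ S → ℓ (v - c) < 1)
    (h3 : p ∈ S → φ (p - c) = 1) (h4 : p ∈ S → ∀ w ∈ S, w ≠ p → φ (w - c) = 0) :
    ∀ᶠ q in nhds p, ∃ L : EuclideanSpace ℝ (Fin d) →L[ℝ] ℝ,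
      (∀ v ∈ S, L (moveVertex p q v - c) = 1) ∧
      ∀ v ∈ V, v ∉ S → L (moveVertex p q v - c) < 1 := by
  by_cases hpS : p ∈ S
  · have hφc : Continuous fun q => φ (q - c) := by fun_prop
    have hℓc : Continuous fun q => ℓ (q - c) := by fun_prop
    let t : EuclideanSpace ℝ (Fin d) → ℝ := fun q => (1 - ℓ (q - c)) / φ (q - c)
    have ht : ContinuousAt t p := by
      apply ContinuousAt.div
      · exact (continuous_const.sub hℓc).continuousAt
      · exact hφc.continuousAt
      · rw [h3 hpS]; exact one_ne_zero
    have ht0 : t p = 0 := by simp only [t]; rw [h1 p hpS]; simp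
    have e1 : ∀ᶠ q in nhds p, φ (q - c) ≠ 0 := by
      apply hφc.continuousAt.eventually_ne
      rw [h3 hpS]; exact one_ne_zero
    have e2 : ∀ᶠ q in nhds p, ∀ v ∈ V, v ∉ S → ℓ (v - c) + t q * φ (v - c) < 1 := by
      rw [Filter.eventually_all_finite hfin]
      intro v hv
      by_cases hvS : v ∈ S
      · exact Filter.Eventually.of_forall fun q h => absurd hvS h
      · have : ContinuousAt (fun q => ℓ (v - c) + t q * φ (v - c)) p :=
          continuousAt_const.add (ht.mul continuousAt_const)
        have h5 := this.eventually_lt (continuousAt_const (y := (1 : ℝ)))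
          (by rw [ht0, zero_mul, add_zero]; exact h2 v hv hvS)
        filter_upwards [h5] with q hq _ using hq
    filter_upwards [e1, e2] with q hq1 hq2
    refine ⟨ℓ + t q • φ, ?_, ?_⟩
    · intro v hv
      by_cases hvp : v = p
      · rw [hvp, moveVertex_self]
        change ℓ (q - c) + t q * φ (q - c) = 1
        simp only [t]
        rw [div_mul_cancel₀ _ hq1]; ring
      · rw [moveVertex_ne p q hvp]
        change ℓ (v - c) + t q * φ (v - c) = 1
        rw [h1 v hv, h4 hpS v hv hvp]; ring
    · intro v hv hvS
      have hvp : v ≠ p := fun h => hvS (h ▸ hpS)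
      rw [moveVertex_ne p q hvp]
      exact hq2 v hv hvS
  · by_cases hpV : p ∈ V
    · have hℓc : Continuous fun q => ℓ (q - c) := by fun_prop
      have e := hℓc.continuousAt.eventually_lt (continuousAt_const (y := (1 : ℝ))) (h2 p hpV hpS)
      filter_upwards [e] with q hq
      refine ⟨ℓ, ?_, ?_⟩
      · intro v hv
        rw [moveVertex_ne p q (fun h => hpS (h ▸ hv))]; exact h1 v hv
      · intro v hv hvS
        by_cases hvp : v = p
        · rw [hvp, moveVertex_self]; exact hq
        · rw [moveVertex_ne p q hvp]; exact h2 v hv hvS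
    · refine Filter.Eventually.of_forall fun q => ⟨ℓ, ?_, ?_⟩
      · intro v hv
        rw [moveVertex_ne p q (fun h => hpS (h ▸ hv))]; exact h1 v hv
      · intro v hv hvS
        rw [moveVertex_ne p q (fun h => hpV (h ▸ hv))]; exact h2 v hv hvS

lemma interior_ne {d : ℕ} {V : Set (EuclideanSpace ℝ (Fin d))} (hVsph : V ⊆ Metric.sphere 0 1)
    {c : EuclideanSpace ℝ (Fin d)} (hc : c ∈ interior (convexHull ℝ V))
    {p : EuclideanSpace ℝ (Fin d)} (hp : p ∈ V) : p ≠ c := by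
  rintro rfl
  have h1 : p ∈ interior (Metric.closedBall (0 : EuclideanSpace ℝ (Fin d)) 1) :=
    interior_mono (convexHull_min (hVsph.trans Metric.sphere_subset_closedBall)
      (convex_closedBall _ _)) hc
  rw [interior_closedBall _ one_ne_zero, mem_ball_zero_iff] at h1
  have h2 := hVsph hp
  rw [mem_sphere_zero_iff_norm] at h2
  linarith

/-- volume of the simplex over the facet `F` with apex `c` -/
noncomputable def coneVol {d : ℕ} (c : EuclideanSpace ℝ (Fin d))
    (F : Set (EuclideanSpace ℝ (Fin d))) : ℝ :=
  (volume (convexHull ℝ (insert c (F.extremePoints ℝ)))).toReal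

section
variable {d : ℕ} (hd : 2 ≤ d) {V : Set (EuclideanSpace ℝ (Fin d))} (hfin : V.Finite)
  (hdim : affineSpan ℝ V = ⊤)
  (hvert : (convexHull ℝ V).extremePoints ℝ = V)
  (hsimp : ∀ F : Set (EuclideanSpace ℝ (Fin d)), IsFacet (convexHull ℝ V) F →
      (F.extremePoints ℝ).ncard = d)
  (𝒢 : Finset (Set (EuclideanSpace ℝ (Fin d))))
  (h𝒢 : ∀ F, F ∈ 𝒢 ↔ IsFacet (convexHull ℝ V) F)

include hfin hvert h𝒢

lemma facet_sub {F : Set (EuclideanSpace ℝ (Fin d))} (hF : F ∈ 𝒢) : F.extremePoints ℝ ⊆ V := by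
  rw [(facet_hull hfin hvert ((h𝒢 F).1 hF).1).1]; exact Set.inter_subset_right

lemma facet_inj : ∀ F ∈ 𝒢, ∀ F' ∈ 𝒢, F.extremePoints ℝ = F'.extremePoints ℝ → F = F' := by
  intro F hF F' hF' h
  rw [(facet_hull hfin hvert ((h𝒢 F).1 hF).1).2, (facet_hull hfin hvert ((h𝒢 F').1 hF').1).2, h]

lemma facet_fin_vol {c : EuclideanSpace ℝ (Fin d)} {F : Set (EuclideanSpace ℝ (Fin d))}
    (hF : F ∈ 𝒢) : volume (convexHull ℝ (insert c (F.extremePoints ℝ))) ≠ ⊤ :=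
  ((((hfin.subset (facet_sub hfin hvert 𝒢 h𝒢 hF)).insert c).isCompact_convexHull
    ℝ).measure_lt_top).ne

include hd hdim hsimp

lemma volsum {c : EuclideanSpace ℝ (Fin d)} (hc : c ∈ interior (convexHull ℝ V)) :
    ∑ F ∈ 𝒢, coneVol c F = (volume (convexHull ℝ V)).toReal := by
  unfold coneVol
  rw [← ENNReal.toReal_sum (fun F hF => facet_fin_vol hfin hvert 𝒢 h𝒢 hF)]
  congr 1
  apply le_antisymm
  · have := fan_lower_bound hfin id (c := c) (by simpa using interior_subset hc) 𝒢
      (fun F => F.extremePoints ℝ) (fun F hF => facet_sub hfin hvert 𝒢 h𝒢 hF)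
      (facet_inj hfin hvert 𝒢 h𝒢) ?_
    · simpa using this
    · intro F hF
      obtain ⟨ℓ, φ, h1, h2, -⟩ := facet_data hd hfin hdim hvert ((h𝒢 F).1 hF)
        (hsimp F ((h𝒢 F).1 hF)) hc
      exact ⟨ℓ, h1, h2⟩
  · refine le_trans ?_ (measure_biUnion_finset_le 𝒢 _)
    apply measure_mono_ae
    filter_upwards [facet_cover hd hfin hvert hc] with x hx hxP
    obtain ⟨F, hF, hxF⟩ := hx hxP
    exact Set.mem_iUnion₂.2 ⟨F, (h𝒢 F).2 hF, hxF⟩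

/-- translation identity -/
lemma sum_functional_zero {c : EuclideanSpace ℝ (Fin d)} (hc : c ∈ interior (convexHull ℝ V))
    (ℓ : Set (EuclideanSpace ℝ (Fin d)) → EuclideanSpace ℝ (Fin d) →L[ℝ] ℝ)
    (hℓ : ∀ F ∈ 𝒢, ∀ v ∈ F.extremePoints ℝ, ℓ F (v - c) = 1) (x : EuclideanSpace ℝ (Fin d)) :
    ∑ F ∈ 𝒢, coneVol c F * ℓ F x = 0 := by
  classical
  -- small translations
  have key : ∀ z, c + z ∈ interior (convexHull ℝ V) → 0 ≤ ∑ F ∈ 𝒢, coneVol c F * ℓ F z := by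
    intro z hz
    have e1 := volsum hd hfin hdim hvert hsimp 𝒢 h𝒢 hc
    have e2 := volsum hd hfin hdim hvert hsimp 𝒢 h𝒢 hz
    have e3 : ∀ F ∈ 𝒢, coneVol c F * (1 - ℓ F z) ≤ coneVol (c + z) F := by
      intro F hF
      have hcS : c ∉ F.extremePoints ℝ := by
        intro h
        have := hℓ F hF c h
        simp at this
      have := vol_shear (T := insert c (F.extremePoints ℝ)) (-(ℓ F)) z ((1 + ℓ F c) • z)
        (moveVertex c (c + z)) (by
          rintro v (rfl | hv)
          · rw [moveVertex_self, add_assoc, ← add_smul]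
            simp
          · rw [moveVertex_ne c _ (fun h => hcS (h ▸ hv)), add_assoc, ← add_smul]
            have h := hℓ F hF v hv
            rw [map_sub] at h
            have : (-(ℓ F)) v + (1 + ℓ F c) = 0 := by
              change -(ℓ F v) + _ = 0
              linarith
            rw [this]; simp)
      rw [moveVertex_image (Set.mem_insert _ _)] at this
      have hset : insert c (F.extremePoints ℝ) \ {c} ∪ {c + z} =
          insert (c + z) (F.extremePoints ℝ) := by
        rw [Set.insert_sdiff_of_mem _ (Set.mem_singleton c), Set.sdiff_singleton_eq_self hcS,
          Set.union_singleton]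
      rw [hset] at this
      unfold coneVol
      rw [this, mul_comm]
      apply mul_le_mul_of_nonneg_right _ ENNReal.toReal_nonneg
      exact le_abs_self (1 + -(ℓ F) z)
    have e4 := Finset.sum_le_sum e3
    rw [e2, ← e1] at e4
    simp only [mul_sub, mul_one, Finset.sum_sub_distrib] at e4
    linarith
  have hnear : ∀ᶠ s : ℝ in nhds 0, c + s • x ∈ interior (convexHull ℝ V) := by
    have hcont : Continuous fun s : ℝ => c + s • x := by fun_prop
    apply hcont.continuousAt.preimage_mem_nhds
    simpa using isOpen_interior.mem_nhds hc
  obtain ⟨ε, hε, hball⟩ := Metric.eventually_nhds_iff.1 hnear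
  have hs : ∀ s : ℝ, ∑ F ∈ 𝒢, coneVol c F * ℓ F (s • x) = s * ∑ F ∈ 𝒢, coneVol c F * ℓ F x := by
    intro s
    rw [Finset.mul_sum]
    refine Finset.sum_congr rfl fun F _ => ?_
    rw [map_smul, smul_eq_mul]; ring
  have k1 := key _ (hball (y := ε / 2) (by
    rw [dist_zero_right, Real.norm_of_nonneg (by positivity)]; linarith))
  have k2 := key _ (hball (y := -(ε / 2)) (by
    rw [dist_zero_right, norm_neg, Real.norm_of_nonneg (by positivity)]; linarith))
  rw [hs] at k1 k2
  nlinarith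

omit hdim hsimp in
/-- the facets through `p` carry positive volume -/
lemma facet_pos (hVsph : V ⊆ Metric.sphere 0 1)
    {c : EuclideanSpace ℝ (Fin d)} (hc : c ∈ interior (convexHull ℝ V))
    {p : EuclideanSpace ℝ (Fin d)} (hp : p ∈ V) :
    ∃ F ∈ 𝒢, p ∈ F.extremePoints ℝ ∧ 0 < coneVol c F := by
  by_contra! hcon
  have hcp : p ≠ c := interior_ne hVsph hc hp
  set Q := convexHull ℝ (insert c (V \ {p})) with hQ
  have hQc : IsClosed Q := (((hfin.subset Set.sdiff_subset).insert c).isCompact_convexHull ℝ).isClosed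
  have hnull : ∀ᵐ x : EuclideanSpace ℝ (Fin d), ∀ F ∈ 𝒢, p ∈ F.extremePoints ℝ →
      x ∉ convexHull ℝ (insert c (F.extremePoints ℝ)) := by
    rw [Filter.eventually_all_finset]
    intro F hF
    by_cases hpF : p ∈ F.extremePoints ℝ
    · have h0 : coneVol c F = 0 := le_antisymm (hcon F hF hpF) ENNReal.toReal_nonneg
      unfold coneVol at h0
      rw [ENNReal.toReal_eq_zero_iff] at h0
      have h1 := h0.resolve_right (facet_fin_vol hfin hvert 𝒢 h𝒢 hF)
      filter_upwards [measure_eq_zero_iff_ae_notMem.1 h1] with x hx _ using hx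
    · exact Filter.Eventually.of_forall fun x h => absurd h hpF
  have hae : ∀ᵐ x : EuclideanSpace ℝ (Fin d), x ∉ interior (convexHull ℝ V) \ Q := by
    filter_upwards [facet_cover hd hfin hvert hc, hnull] with x hx1 hx2 hx
    obtain ⟨F, hF, hxF⟩ := hx1 (interior_subset hx.1)
    have hF' := (h𝒢 F).2 hF
    by_cases hpF : p ∈ F.extremePoints ℝ
    · exact hx2 F hF' hpF hxF
    · apply hx.2
      refine convexHull_mono (Set.insert_subset_insert ?_) hxF
      intro v hv
      exact ⟨facet_sub hfin hvert 𝒢 h𝒢 hF' hv, fun h => hpF (h ▸ hv)⟩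
  have hz : volume (interior (convexHull ℝ V) \ Q) = 0 := measure_eq_zero_iff_ae_notMem.2 hae
  have hemp : interior (convexHull ℝ V) \ Q = ∅ :=
    (isOpen_interior.sdiff hQc).measure_eq_zero_iff volume |>.1 hz
  have hsub : convexHull ℝ V ⊆ Q := by
    have h1 : interior (convexHull ℝ V) ⊆ Q := Set.sdiff_eq_empty.1 hemp
    have h2 := closure_minimal h1 hQc
    rw [(convex_convexHull ℝ V).closure_interior_eq_closure_of_nonempty_interior ⟨c, hc⟩] at h2
    exact subset_closure.trans h2
  have hQsub : Q ⊆ convexHull ℝ V := by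
    apply convexHull_min _ (convex_convexHull ℝ V)
    exact Set.insert_subset (interior_subset hc) (Set.sdiff_subset.trans (subset_convexHull ℝ V))
  have hEq : convexHull ℝ V = Q := hsub.antisymm hQsub
  have hpe : p ∈ Q.extremePoints ℝ := by rw [← hEq, hvert]; exact hp
  rcases extremePoints_convexHull_subset hpe with h | h
  · exact hcp h
  · exact h.2 rfl

/-- the gradient of the volume at each vertex, with base point `c` -/
lemma main_c (hVsph : V ⊆ Metric.sphere 0 1) (hZ : PropertyZ V)
    {c : EuclideanSpace ℝ (Fin d)} (hc : c ∈ interior (convexHull ℝ V)) :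
    ∃ φ : Set (EuclideanSpace ℝ (Fin d)) → EuclideanSpace ℝ (Fin d) →
        EuclideanSpace ℝ (Fin d) →L[ℝ] ℝ,
      (∀ F ∈ 𝒢, ∀ v ∈ F.extremePoints ℝ, φ F v (v - c) = 1) ∧
      (∀ F ∈ 𝒢, ∀ v ∈ F.extremePoints ℝ, ∀ w ∈ F.extremePoints ℝ, w ≠ v → φ F v (w - c) = 0) ∧
      (∀ F ∈ 𝒢, ∀ v, v ∉ F.extremePoints ℝ → φ F v = 0) ∧
      (∀ F ∈ 𝒢, LinearIndependent ℝ
        (fun v : F.extremePoints ℝ => (v : EuclideanSpace ℝ (Fin d)) - c)) ∧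
      (∀ F ∈ 𝒢, Submodule.span ℝ (Set.range fun v : F.extremePoints ℝ =>
        (v : EuclideanSpace ℝ (Fin d)) - c) = ⊤) ∧
      (∀ p ∈ V, ∃ k > 0, ∀ x, ∑ F ∈ 𝒢, coneVol c F * φ F p x = k * ⟪p, x⟫) ∧
      (∀ x, ∑ p ∈ hfin.toFinset, ∑ F ∈ 𝒢, coneVol c F * φ F p x = 0) := by
  classical
  have hdata : ∀ F : Set (EuclideanSpace ℝ (Fin d)), ∃ (ℓ : EuclideanSpace ℝ (Fin d) →L[ℝ] ℝ)
      (φ : EuclideanSpace ℝ (Fin d) → EuclideanSpace ℝ (Fin d) →L[ℝ] ℝ), F ∈ 𝒢 →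
      (∀ v ∈ F.extremePoints ℝ, ℓ (v - c) = 1) ∧
      (∀ v ∈ V, v ∉ F.extremePoints ℝ → ℓ (v - c) < 1) ∧
      (∀ v ∈ F.extremePoints ℝ, φ v (v - c) = 1) ∧
      (∀ v ∈ F.extremePoints ℝ, ∀ w ∈ F.extremePoints ℝ, w ≠ v → φ v (w - c) = 0) ∧
      (∀ v, v ∉ F.extremePoints ℝ → φ v = 0) ∧
      (∀ x, ∑ v ∈ hfin.toFinset, φ v x = ℓ x) ∧
      LinearIndependent ℝ (fun v : F.extremePoints ℝ => (v : EuclideanSpace ℝ (Fin d)) - c) ∧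
      Submodule.span ℝ (Set.range fun v : F.extremePoints ℝ =>
        (v : EuclideanSpace ℝ (Fin d)) - c) = ⊤ := by
    intro F
    by_cases hF : F ∈ 𝒢
    · obtain ⟨ℓ, φ, h⟩ := facet_data hd hfin hdim hvert ((h𝒢 F).1 hF)
        (hsimp F ((h𝒢 F).1 hF)) hc
      exact ⟨ℓ, φ, fun _ => h⟩
    · exact ⟨0, 0, fun h => absurd h hF⟩
  choose ℓ φ hall using hdata
  refine ⟨φ, fun F hF => (hall F hF).2.2.1, fun F hF => (hall F hF).2.2.2.1,
    fun F hF => (hall F hF).2.2.2.2.1, fun F hF => (hall F hF).2.2.2.2.2.2.1,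
    fun F hF => (hall F hF).2.2.2.2.2.2.2, ?_, ?_⟩
  · intro p hp
    have hpn : ‖p‖ = 1 := mem_sphere_zero_iff_norm.1 (hVsph hp)
    have hpc := interior_ne hVsph hc hp
    obtain ⟨ε₁, hε₁, hZ'⟩ := hZ p hp
    obtain ⟨ε₂, hε₂, hmem⟩ := mem_perturbed hfin hc
    have hev : ∀ᶠ q in nhds p, ∀ F ∈ 𝒢, ∃ L : EuclideanSpace ℝ (Fin d) →L[ℝ] ℝ,
        (∀ v ∈ F.extremePoints ℝ, L (moveVertex p q v - c) = 1) ∧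
        ∀ v ∈ V, v ∉ F.extremePoints ℝ → L (moveVertex p q v - c) < 1 := by
      rw [Filter.eventually_all_finset]
      intro F hF
      obtain ⟨h1, h2, h3, h4, -⟩ := hall F hF
      exact perturb_functional hfin (ℓ F) (φ F p) h1 h2 (h3 p) (h4 p)
    obtain ⟨ε₃, hε₃, hev⟩ := Metric.eventually_nhds_iff.1 hev
    set g : EuclideanSpace ℝ (Fin d) →L[ℝ] ℝ := ∑ F ∈ 𝒢, coneVol c F • φ F p with hg
    have hgx : ∀ x, g x = ∑ F ∈ 𝒢, coneVol c F * φ F p x := by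
      intro x
      rw [hg, sum_apply]; rfl
    set y := (InnerProductSpace.toDual ℝ (EuclideanSpace ℝ (Fin d))).symm g with hy
    have hgy : ∀ x, g x = ⟪y, x⟫ := fun x => by
      rw [hy, InnerProductSpace.toDual_symm_apply]
    have hloc : ∀ q ∈ Metric.sphere (0 : EuclideanSpace ℝ (Fin d)) 1,
        dist q p < min ε₁ (min ε₂ ε₃) → ⟪y, q⟫ ≤ ⟪y, p⟫ := by
      intro q hq hqp
      have hq1 : dist q p < ε₁ := hqp.trans_le (min_le_left _ _)
      have hq2 : dist q p < ε₂ := hqp.trans_le ((min_le_right _ _).trans (min_le_left _ _))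
      have hq3 : dist q p < ε₃ := hqp.trans_le ((min_le_right _ _).trans (min_le_right _ _))
      have hb := fan_lower_bound hfin (moveVertex p q) (hmem _ (moveVertex_dist hq2)) 𝒢
        (fun F => F.extremePoints ℝ) (fun F hF => facet_sub hfin hvert 𝒢 h𝒢 hF)
        (facet_inj hfin hvert 𝒢 h𝒢) (hev hq3)
      rw [moveVertex_image hp] at hb
      have hb2 := hb.trans (hZ' q hq hq1)
      have hPfin : volume (convexHull ℝ V) ≠ ⊤ :=
        ((hfin.isCompact_convexHull ℝ).measure_lt_top).ne
      have hb3 := ENNReal.toReal_mono hPfin hb2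
      rw [ENNReal.toReal_sum, ← volsum hd hfin hdim hvert hsimp 𝒢 h𝒢 hc] at hb3
      swap
      · intro F hF
        exact (((((hfin.subset (facet_sub hfin hvert 𝒢 h𝒢 hF)).image _).insert c).isCompact_convexHull
          ℝ).measure_lt_top).ne
      have hterm : ∀ F ∈ 𝒢, coneVol c F + coneVol c F * φ F p (q - p) ≤
          (volume (convexHull ℝ (insert c (moveVertex p q '' F.extremePoints ℝ)))).toReal := by
        intro F hF
        obtain ⟨-, -, h3, h4, h5, -⟩ := hall F hF
        have hsh := vol_shear (T := insert c (F.extremePoints ℝ)) (φ F p) (q - p)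
          (-(φ F p c) • (q - p)) (moveVertex p q) (by
            intro v hv
            rw [add_assoc, ← add_smul, ← sub_eq_add_neg, ← map_sub]
            rcases hv with rfl | hv
            · rw [moveVertex_ne p q hpc.symm]; simp
            · by_cases hvp : v = p
              · rw [hvp] at hv ⊢
                rw [moveVertex_self, h3 p hv]; simp
              · rw [moveVertex_ne p q hvp]
                by_cases hpS : p ∈ F.extremePoints ℝ
                · rw [h4 p hpS v hv hvp]; simp
                · rw [h5 p hpS]; simp)
        rw [Set.image_insert_eq, moveVertex_ne p q hpc.symm] at hsh
        rw [hsh]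
        unfold coneVol
        rw [← mul_one_add, mul_comm]
        exact mul_le_mul_of_nonneg_right (le_abs_self _) ENNReal.toReal_nonneg
      have hb4 := (Finset.sum_le_sum hterm).trans hb3
      rw [Finset.sum_add_distrib, ← hgx, hgy, inner_sub_right] at hb4
      linarith
    have hyp := sphere_max y p hpn (by positivity) hloc
    set k := ⟪y, p⟫ with hk
    have hgk : ∀ x, ∑ F ∈ 𝒢, coneVol c F * φ F p x = k * ⟪p, x⟫ := by
      intro x
      rw [← hgx, hgy]
      conv_lhs => rw [hyp]
      rw [inner_smul_left]; rfl
    refine ⟨k, ?_, hgk⟩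
    have hpos : 0 < k * ⟪p, p - c⟫ := by
      rw [← hgk]
      obtain ⟨F, hF, hpF, hFpos⟩ := facet_pos hd hfin hvert 𝒢 h𝒢 hVsph hc hp
      apply Finset.sum_pos'
      · intro F hF
        obtain ⟨-, -, h3, h4, h5, -⟩ := hall F hF
        apply mul_nonneg ENNReal.toReal_nonneg
        by_cases hpS : p ∈ F.extremePoints ℝ
        · rw [h3 p hpS]; exact zero_le_one
        · rw [h5 p hpS]; exact le_rfl
      · refine ⟨F, hF, ?_⟩
        rw [(hall F hF).2.2.1 p hpF, mul_one]; exact hFpos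
    have hcn : ‖c‖ ≤ 1 := by
      rw [← mem_closedBall_zero_iff]
      exact convexHull_min (hVsph.trans Metric.sphere_subset_closedBall)
        (convex_closedBall _ _) (interior_subset hc)
    have hnn : 0 ≤ ⟪p, p - c⟫ := by
      rw [inner_sub_right, real_inner_self_eq_norm_sq, hpn]
      have := real_inner_le_norm p c
      rw [hpn] at this
      linarith
    exact pos_of_mul_pos_left hpos hnn
  · intro x
    rw [Finset.sum_comm, ← sum_functional_zero hd hfin hdim hvert hsimp 𝒢 h𝒢 hc ℓ
      (fun F hF => (hall F hF).1) x]
    refine Finset.sum_congr rfl fun F hF => ?_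
    rw [← Finset.mul_sum, (hall F hF).2.2.2.2.2.1 x]

/-- the origin is an interior point -/
lemma zero_interior (hVsph : V ⊆ Metric.sphere 0 1) (hZ : PropertyZ V) :
    (0 : EuclideanSpace ℝ (Fin d)) ∈ interior (convexHull ℝ V) := by
  obtain ⟨c, hc⟩ := interior_convexHull_nonempty_iff_affineSpan_eq_top.2 hdim
  obtain ⟨φ, -, -, -, -, -, hk, hsum⟩ := main_c hd hfin hdim hvert hsimp 𝒢 h𝒢 hVsph hZ hc
  by_contra h0
  obtain ⟨f, hf⟩ := geometric_hahn_banach_open_point (convex_convexHull ℝ V).interior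
    isOpen_interior h0
  rw [map_zero] at hf
  have hfle : ∀ z ∈ convexHull ℝ V, f z ≤ 0 := by
    intro z hz
    have hcl : z ∈ closure (interior (convexHull ℝ V)) := by
      rw [(convex_convexHull ℝ V).closure_interior_eq_closure_of_nonempty_interior ⟨c, hc⟩]
      exact subset_closure hz
    have : closure (interior (convexHull ℝ V)) ⊆ {z | f z ≤ 0} :=
      closure_minimal (fun a ha => (hf a ha).le) (isClosed_le f.continuous continuous_const)
    exact this hcl
  set y := (InnerProductSpace.toDual ℝ (EuclideanSpace ℝ (Fin d))).symm f with hy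
  have hfy : ∀ x, f x = ⟪x, y⟫ := fun x => by
    rw [real_inner_comm, hy, InnerProductSpace.toDual_symm_apply]
  have hnp : ∀ p ∈ hfin.toFinset, ∑ F ∈ 𝒢, coneVol c F * φ F p y ≤ 0 := by
    intro p hp
    obtain ⟨k, hk0, hk⟩ := hk p (hfin.mem_toFinset.1 hp)
    rw [hk, ← hfy]
    exact mul_nonpos_of_nonneg_of_nonpos hk0.le
      (hfle p (subset_convexHull ℝ V (hfin.mem_toFinset.1 hp)))
  have hz := (Finset.sum_eq_zero_iff_of_nonpos hnp).1 (hsum y)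
  have hfV : ∀ p ∈ V, 0 ≤ f p := by
    intro p hp
    obtain ⟨k, hk0, hk⟩ := hk p hp
    have := hz p (hfin.mem_toFinset.2 hp)
    rw [hk, ← hfy] at this
    exact ((mul_eq_zero.1 this).resolve_left hk0.ne').ge
  have := hull_ge f hfV c (interior_subset hc)
  linarith [hf c hc]

end

/-- comparison of the volume of a right-angled simplex with the Hausdorff measure of its base -/
lemma simplex_vol (n : ℕ) : ∃ κ > (0 : ℝ), ∀ (u : EuclideanSpace ℝ (Fin (n + 1)))
    (w : Fin n → EuclideanSpace ℝ (Fin (n + 1))), ‖u‖ = 1 → (∀ i, ⟪u, w i⟫ = 0) →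
    (volume (convexHull ℝ (insert u (insert 0 (Set.range w))))).toReal =
      κ * (μH[(n : ℝ)] (convexHull ℝ (insert 0 (Set.range w)))).toReal := by
  classical
  let b₀ := EuclideanSpace.basisFun (Fin n) ℝ
  let b₁ := EuclideanSpace.basisFun (Fin (n + 1)) ℝ
  set B₀ : Set (EuclideanSpace ℝ (Fin n)) := convexHull ℝ (insert 0 (Set.range b₀)) with hB₀
  set Δ : Set (EuclideanSpace ℝ (Fin (n + 1))) := convexHull ℝ
    (insert (b₁ (Fin.last n)) (insert 0 (Set.range fun i => b₁ (Fin.castSucc i)))) with hΔ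
  have : (μH[(n : ℝ)] : Measure (EuclideanSpace ℝ (Fin n))).IsAddHaarMeasure := by
    have := isAddHaarMeasure_hausdorffMeasure (E := EuclideanSpace ℝ (Fin n))
    rwa [finrank_euclideanSpace_fin] at this
  have hspan_aff : ∀ (m : ℕ) (T : Set (EuclideanSpace ℝ (Fin m))), 0 ∈ T →
      Submodule.span ℝ T = ⊤ → (interior (convexHull ℝ T)).Nonempty := by
    intro m T h0 hT
    rw [interior_convexHull_nonempty_iff_affineSpan_eq_top]
    refine (AffineSubspace.affineSpan_eq_top_iff_vectorSpan_eq_top_of_nonempty ℝ _ _ ⟨0, h0⟩).2 ?_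
    rw [vectorSpan_eq_span_vsub_set_right ℝ h0]
    simpa using hT
  have hB₀fin : μH[(n : ℝ)] B₀ ≠ ⊤ :=
    ((((Set.finite_range b₀).insert 0).isCompact_convexHull ℝ).measure_lt_top).ne
  have hB₀pos : 0 < μH[(n : ℝ)] B₀ := by
    apply Measure.measure_pos_of_nonempty_interior
    apply hspan_aff n _ (Set.mem_insert _ _)
    rw [Submodule.span_insert_zero]
    have := b₀.toBasis.span_eq
    rwa [OrthonormalBasis.coe_toBasis] at this
  have hΔfin : volume Δ ≠ ⊤ :=
    (((((Set.finite_range _).insert 0).insert _).isCompact_convexHull ℝ).measure_lt_top).ne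
  have hΔpos : 0 < volume Δ := by
    apply Measure.measure_pos_of_nonempty_interior
    apply hspan_aff (n + 1) _ (by simp)
    rw [eq_top_iff]
    have := b₁.toBasis.span_eq
    rw [OrthonormalBasis.coe_toBasis] at this
    rw [← this]
    apply Submodule.span_mono
    rintro _ ⟨i, rfl⟩
    refine Fin.lastCases ?_ (fun i => ?_) i
    · simp
    · right; right; exact ⟨i, rfl⟩
  have hh : 0 < (μH[(n : ℝ)] B₀).toReal := ENNReal.toReal_pos hB₀pos.ne' hB₀fin
  have hv : 0 < (volume Δ).toReal := ENNReal.toReal_pos hΔpos.ne' hΔfin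
  refine ⟨(volume Δ).toReal / (μH[(n : ℝ)] B₀).toReal, div_pos hv hh, ?_⟩
  intro u w hu huw
  -- orthonormal basis with last vector u
  obtain ⟨b, hb⟩ : ∃ b : OrthonormalBasis (Fin (n + 1)) ℝ (EuclideanSpace ℝ (Fin (n + 1))),
      b (Fin.last n) = u := by
    have ho : Orthonormal ℝ (Set.domRestrict {Fin.last n}
        (fun _ : Fin (n + 1) => u)) := by
      constructor
      · intro i; exact hu
      · intro i j hij
        exact absurd (Subsingleton.elim i j) hij
    obtain ⟨b, hb⟩ := ho.exists_orthonormalBasis_extension_of_card_eq (by simp)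
    exact ⟨b, hb _ rfl⟩
  -- isometric embedding
  have horth : Orthonormal ℝ (fun i : Fin n => b (Fin.castSucc i)) :=
    b.orthonormal.comp _ (Fin.castSucc_injective n)
  let e : EuclideanSpace ℝ (Fin n) →ₗ[ℝ] EuclideanSpace ℝ (Fin (n + 1)) :=
    b₀.toBasis.constr ℝ (fun i => b (Fin.castSucc i))
  have heb : ∀ i, e (b₀ i) = b (Fin.castSucc i) := by
    intro i
    have := b₀.toBasis.constr_basis ℝ (fun i => b (Fin.castSucc i)) i
    rwa [OrthonormalBasis.coe_toBasis] at this
  have hex : ∀ x, e x = ∑ i, x i • b (Fin.castSucc i) := by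
    intro x
    simp only [e, Module.Basis.constr_apply_fintype]
    rfl
  have hisom : Isometry e := by
    apply AddMonoidHomClass.isometry_of_norm
    intro x
    rw [← sq_eq_sq₀ (norm_nonneg _) (norm_nonneg _), ← real_inner_self_eq_norm_sq, hex,
      horth.inner_sum, EuclideanSpace.norm_sq_eq]
    refine Finset.sum_congr rfl fun i _ => ?_
    simp [sq]
  have heu : ∀ x, ⟪u, e x⟫ = 0 := by
    intro x
    rw [hex, inner_sum]
    refine Finset.sum_eq_zero fun i _ => ?_
    rw [inner_smul_right, ← hb, b.orthonormal.2 (Fin.castSucc_ne_last i).symm, mul_zero]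
  let w' : Fin n → EuclideanSpace ℝ (Fin n) := fun i =>
    WithLp.toLp 2 (fun j => ⟪b (Fin.castSucc j), w i⟫)
  have hew : ∀ i, e (w' i) = w i := by
    intro i
    rw [hex]
    conv_rhs => rw [← b.sum_repr' (w i), Fin.sum_univ_castSucc, hb, huw, zero_smul, add_zero]
  let M : EuclideanSpace ℝ (Fin n) →ₗ[ℝ] EuclideanSpace ℝ (Fin n) := b₀.toBasis.constr ℝ w'
  have hM : ∀ i, M (b₀ i) = w' i := by
    intro i
    have := b₀.toBasis.constr_basis ℝ w' i
    rwa [OrthonormalBasis.coe_toBasis] at this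
  let G₀ : (EuclideanSpace ℝ (Fin n) × ℝ) →ₗ[ℝ] EuclideanSpace ℝ (Fin (n + 1)) :=
    e.coprod (LinearMap.toSpanSingleton ℝ _ u)
  have hG₀ : ∀ x t, G₀ (x, t) = e x + t • u := by
    intro x t; simp [G₀]
  have huu : ⟪u, u⟫ = 1 := by rw [real_inner_self_eq_norm_sq, hu]; norm_num
  have hinj : Function.Injective G₀ := by
    rw [injective_iff_map_eq_zero]
    rintro ⟨x, t⟩ hxt
    rw [hG₀] at hxt
    have ht : t = 0 := by
      have h1 : ⟪u, e x + t • u⟫ = 0 := by rw [hxt, inner_zero_right]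
      rw [inner_add_right, inner_smul_right, heu, huu, zero_add, mul_one] at h1
      exact h1
    rw [ht, zero_smul, add_zero] at hxt
    have hx : x = 0 := hisom.injective (by rw [hxt, map_zero])
    rw [hx, ht]; rfl
  let G : (EuclideanSpace ℝ (Fin n) × ℝ) ≃ₗ[ℝ] EuclideanSpace ℝ (Fin (n + 1)) :=
    LinearEquiv.ofInjectiveOfFinrankEq G₀ hinj (by simp)
  have hG : ∀ x t, G (x, t) = e x + t • u := fun x t => hG₀ x t
  let L : EuclideanSpace ℝ (Fin (n + 1)) →ₗ[ℝ] EuclideanSpace ℝ (Fin (n + 1)) :=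
    G.toLinearMap ∘ₗ (M.prodMap (LinearMap.id : ℝ →ₗ[ℝ] ℝ)) ∘ₗ G.symm.toLinearMap
  have hdet : LinearMap.det L = LinearMap.det M := by
    simp only [L]
    rw [LinearMap.det_conj, LinearMap.det_prodMap, LinearMap.det_id, mul_one]
  have hLG : ∀ (x : EuclideanSpace ℝ (Fin n)) (t : ℝ), L (e x + t • u) = e (M x) + t • u := by
    intro x t
    have hs : G.symm (e x + t • u) = (x, t) := by rw [← hG x t, LinearEquiv.symm_apply_apply]
    change G (M (G.symm (e x + t • u)).1, (G.symm (e x + t • u)).2) = _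
    rw [hs, hG]
  have hLb : ∀ i, L (b (Fin.castSucc i)) = w i := by
    intro i
    have := hLG (b₀ i) 0
    rwa [zero_smul, add_zero, add_zero, heb, hM, hew] at this
  have hLu : L u = u := by
    have := hLG 0 1
    simpa using this
  -- volume side
  have hset1 : convexHull ℝ (insert u (insert 0 (Set.range w))) =
      L '' convexHull ℝ (insert u (insert 0 (Set.range fun i => b (Fin.castSucc i)))) := by
    rw [LinearMap.image_convexHull, Set.image_insert_eq, Set.image_insert_eq, hLu, map_zero,
      ← Set.range_comp]
    congr 4
    funext i; exact (hLb i).symm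
  have hset2 : convexHull ℝ (insert u (insert 0 (Set.range fun i => b (Fin.castSucc i)))) =
      b.repr.symm.toLinearEquiv.toLinearMap '' Δ := by
    rw [hΔ, LinearMap.image_convexHull, Set.image_insert_eq, Set.image_insert_eq, map_zero,
      ← Set.range_comp]
    have hbb : ∀ i, b.repr.symm.toLinearEquiv.toLinearMap (b₁ i) = b i := by
      intro i
      simp [b₁]
    rw [hbb, hb]
    congr 4
  have hvol2 : volume (b.repr.symm.toLinearEquiv.toLinearMap '' Δ) = volume Δ := by
    have h1 : b.repr.symm.toLinearEquiv.toLinearMap '' Δ = b.repr ⁻¹' Δ := by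
      change b.repr.symm.toEquiv '' Δ = _
      rw [Equiv.image_eq_preimage_symm]; rfl
    rw [h1]
    exact b.repr.measurePreserving.measure_preimage
      ((((Set.finite_range _).insert 0).insert _).isCompact_convexHull
        ℝ).measurableSet.nullMeasurableSet
  rw [hset1, Measure.addHaar_image_linearMap, hset2, hvol2, hdet]
  -- Hausdorff side
  have hset3 : convexHull ℝ (insert 0 (Set.range w)) = e '' (M '' B₀) := by
    rw [hB₀, LinearMap.image_convexHull, LinearMap.image_convexHull, Set.image_insert_eq,
      Set.image_insert_eq, map_zero, map_zero, ← Set.range_comp, ← Set.range_comp]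
    congr 3
    funext i
    simp [hM, hew]
  rw [hset3, hisom.hausdorffMeasure_image (Or.inl (Nat.cast_nonneg n)),
    Measure.addHaar_image_linearMap, ENNReal.toReal_mul, ENNReal.toReal_mul]
  field_simp

theorem propertyZ_vertex_formula (d : ℕ) (hd : 2 ≤ d)
    (V : Set (EuclideanSpace ℝ (Fin d))) (hfin : V.Finite)
    (hVsph : V ⊆ Metric.sphere 0 1)
    (hdim : affineSpan ℝ V = ⊤)
    (hvert : (convexHull ℝ V).extremePoints ℝ = V)
    (hZ : PropertyZ V)
    (hsimp : ∀ F : Set (EuclideanSpace ℝ (Fin d)), IsFacet (convexHull ℝ V) F →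
      (F.extremePoints ℝ).ncard = d)
    (p : EuclideanSpace ℝ (Fin d)) (hp : p ∈ V)
    (ℱ : Finset (Set (EuclideanSpace ℝ (Fin d))))
    (hℱ : ∀ F : Set (EuclideanSpace ℝ (Fin d)),
      F ∈ ℱ ↔ IsFacet (convexHull ℝ V) F ∧ p ∈ F ∧
        LinearIndependent ℝ ((↑) : (F.extremePoints ℝ \ {p} : Set (EuclideanSpace ℝ (Fin d))) →
          EuclideanSpace ℝ (Fin d)))
    (u : Set (EuclideanSpace ℝ (Fin d)) → EuclideanSpace ℝ (Fin d))
    (hu_norm : ∀ F ∈ ℱ, ‖u F‖ = 1)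
    (hu_orth : ∀ F ∈ ℱ, ∀ w ∈ F.extremePoints ℝ \ {p}, ⟪u F, w⟫ = 0)
    (hu_pos : ∀ F ∈ ℱ, 0 < ⟪u F, p⟫)
    (A : Set (EuclideanSpace ℝ (Fin d)) → ℝ)
    (hA : ∀ F ∈ ℱ, A F =
      (μH[((d : ℝ) - 1)] (convexHull ℝ ((F.extremePoints ℝ \ {p}) ∪ {0}))).toReal)
    (m : EuclideanSpace ℝ (Fin d)) (hm : m = ∑ F ∈ ℱ, A F • u F) :
    m ≠ 0 ∧ p = ‖m‖⁻¹ • m := by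
  classical
  have hGfin : {F | IsFacet (convexHull ℝ V) F}.Finite := by
    refine (hfin.powerset.image fun S => convexHull ℝ S).subset ?_
    intro F hF
    obtain ⟨h1, h2⟩ := facet_hull hfin hvert hF.1
    refine ⟨F.extremePoints ℝ, ?_, h2.symm⟩
    rw [h1]; exact Set.inter_subset_right
  set 𝒢 := hGfin.toFinset with h𝒢def
  have h𝒢 : ∀ F, F ∈ 𝒢 ↔ IsFacet (convexHull ℝ V) F := fun F => hGfin.mem_toFinset
  have h0 := zero_interior hd hfin hdim hvert hsimp 𝒢 h𝒢 hVsph hZ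
  obtain ⟨φ, hφ1, hφ0, hφz, hli, hspan, hk, -⟩ :=
    main_c hd hfin hdim hvert hsimp 𝒢 h𝒢 hVsph hZ h0
  obtain ⟨k, hk0, hk⟩ := hk p hp
  have hpn : ‖p‖ = 1 := mem_sphere_zero_iff_norm.1 (hVsph hp)
  obtain ⟨n, rfl⟩ : ∃ n, d = n + 1 := ⟨d - 1, by omega⟩
  obtain ⟨κ, hκ, hsv⟩ := simplex_vol n
  have hpS : ∀ F, IsFacet (convexHull ℝ V) F → (p ∈ F.extremePoints ℝ ↔ p ∈ F) := by
    intro F hF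
    rw [(facet_hull hfin hvert hF.1).1]
    exact ⟨fun h => h.1, fun h => ⟨h, hp⟩⟩
  have hsub : ℱ ⊆ 𝒢 := fun F hF => (h𝒢 F).2 ((hℱ F).1 hF).1
  have hsumEq : ∀ x, ∑ F ∈ 𝒢, coneVol 0 F * φ F p x = ∑ F ∈ ℱ, coneVol 0 F * φ F p x := by
    intro x
    symm
    apply Finset.sum_subset hsub
    intro F hF hFn
    have hFf := (h𝒢 F).1 hF
    have hpF : p ∉ F.extremePoints ℝ := by
      intro hpF
      apply hFn
      refine (hℱ F).2 ⟨hFf, (hpS F hFf).1 hpF, ?_⟩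
      have h1 : LinearIndependent ℝ
          ((↑) : F.extremePoints ℝ → EuclideanSpace ℝ (Fin (n + 1))) := by
        have := hli F hF
        simpa only [sub_zero] using this
      exact LinearIndepOn.mono (s := F.extremePoints ℝ) (v := id) h1 Set.sdiff_subset
    rw [hφz F hF p hpF]; simp
  have hterm : ∀ F ∈ ℱ, ∀ x, coneVol 0 F * φ F p x = κ * (A F * ⟪u F, x⟫) := by
    intro F hF x
    have hFG := hsub hF
    have hFf := (h𝒢 F).1 hFG
    have hpF : p ∈ F.extremePoints ℝ := (hpS F hFf).2 ((hℱ F).1 hF).2.1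
    have hup := hu_pos F hF
    set S := F.extremePoints ℝ with hS
    have hSfin : S.Finite := hfin.subset (facet_sub hfin hvert 𝒢 h𝒢 hFG)
    have hWfin : (S \ {p}).Finite := hSfin.subset Set.sdiff_subset
    have hWcard : (S \ {p}).ncard = n := by
      have := Set.ncard_sdiff_singleton_of_mem hpF
      rw [hsimp F hFf] at this
      simpa using this
    have hfW : Finite ↥(S \ {p}) := hWfin
    let eq := Finite.equivFinOfCardEq (α := ↥(S \ {p})) (n := n)
      (by rw [Nat.card_coe_set_eq, hWcard])
    let w : Fin n → EuclideanSpace ℝ (Fin (n + 1)) := fun i => (eq.symm i : EuclideanSpace ℝ _)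
    have hw : Set.range w = S \ {p} := by
      have : w = Subtype.val ∘ eq.symm := rfl
      rw [this, eq.symm.surjective.range_comp, Subtype.range_coe]
    have hmain := hsv (u F) w (hu_norm F hF) (fun i => hu_orth F hF _ (eq.symm i).2)
    have hAF : A F = (μH[(n : ℝ)] (convexHull ℝ (insert 0 (Set.range w)))).toReal := by
      rw [hA F hF, hw, Set.union_singleton]
      congr 3
      push_cast; ring
    rw [← hAF] at hmain
    have huu : ⟪u F, u F⟫ = 1 := by
      rw [real_inner_self_eq_norm_sq, hu_norm F hF]; norm_num
    have hune : ∀ v ∈ insert 0 (S \ {p}), ⟪u F, v⟫ = 0 := by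
      rintro v (rfl | hv)
      · exact inner_zero_right _
      · exact hu_orth F hF v hv
    have hsh := vol_shear (T := insert (u F) (insert 0 (S \ {p}))) (innerSL ℝ (u F)) (p - u F) 0
      (moveVertex (u F) p) (by
        rintro v (rfl | hv)
        · rw [moveVertex_self, innerSL_apply_apply, huu]; simp
        · have hv0 := hune v hv
          rw [moveVertex_ne, innerSL_apply_apply, hv0]
          · simp
          · rintro rfl
            rw [huu] at hv0
            exact one_ne_zero hv0)
    have hset : moveVertex (u F) p '' (insert (u F) (insert 0 (S \ {p}))) = insert 0 S := by
      rw [moveVertex_image (Set.mem_insert _ _),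
        Set.insert_sdiff_of_mem _ (Set.mem_singleton _), Set.sdiff_singleton_eq_self,
        Set.union_singleton, Set.insert_comm, Set.insert_sdiff_singleton,
        Set.insert_eq_of_mem hpF]
      intro h
      have := hune _ h
      rw [huu] at this
      exact one_ne_zero this
    rw [hset, ← hw, hmain, innerSL_apply_apply, inner_sub_right, huu, add_sub_cancel,
      abs_of_pos hup] at hsh
    have hcv : coneVol 0 F = ⟪u F, p⟫ * (κ * A F) := hsh
    have hfun : (⟪u F, p⟫ • (φ F p)).toLinearMap = (innerSL ℝ (u F)).toLinearMap := by
      apply LinearMap.ext_on_range (hspan F hFG)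
      rintro ⟨v, hv⟩
      change ⟪u F, p⟫ * φ F p (v - 0) = ⟪u F, v - 0⟫
      by_cases hvp : v = p
      · rw [hvp, hφ1 F hFG p hpF, sub_zero, mul_one]
      · rw [hφ0 F hFG p hpF v hv hvp, sub_zero, hu_orth F hF v ⟨hv, hvp⟩, mul_zero]
    have hfx : ⟪u F, p⟫ * φ F p x = ⟪u F, x⟫ := LinearMap.congr_fun hfun x
    rw [hcv, ← hfx]; ring
  have hmx : ∀ x, κ * ⟪m, x⟫ = k * ⟪p, x⟫ := by
    intro x
    rw [← hk, hsumEq, Finset.sum_congr rfl (fun F hF => hterm F hF x), ← Finset.mul_sum, hm,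
      sum_inner]
    simp only [inner_smul_left, conj_trivial]
  have hmp : m = (κ⁻¹ * k) • p := by
    apply ext_inner_right ℝ
    intro x
    rw [inner_smul_left, conj_trivial, mul_assoc, ← hmx, inv_mul_cancel_left₀ hκ.ne']
  have hpos : 0 < κ⁻¹ * k := by positivity
  have hmn : ‖m‖ = κ⁻¹ * k := by
    rw [hmp, norm_smul, hpn, mul_one, Real.norm_of_nonneg hpos.le]
  constructor
  · intro h
    rw [h, norm_zero] at hmn
    linarith
  · rw [hmn, hmp, smul_smul, inv_mul_cancel₀ hpos.ne', one_smul]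
end

section
/- Let d ≥ 2, let V ⊂ S^{d-1} be finite, and suppose P = conv V is a d-dimensional polytope whose vertex set is V and which satisfies Property Z. Let p ∈ V, and suppose all vertices of P adjacent to p (i.e. all q ∈ V such that the segment [p,q] is a 1-dimensional exposed face of P) are contained in a hyperplane H. Then p is a normal vector of H (that is, H = {x ∈ ℝ^d : ⟨p,x⟩ = c} for some c ∈ ℝ); consequently, all edges of P starting at p have equal length: |q₁ − p| = |q₂ − p| for all q₁, q₂ ∈ V adjacent to p. -/
open MeasureTheory Real RealInnerProductSpace

/-- Two vertices `p, q` of a polytope `P` are adjacent if the segment `[p,q]` is a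
`1`-dimensional exposed face of `P`. -/
def Adjacent {d : ℕ} (P : Set (EuclideanSpace ℝ (Fin d)))
    (p q : EuclideanSpace ℝ (Fin d)) : Prop :=
  p ≠ q ∧ IsExposed ℝ P (segment ℝ p q) ∧
    Module.finrank ℝ (affineSpan ℝ (segment ℝ p q)).direction = 1

lemma aux_exposed {E : Type*} [NormedAddCommGroup E] [InnerProductSpace ℝ E] {V : Set E}
    {p v : E} (hp : p ∈ V) (hv : v ∈ V) (l : StrongDual ℝ E) (hlv : l v = l p)
    (hl : ∀ w ∈ V, w ≠ p → w ≠ v → l w < l p) :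
    IsExposed ℝ (convexHull ℝ V) (segment ℝ p v) := by
  intro _
  refine ⟨l, ?_⟩
  have key : convexHull ℝ V ⊆ {x | l x ≤ l p ∧ (l x = l p → x ∈ segment ℝ p v)} := by
    apply convexHull_min
    · intro w hw
      by_cases h1 : w = p
      · subst h1; exact ⟨le_rfl, fun _ => left_mem_segment _ _ _⟩
      by_cases h2 : w = v
      · subst h2; exact ⟨hlv.le, fun _ => right_mem_segment _ _ _⟩
      have := hl w hw h1 h2
      exact ⟨this.le, fun h => absurd h this.ne⟩
    · rw [convex_iff_forall_pos]
      rintro x ⟨hx1, hx2⟩ y ⟨hy1, hy2⟩ a b ha hb hab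
      have hlin : l (a • x + b • y) = a * l x + b * l y := by simp
      have e : l p = a * l p + b * l p := by rw [← add_mul, hab, one_mul]
      refine ⟨by rw [hlin]; nlinarith, fun h => ?_⟩
      rw [hlin] at h
      have h1 : l x = l p := by
        by_contra hne
        have : l x < l p := lt_of_le_of_ne hx1 hne
        nlinarith
      have h2 : l y = l p := by
        by_contra hne
        have : l y < l p := lt_of_le_of_ne hy1 hne
        nlinarith
      exact convex_segment p v (hx2 h1) (hy2 h2) ha.le hb.le hab
  have hpP := subset_convexHull ℝ V hp
  have hvP := subset_convexHull ℝ V hv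
  ext x
  constructor
  · intro hx
    refine ⟨(convex_convexHull ℝ V).segment_subset hpP hvP hx, fun y hy => ?_⟩
    have : l x = l p := by
      obtain ⟨a, b, ha, hb, hab, rfl⟩ := hx
      simp [hlv, ← add_mul, hab]
    rw [this]; exact (key hy).1
  · rintro ⟨hx, h⟩
    exact (key hx).2 (le_antisymm (key hx).1 (h p hpP))

lemma aux_extreme {E : Type*} [NormedAddCommGroup E] [InnerProductSpace ℝ E] {S : Set E}
    (hS : S.Finite) {u : E} (hu : u ∈ (convexHull ℝ S).extremePoints ℝ) :
    ∃ g : StrongDual ℝ E, ∀ w ∈ S, w ≠ u → g w < g u := by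
  have hnot : u ∉ convexHull ℝ (S \ {u}) := by
    intro h
    have hc := ((convex_convexHull ℝ S).mem_extremePoints_iff_convex_sdiff.1 hu).2
    have : convexHull ℝ (S \ {u}) ⊆ convexHull ℝ S \ {u} :=
      convexHull_min (Set.sdiff_subset_sdiff_left (subset_convexHull ℝ S)) hc
    exact (this h).2 rfl
  obtain ⟨f, r, h1, h2⟩ := geometric_hahn_banach_closed_point (convex_convexHull ℝ (S \ {u}))
    ((hS.subset Set.sdiff_subset).isClosed_convexHull (𝕜 := ℝ)) hnot
  exact ⟨f, fun w hw hne => (h1 w (subset_convexHull ℝ _ ⟨hw, hne⟩)).trans h2⟩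

lemma aux_convexHull_extreme {E : Type*} [NormedAddCommGroup E] [InnerProductSpace ℝ E] {S : Set E}
    (hS : S.Finite) : convexHull ℝ S = convexHull ℝ ((convexHull ℝ S).extremePoints ℝ) := by
  have h := closure_convexHull_extremePoints (hS.isCompact_convexHull (𝕜 := ℝ)) (convex_convexHull ℝ S)
  have hf : ((convexHull ℝ S).extremePoints ℝ).Finite := hS.subset extremePoints_convexHull_subset
  rw [(hf.isClosed_convexHull (𝕜 := ℝ)).closure_eq] at h
  exact h.symm

lemma aux_finrank {E : Type*} [NormedAddCommGroup E] [InnerProductSpace ℝ E] {p q : E}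
    (h : p ≠ q) : Module.finrank ℝ (affineSpan ℝ (segment ℝ p q)).direction = 1 := by
  rw [← convexHull_pair, affineSpan_convexHull, direction_affineSpan, vectorSpan_pair]
  apply finrank_span_singleton
  simpa [sub_eq_zero] using h

lemma aux_ray {E : Type*} [NormedAddCommGroup E] [InnerProductSpace ℝ E] {p u : E} {a b : ℝ}
    (hu : u ≠ 0) (hp : ‖p‖ = 1) (ha : a ≠ 0) (hb : b ≠ 0) (h1 : ‖p + a • u‖ = 1)
    (h2 : ‖p + b • u‖ = 1) : a = b := by
  have e1 := norm_add_sq_real p (a • u)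
  have e2 := norm_add_sq_real p (b • u)
  rw [h1, hp, inner_smul_right, norm_smul, mul_pow, Real.norm_eq_abs, sq_abs] at e1
  rw [h2, hp, inner_smul_right, norm_smul, mul_pow, Real.norm_eq_abs, sq_abs] at e2
  have hu' : ‖u‖ ^ 2 ≠ 0 := by simpa using hu
  have f1 : 2 * inner ℝ p u + a * ‖u‖ ^ 2 = 0 := by
    apply mul_left_cancel₀ ha; linarith
  have f2 : 2 * inner ℝ p u + b * ‖u‖ ^ 2 = 0 := by
    apply mul_left_cancel₀ hb; linarith
  apply mul_right_cancel₀ hu'; linarith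

lemma aux_cone {d : ℕ} {V : Set (EuclideanSpace ℝ (Fin d))} (hfin : V.Finite)
    (hVsph : V ⊆ Metric.sphere 0 1)
    (hvert : (convexHull ℝ V).extremePoints ℝ = V)
    {p : EuclideanSpace ℝ (Fin d)} (hp : p ∈ V) :
    ∀ v ∈ V, v ≠ p → v - p ∈ ConvexCone.hull ℝ
      (convexHull ℝ ((fun q => q - p) '' {q ∈ V | Adjacent (convexHull ℝ V) p q})) := by
  set C := ConvexCone.hull ℝ
      (convexHull ℝ ((fun q => q - p) '' {q ∈ V | Adjacent (convexHull ℝ V) p q})) with hC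
  have hnorm : ∀ v ∈ V, ‖v‖ = 1 := fun v hv => by simpa using hVsph hv
  obtain ⟨f, hf⟩ := aux_extreme hfin (u := p) (by rw [hvert]; exact hp)
  set U : EuclideanSpace ℝ (Fin d) → EuclideanSpace ℝ (Fin d) :=
    fun v => (f p - f v)⁻¹ • (v - p) with hU
  have hpos : ∀ v ∈ V, v ≠ p → 0 < f p - f v := fun v hv hne => sub_pos.2 (hf v hv hne)
  have hUv : ∀ v ∈ V, v ≠ p → v - p = (f p - f v) • U v := by
    intro v hv hne
    simp only [hU]
    rw [smul_inv_smul₀ (hpos v hv hne).ne']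
  have hfU : ∀ v ∈ V, v ≠ p → f (U v) = -1 := by
    intro v hv hne
    have := hpos v hv hne
    simp only [hU, map_smul, map_sub, smul_eq_mul]
    field_simp
    ring
  set S := U '' (V \ {p}) with hS
  have hSfin : S.Finite := (hfin.subset Set.sdiff_subset).image U
  have hext : ∀ u ∈ (convexHull ℝ S).extremePoints ℝ, u ∈ C := by
    intro u hu
    obtain ⟨g, hg⟩ := aux_extreme hSfin hu
    obtain ⟨v, ⟨hv, hvp⟩, rfl⟩ := extremePoints_convexHull_subset hu
    have hvp : v ≠ p := hvp
    have hUne : U v ≠ 0 := by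
      intro h0
      have := hfU v hv hvp
      rw [h0] at this
      simp at this
    have hadj : Adjacent (convexHull ℝ V) p v := by
      refine ⟨hvp.symm, ?_, aux_finrank hvp.symm⟩
      have hl : ∀ w ∈ V, w ≠ p → (g + g (U v) • f) w - (g + g (U v) • f) p
          = (f p - f w) * (g (U w) - g (U v)) := by
        intro w hw hwp
        rw [← map_sub, hUv w hw hwp, map_smul]
        simp [hfU w hw hwp]
        left; ring
      refine aux_exposed hp hv (g + g (U v) • f) ?_ ?_
      · have := hl v hv hvp
        rw [sub_self, mul_zero] at this
        linarith
      · intro w hw hwp hwv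
        have h1 := hl w hw hwp
        have hne : U w ≠ U v := by
          intro he
          apply hwv
          have h2 := hUv w hw hwp
          have h3 := hUv v hv hvp
          rw [he] at h2
          have h4 := aux_ray hUne (hnorm p hp) (hpos w hw hwp).ne' (hpos v hv hvp).ne'
            (by rw [← h2, add_sub_cancel]; exact hnorm w hw)
            (by rw [← h3, add_sub_cancel]; exact hnorm v hv)
          rw [h4, ← h3] at h2
          exact sub_left_injective h2
        have h2 := hg (U w) ⟨w, ⟨hw, hwp⟩, rfl⟩ hne
        nlinarith [hpos w hw hwp]
    apply C.smul_mem (inv_pos.2 (hpos v hv hvp))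
    apply ConvexCone.subset_hull
    apply subset_convexHull
    exact ⟨v, ⟨hv, hadj⟩, rfl⟩
  have hconv : convexHull ℝ S ⊆ C := by
    rw [aux_convexHull_extreme hSfin]
    exact convexHull_min hext C.convex
  intro v hv hvp
  rw [hUv v hv hvp]
  exact C.smul_mem (hpos v hv hvp) (hconv (subset_convexHull ℝ S ⟨v, ⟨hv, hvp⟩, rfl⟩))

lemma aux_cone' {d : ℕ} {V : Set (EuclideanSpace ℝ (Fin d))} (hfin : V.Finite)
    (hVsph : V ⊆ Metric.sphere 0 1)
    (hvert : (convexHull ℝ V).extremePoints ℝ = V)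
    {p : EuclideanSpace ℝ (Fin d)} (hp : p ∈ V) {y : EuclideanSpace ℝ (Fin d)}
    (hy : y ∈ convexHull ℝ (V \ {p})) :
    ∃ s : ℝ, 0 < s ∧ ∃ b ∈ convexHull ℝ {q ∈ V | Adjacent (convexHull ℝ V) p q},
      y = p + s • (b - p) := by
  set N := {q ∈ V | Adjacent (convexHull ℝ V) p q}
  have h1 : convexHull ℝ (V \ {p}) ⊆ (fun x => x - p) ⁻¹' (ConvexCone.hull ℝ
      (convexHull ℝ ((fun q => q - p) '' N)) : Set (EuclideanSpace ℝ (Fin d))) := by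
    apply convexHull_min
    · rintro v ⟨hv, hvp⟩
      exact aux_cone hfin hVsph hvert hp v hv hvp
    · have := (ConvexCone.hull ℝ
        (convexHull ℝ ((fun q => q - p) '' N))).convex.translate_preimage_left (-p)
      simpa [sub_eq_add_neg] using this
  have h2 := h1 hy
  rw [Set.mem_preimage, SetLike.mem_coe,
    ConvexCone.mem_hull_of_convex (convex_convexHull ℝ _)] at h2
  obtain ⟨s, hs, z, hz, hzy⟩ := h2
  have h3 : convexHull ℝ ((fun q => q - p) '' N) ⊆ (fun z => z + p) ⁻¹' convexHull ℝ N := by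
    apply convexHull_min
    · rintro _ ⟨q, hq, rfl⟩
      simpa using subset_convexHull ℝ N hq
    · exact (convex_convexHull ℝ N).translate_preimage_left p
  refine ⟨s, hs, z + p, h3 hz, ?_⟩
  have : s • z = y - p := hzy
  rw [add_sub_cancel_right, this, add_sub_cancel]

lemma aux_nonempty {d : ℕ} (hd : 2 ≤ d) {V : Set (EuclideanSpace ℝ (Fin d))}
    (hdim : affineSpan ℝ V = ⊤) (p : EuclideanSpace ℝ (Fin d)) : (V \ {p}).Nonempty := by
  by_contra h
  rw [Set.not_nonempty_iff_eq_empty, Set.sdiff_eq_empty] at h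
  have h1 : (⊤ : AffineSubspace ℝ (EuclideanSpace ℝ (Fin d))) ≤ affineSpan ℝ {p} :=
    hdim ▸ affineSpan_mono ℝ h
  have h2 := AffineSubspace.direction_le h1
  rw [AffineSubspace.direction_top, direction_affineSpan, vectorSpan_singleton] at h2
  have h3 := Submodule.finrank_mono h2
  simp at h3
  omega

lemma aux_decomp {d : ℕ} (hd : 2 ≤ d) {V : Set (EuclideanSpace ℝ (Fin d))} (hfin : V.Finite)
    (hVsph : V ⊆ Metric.sphere 0 1) (hdim : affineSpan ℝ V = ⊤)
    (hvert : (convexHull ℝ V).extremePoints ℝ = V)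
    {p : EuclideanSpace ℝ (Fin d)} (hp : p ∈ V) {x : EuclideanSpace ℝ (Fin d)}
    (hx : x ∈ convexHull ℝ V) :
    ∃ t s : ℝ, 0 ≤ t ∧ t ≤ 1 ∧ 0 < s ∧
      ∃ b ∈ convexHull ℝ {q ∈ V | Adjacent (convexHull ℝ V) p q},
      p + s • (b - p) ∈ convexHull ℝ (V \ {p}) ∧ x = p + (t * s) • (b - p) := by
  have h1 : V = insert p (V \ {p}) := by simp [Set.insert_eq_of_mem hp]
  rw [h1, convexHull_insert (aux_nonempty hd hdim p), mem_convexJoin] at hx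
  obtain ⟨p', hp', y, hy, hx⟩ := hx
  rw [Set.mem_singleton_iff] at hp'
  subst hp'
  rw [segment_eq_image'] at hx
  obtain ⟨t, ⟨ht0, ht1⟩, rfl⟩ := hx
  obtain ⟨s, hs, b, hb, rfl⟩ := aux_cone' hfin hVsph hvert hp hy
  refine ⟨t, s, ht0, ht1, hs, b, hb, hy, ?_⟩
  simp [mul_smul]

lemma aux_inner_hull {d : ℕ} {N : Set (EuclideanSpace ℝ (Fin d))}
    {n : EuclideanSpace ℝ (Fin d)} {c : ℝ} (h : ∀ q ∈ N, ⟪n, q⟫ = c)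
    {b : EuclideanSpace ℝ (Fin d)} (hb : b ∈ convexHull ℝ N) : ⟪n, b⟫ = c := by
  have : convexHull ℝ N ⊆ {x | innerSL ℝ n x = c} :=
    convexHull_min (fun q hq => h q hq) (convex_hyperplane (innerSL ℝ n).isLinear c)
  exact this hb

lemma aux_vol {d : ℕ} (hd : 2 ≤ d) {V : Set (EuclideanSpace ℝ (Fin d))} (hfin : V.Finite)
    (hVsph : V ⊆ Metric.sphere 0 1) (hdim : affineSpan ℝ V = ⊤)
    (hvert : (convexHull ℝ V).extremePoints ℝ = V)
    {p : EuclideanSpace ℝ (Fin d)} (hp : p ∈ V)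
    {n : EuclideanSpace ℝ (Fin d)} {c : ℝ}
    (hadj : ∀ q ∈ V, Adjacent (convexHull ℝ V) p q → ⟪n, q⟫ = c) (hc : c < ⟪n, p⟫)
    {q : EuclideanSpace ℝ (Fin d)} (hq : ⟪n, p⟫ < ⟪n, q⟫) :
    volume (convexHull ℝ V) < volume (convexHull ℝ ((V \ {p}) ∪ {q})) := by
  set P := convexHull ℝ V with hP
  set Q := convexHull ℝ ((V \ {p}) ∪ {q}) with hQ
  set N := {q ∈ V | Adjacent P p q} with hN
  have hNH : ∀ b ∈ convexHull ℝ N, ⟪n, b⟫ = c := fun b hb =>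
    aux_inner_hull (fun q hq => hadj q hq.1 hq.2) hb
  have hNV : N ⊆ V \ {p} := fun v hv => ⟨hv.1, hv.2.1.symm⟩
  have hNV' := convexHull_mono (𝕜 := ℝ) hNV
  have hVQ : convexHull ℝ (V \ {p}) ⊆ Q := convexHull_mono Set.subset_union_left
  have hqQ : q ∈ Q := subset_convexHull ℝ _ (Or.inr rfl)
  set h := ⟪n, p⟫ - c with hh
  have hpos : 0 < h := sub_pos.2 hc
  set M : Set (EuclideanSpace ℝ (Fin d)) := {x | c < ⟪n, x⟫} with hM
  have hMo : IsOpen M := isOpen_lt continuous_const (by fun_prop)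
  set φ : Module.Dual ℝ (EuclideanSpace ℝ (Fin d)) := h⁻¹ • (innerSL ℝ n).toLinearMap with hφ
  have hφx : ∀ x, φ x = h⁻¹ * ⟪n, x⟫ := fun x => rfl
  set L := LinearMap.transvection φ (q - p) with hL
  have hdet : LinearMap.det L = 1 + φ (q - p) := LinearMap.transvection.det _ _
  have hφqp : 0 < φ (q - p) := by
    rw [hφx, inner_sub_right]; exact mul_pos (inv_pos.2 hpos) (sub_pos.2 hq)
  have hLx : ∀ x, L x = x + φ x • (q - p) := fun x => rfl
  set A := P ∩ M with hA
  set T : Set (EuclideanSpace ℝ (Fin d)) := (fun x => q + x) '' (L '' ((fun x => -p + x) '' A))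
    with hT
  have hvolT : volume T = ENNReal.ofReal (1 + φ (q - p)) * volume A := by
    rw [hT, Set.image_add_left, measure_preimage_add, Measure.addHaar_image_linearMap, hdet,
      Set.image_add_left, measure_preimage_add, abs_of_pos (by linarith)]
  have hdec : ∀ x ∈ P, ∃ t s : ℝ, 0 ≤ t ∧ t ≤ 1 ∧ 0 < s ∧
      ∃ b ∈ convexHull ℝ N,
      p + s • (b - p) ∈ convexHull ℝ (V \ {p}) ∧ x = p + (t * s) • (b - p) ∧
      ⟪n, x⟫ = ⟪n, p⟫ - (t * s) * h := by
    intro x hx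
    obtain ⟨t, s, h0, h1, hs, b, hb, hy, hxe⟩ := aux_decomp hd hfin hVsph hdim hvert hp hx
    refine ⟨t, s, h0, h1, hs, b, hb, hy, hxe, ?_⟩
    rw [hxe, inner_add_right, inner_smul_right, inner_sub_right, hNH b hb]
    ring
  -- the part above the hyperplane
  have hTsub : T ⊆ Q ∩ M := by
    rintro _ ⟨_, ⟨_, ⟨x, ⟨hxP, hxM⟩, rfl⟩, rfl⟩, rfl⟩
    obtain ⟨t, s, h0, h1, hs, b, hb, hy, hxe, hin⟩ := hdec x hxP
    have hxM : c < ⟪n, x⟫ := hxM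
    have hr0 : 0 ≤ t * s := mul_nonneg h0 hs.le
    set r := t * s
    have hr1 : r < 1 := by
      rw [hin] at hxM
      by_contra hcon
      have : 1 ≤ r := not_lt.1 hcon
      nlinarith
    have e : q + L (-p + x) = (1 - r) • q + r • b := by
      rw [hLx, hφx, hxe, neg_add_cancel_left, inner_smul_right, inner_sub_right, hNH b hb]
      have : h⁻¹ * (r * (c - ⟪n, p⟫)) = -r := by
        rw [show c - ⟪n, p⟫ = -h by rw [hh]; ring]
        field_simp
      rw [this]
      module
    simp only
    rw [e]
    refine ⟨convex_convexHull ℝ _ hqQ (hVQ (hNV' hb)) (by linarith) hr0 (by ring), ?_⟩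
    change c < _
    rw [inner_add_right, inner_smul_right, inner_smul_right, hNH b hb]
    nlinarith
  -- the part below the hyperplane
  have hBsub : P \ M ⊆ Q \ M := by
    rintro x ⟨hxP, hxM⟩
    refine ⟨hVQ ?_, hxM⟩
    obtain ⟨t, s, h0, h1, hs, b, hb, hy, hxe, hin⟩ := hdec x hxP
    have hxM : ⟪n, x⟫ ≤ c := not_lt.1 hxM
    have hr1 : 1 ≤ t * s := by
      rw [hin] at hxM
      by_contra hcon
      have : t * s < 1 := not_le.1 hcon
      nlinarith
    have hrs : t * s ≤ s := by nlinarith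
    have hb' := hNV' hb
    rcases eq_or_lt_of_le (hr1.trans hrs) with hs1 | hs1
    · have : t * s = 1 := le_antisymm (hrs.trans hs1.ge) hr1
      rw [hxe, this]
      simpa using hb'
    · have hs1' : 0 < s - 1 := by linarith
      have e : x = ((s - t * s) / (s - 1)) • b + ((t * s - 1) / (s - 1)) • (p + s • (b - p)) := by
        rw [hxe]
        match_scalars <;> field_simp <;> ring
      rw [e]
      refine convex_convexHull ℝ _ hb' hy (div_nonneg (by linarith) hs1'.le)
        (div_nonneg (by linarith) hs1'.le) ?_
      field_simp
      ring
  -- positivity of the volume above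
  have hPc : Convex ℝ P := convex_convexHull ℝ V
  have hint : (interior P).Nonempty := interior_convexHull_nonempty_iff_affineSpan_eq_top.2 hdim
  have hApos : 0 < volume A := by
    have hpcl : p ∈ closure (interior P) := by
      rw [hPc.closure_interior_eq_closure_of_nonempty_interior hint]
      exact subset_closure (subset_convexHull ℝ V hp)
    obtain ⟨z, hz⟩ := mem_closure_iff.1 hpcl M hMo hc
    have : IsOpen (M ∩ interior P) := hMo.inter isOpen_interior
    exact (this.measure_pos volume ⟨z, hz⟩).trans_le
      (measure_mono fun w hw => ⟨interior_subset hw.2, hw.1⟩)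
  have hPfin : volume P ≠ ⊤ := (hfin.isCompact_convexHull (𝕜 := ℝ)).measure_ne_top
  have hAfin : volume A ≠ ⊤ := ne_top_of_le_ne_top hPfin (measure_mono Set.inter_subset_left)
  have hBfin : volume (P \ M) ≠ ⊤ := ne_top_of_le_ne_top hPfin (measure_mono Set.sdiff_subset)
  rw [← measure_inter_add_sdiff P hMo.measurableSet, ← measure_inter_add_sdiff Q hMo.measurableSet]
  have hAT : volume A < volume T := by
    rw [hvolT]
    calc volume A = 1 * volume A := (one_mul _).symm
      _ < _ := by
        refine ENNReal.mul_lt_mul_left hApos.ne' hAfin ?_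
        rw [ENNReal.one_lt_ofReal]; linarith
  exact ENNReal.add_lt_add_of_lt_of_le hBfin (hAT.trans_le (measure_mono hTsub))
    (measure_mono hBsub)

lemma aux_localmax {d : ℕ} {p n : EuclideanSpace ℝ (Fin d)} (hp : ‖p‖ = 1) {ε : ℝ} (hε : 0 < ε)
    (h : ∀ q ∈ Metric.sphere (0 : EuclideanSpace ℝ (Fin d)) 1, dist q p < ε → ⟪n, q⟫ ≤ ⟪n, p⟫) :
    n = ⟪n, p⟫ • p := by
  by_contra hne
  set m := n - ⟪n, p⟫ • p with hm
  have hm0 : m ≠ 0 := sub_ne_zero.2 hne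
  have hmn : ‖m‖ ≠ 0 := norm_ne_zero_iff.2 hm0
  have hpp : ⟪p, p⟫ = 1 := by rw [real_inner_self_eq_norm_sq, hp]; norm_num
  have hpm : ⟪p, m⟫ = 0 := by
    rw [hm, inner_sub_right, inner_smul_right, hpp, real_inner_comm]; ring
  have hnm : ⟪n, m⟫ = ‖m‖ ^ 2 := by
    have : n = m + ⟪n, p⟫ • p := by rw [hm]; abel
    conv_lhs => rw [this]
    rw [inner_add_left, inner_smul_left, hpm, real_inner_self_eq_norm_sq]; simp
  let γ : ℝ → EuclideanSpace ℝ (Fin d) := fun θ => Real.cos θ • p + (Real.sin θ * ‖m‖⁻¹) • m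
  have hγ0 : γ 0 = p := by simp [γ]
  have hγc : Continuous γ := by fun_prop
  have hγs : ∀ θ, γ θ ∈ Metric.sphere (0 : EuclideanSpace ℝ (Fin d)) 1 := by
    intro θ
    have : ‖γ θ‖ ^ 2 = 1 := by
      simp only [γ]
      rw [norm_add_sq_real, inner_smul_left, inner_smul_right, hpm, norm_smul, norm_smul, hp,
        mul_pow, mul_pow, Real.norm_eq_abs, Real.norm_eq_abs, sq_abs, sq_abs]
      field_simp
      simp only [mul_zero, add_zero]
      linear_combination ‖m‖ * Real.sin_sq_add_cos_sq θ
    rw [mem_sphere_zero_iff_norm]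
    nlinarith [norm_nonneg (γ θ)]
  have hin : ∀ θ, ⟪n, γ θ⟫ = Real.cos θ * ⟪n, p⟫ + Real.sin θ * ‖m‖ := by
    intro θ
    simp only [γ]
    rw [inner_add_right, inner_smul_right, inner_smul_right, hnm]
    field_simp
  have hmax : IsLocalMax (fun θ => Real.cos θ * ⟪n, p⟫ + Real.sin θ * ‖m‖) 0 := by
    have h1 : ∀ᶠ θ in nhds (0 : ℝ), dist (γ θ) p < ε := by
      have := hγc.tendsto 0
      rw [hγ0] at this
      exact this (Metric.ball_mem_nhds p hε)
    filter_upwards [h1] with θ hθ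
    have := h (γ θ) (hγs θ) hθ
    rw [hin] at this
    simpa using this
  have hder : HasDerivAt (fun θ => Real.cos θ * ⟪n, p⟫ + Real.sin θ * ‖m‖)
      (-Real.sin 0 * ⟪n, p⟫ + Real.cos 0 * ‖m‖) 0 :=
    ((Real.hasDerivAt_cos 0).mul_const _).add ((Real.hasDerivAt_sin 0).mul_const _)
  have := hmax.hasDerivAt_eq_zero hder
  simp at this
  exact hm0 this

lemma aux_main {d : ℕ} (hd : 2 ≤ d) {V : Set (EuclideanSpace ℝ (Fin d))} (hfin : V.Finite)
    (hVsph : V ⊆ Metric.sphere 0 1) (hdim : affineSpan ℝ V = ⊤)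
    (hvert : (convexHull ℝ V).extremePoints ℝ = V) (hZ : PropertyZ V)
    {p : EuclideanSpace ℝ (Fin d)} (hp : p ∈ V)
    {n : EuclideanSpace ℝ (Fin d)} {c : ℝ}
    (hadj : ∀ q ∈ V, Adjacent (convexHull ℝ V) p q → ⟪n, q⟫ = c) (hc : c < ⟪n, p⟫) :
    n = ⟪n, p⟫ • p := by
  obtain ⟨ε, hε, h⟩ := hZ p hp
  refine aux_localmax (by simpa using hVsph hp) hε fun q hq hqp => ?_
  by_contra hcon
  exact absurd (h q hq hqp)
    (not_le.2 (aux_vol hd hfin hVsph hdim hvert hp hadj hc (not_le.1 hcon)))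

theorem propertyZ_neighbors_in_hyperplane (d : ℕ) (hd : 2 ≤ d)
    (V : Set (EuclideanSpace ℝ (Fin d))) (hfin : V.Finite)
    (hVsph : V ⊆ Metric.sphere 0 1)
    (hdim : affineSpan ℝ V = ⊤)
    (hvert : (convexHull ℝ V).extremePoints ℝ = V)
    (hZ : PropertyZ V)
    (p : EuclideanSpace ℝ (Fin d)) (hp : p ∈ V)
    (n : EuclideanSpace ℝ (Fin d)) (hn : n ≠ 0) (c : ℝ)
    (H : Set (EuclideanSpace ℝ (Fin d))) (hH : H = {x | ⟪n, x⟫ = c})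
    (hadj : ∀ q ∈ V, Adjacent (convexHull ℝ V) p q → q ∈ H) :
    (∃ c' : ℝ, H = {x | ⟪p, x⟫ = c'}) ∧
      ∀ q₁ ∈ V, ∀ q₂ ∈ V, Adjacent (convexHull ℝ V) p q₁ →
        Adjacent (convexHull ℝ V) p q₂ → ‖q₁ - p‖ = ‖q₂ - p‖ := by
  subst hH
  have hadj' : ∀ q ∈ V, Adjacent (convexHull ℝ V) p q → ⟪n, q⟫ = c := hadj
  have hnorm : ∀ v ∈ V, ‖v‖ = 1 := fun v hv => by simpa using hVsph hv
  have hnp : n = ⟪n, p⟫ • p := by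
    rcases lt_trichotomy c ⟪n, p⟫ with hc | hc | hc
    · exact aux_main hd hfin hVsph hdim hvert hZ hp hadj' hc
    · exfalso
      have hsub : convexHull ℝ V ⊆ {x | ⟪n, x⟫ = c} := by
        intro x hx
        obtain ⟨t, s, -, -, -, b, hb, -, rfl⟩ := aux_decomp hd hfin hVsph hdim hvert hp hx
        have hb' := aux_inner_hull (fun q hq => hadj' q hq.1 hq.2) hb
        change _ = c
        rw [inner_add_right, inner_smul_right, inner_sub_right, hb', ← hc]
        ring
      obtain ⟨z, hz⟩ := interior_convexHull_nonempty_iff_affineSpan_eq_top.2 hdim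
      rw [mem_interior_iff_mem_nhds] at hz
      have hcont : Filter.Tendsto (fun t : ℝ => z + t • n) (nhdsWithin 0 {0}ᶜ) (nhds z) := by
        have : Continuous (fun t : ℝ => z + t • n) := by fun_prop
        have := this.tendsto 0
        simp only [zero_smul, add_zero] at this
        exact this.mono_left nhdsWithin_le_nhds
      obtain ⟨t, ht, ht0⟩ := ((hcont.eventually_mem hz).and self_mem_nhdsWithin).exists
      have h1 : ⟪n, z⟫ = c := hsub (mem_of_mem_nhds hz)
      have h2 : ⟪n, z + t • n⟫ = c := hsub ht
      rw [inner_add_right, h1, inner_smul_right, real_inner_self_eq_norm_sq] at h2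
      have h3 : t * ‖n‖ ^ 2 = 0 := by linarith
      have ht0 : t ≠ 0 := ht0
      simp [ht0, hn] at h3
    · have := aux_main hd hfin hVsph hdim hvert hZ hp (n := -n) (c := -c)
        (fun q hq ha => by rw [inner_neg_left, hadj' q hq ha]) (by rw [inner_neg_left]; linarith)
      rw [inner_neg_left, neg_smul] at this
      exact neg_injective this
  set a := ⟪n, p⟫ with ha
  have ha0 : a ≠ 0 := by
    intro h0
    rw [h0, zero_smul] at hnp
    exact hn hnp
  have hiff : ∀ x, ⟪n, x⟫ = c ↔ ⟪p, x⟫ = c / a := by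
    intro x
    rw [hnp, inner_smul_left, eq_div_iff ha0, mul_comm]
    rfl
  refine ⟨⟨c / a, Set.ext hiff⟩, ?_⟩
  have hlen : ∀ q ∈ V, Adjacent (convexHull ℝ V) p q → ‖q - p‖ ^ 2 = 2 - 2 * (c / a) := by
    intro q hq hqa
    have := (hiff q).1 (hadj' q hq hqa)
    rw [norm_sub_sq_real, hnorm q hq, hnorm p hp, real_inner_comm, this]
    ring
  intro q₁ h₁ q₂ h₂ ha₁ ha₂
  have := (hlen q₁ h₁ ha₁).trans (hlen q₂ h₂ ha₂).symm
  exact (sq_eq_sq₀ (norm_nonneg _) (norm_nonneg _)).1 this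
end

section
/- Let d ≥ 2, let V ⊂ S^{d-1} be finite, and suppose P = conv V is a d-dimensional polytope whose vertex set is V and which satisfies Property Z. Let p, q₁, q₂ ∈ V be distinct, with q₁ and q₂ both adjacent to p. Assume that (a) every facet of P containing p contains at least one of q₁ and q₂, and (b) for every S ⊂ V with exactly d−2 elements, conv(S ∪ {p,q₁}) is a facet of P not containing q₂ if and only if conv(S ∪ {p,q₂}) is a facet of P not containing q₁. Then |q₁ − p| = |q₂ − p|. -/
open MeasureTheory Real RealInnerProductSpace

theorem face_mem {E : Type*} [NormedAddCommGroup E] [NormedSpace ℝ E] {V : Set E}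
    (a : E →L[ℝ] ℝ) (b : ℝ) (hV : ∀ v ∈ V, a v ≤ b) {y : E} (hy : y ∈ convexHull ℝ V)
    (hyb : a y = b) : y ∈ convexHull ℝ {v ∈ V | a v = b} := by
  have h : convexHull ℝ V ⊆ {y | a y ≤ b ∧ (a y = b → y ∈ convexHull ℝ {v ∈ V | a v = b})} := by
    apply convexHull_min
    · intro v hv
      exact ⟨hV v hv, fun h => subset_convexHull ℝ _ ⟨hv, h⟩⟩
    · rintro x ⟨hx1, hx2⟩ z ⟨hz1, hz2⟩ α β hα hβ hαβ
      have hβ' : β = 1 - α := by linarith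
      subst hβ'
      refine ⟨?_, fun h => ?_⟩
      · simp only [map_add, map_smul, smul_eq_mul]
        nlinarith
      · simp only [map_add, map_smul, smul_eq_mul] at h
        rcases hα.eq_or_lt with h0 | h0
        · subst h0
          simpa using hz2 (by linarith)
        rcases hβ.eq_or_lt with h1 | h1
        · have : α = 1 := by linarith
          subst this
          simpa using hx2 (by linarith)
        · have hx : a x = b := by
            by_contra hne
            have : a x < b := lt_of_le_of_ne hx1 hne
            nlinarith [mul_lt_mul_of_pos_left this h0, mul_le_mul_of_nonneg_left hz1 hβ]
          have hz : a z = b := by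
            by_contra hne
            have : a z < b := lt_of_le_of_ne hz1 hne
            nlinarith [mul_lt_mul_of_pos_left this h1, mul_le_mul_of_nonneg_left hx1 hα]
          exact convex_convexHull ℝ _ (hx2 hx) (hz2 hz) hα hβ hαβ
  exact (h hy).2 hyb

theorem le_on_hull {E : Type*} [NormedAddCommGroup E] [NormedSpace ℝ E] {V : Set E}
    (a : E →L[ℝ] ℝ) (b : ℝ) (hV : ∀ v ∈ V, a v ≤ b) {y : E} (hy : y ∈ convexHull ℝ V) :
    a y ≤ b := by
  have h : convexHull ℝ V ⊆ {y | a y ≤ b} :=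
    convexHull_min hV (convex_halfSpace_le a.toLinearMap.isLinear b)
  exact h hy

theorem eq_on_span {E : Type*} [NormedAddCommGroup E] [NormedSpace ℝ E] {V : Set E}
    (a : E →L[ℝ] ℝ) (b : ℝ) (hV : ∀ v ∈ V, a v = b) {y : E} (hy : y ∈ affineSpan ℝ V) :
    a y = b := by
  refine affineSpan_induction (p := fun y => a y = b) hy hV ?_
  · intro c u v w hu hv hw
    simp only [vsub_eq_sub, vadd_eq_add, map_add, map_smul, map_sub, hu, hv, hw]
    simp

/-- `s` is an admissible weight of `v` in `y`. -/
def Adm {E : Type*} [NormedAddCommGroup E] [NormedSpace ℝ E] (K : Set E) (v : E) (s : ℝ) (y : E) :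
    Prop := 0 ≤ s ∧ s ≤ 1 ∧ ∃ k ∈ K, y = s • v + (1 - s) • k

theorem Adm.combo {E : Type*} [NormedAddCommGroup E] [NormedSpace ℝ E] {K : Set E}
    (hK : Convex ℝ K) {v : E} {s t : ℝ} {y z : E} (h1 : Adm K v s y) (h2 : Adm K v t z)
    {α β : ℝ} (hα : 0 ≤ α) (hβ : 0 ≤ β) (hαβ : α + β = 1) :
    Adm K v (α * s + β * t) (α • y + β • z) := by
  obtain ⟨hs0, hs1, k, hk, rfl⟩ := h1
  obtain ⟨ht0, ht1, l, hl, rfl⟩ := h2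
  have hβ' : β = 1 - α := by linarith
  refine ⟨by positivity, by nlinarith, ?_⟩
  have e : 1 - (α * s + β * t) = α * (1 - s) + β * (1 - t) := by rw [hβ']; ring
  have p1 : 0 ≤ α * (1 - s) := mul_nonneg hα (by linarith)
  have p2 : 0 ≤ β * (1 - t) := mul_nonneg hβ (by linarith)
  rcases (add_nonneg p1 p2).eq_or_lt with h0 | h0
  · refine ⟨k, hk, ?_⟩
    have q1 : α * (1 - s) = 0 := by linarith
    have q2 : β * (1 - t) = 0 := by linarith
    rw [e, ← h0, smul_add, smul_add, smul_smul α (1 - s), smul_smul β (1 - t), q1, q2]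
    simp only [zero_smul, add_zero, smul_smul, add_smul]
  · refine ⟨(α * (1 - s) / (α * (1 - s) + β * (1 - t))) • k +
      (β * (1 - t) / (α * (1 - s) + β * (1 - t))) • l,
      hK hk hl (by positivity) (by positivity) (by field_simp), ?_⟩
    rw [e, smul_add (α * (1 - s) + β * (1 - t)), smul_smul, smul_smul,
      mul_div_cancel₀ _ h0.ne', mul_div_cancel₀ _ h0.ne']
    module

theorem volume_ineq {E : Type*} [NormedAddCommGroup E] [NormedSpace ℝ E] [FiniteDimensional ℝ E]
    [MeasurableSpace E] [BorelSpace E] (μ : Measure E) [μ.IsAddHaarMeasure]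
    (P Q : Set E) (hP : IsCompact P) (hQ : IsCompact Q) (l : E → ℝ) (L : NNReal)
    (hl : LipschitzWith L l) (τ : E) (hτ : L * ‖τ‖ < 1) (hPQ : ∀ y ∈ P, y + l y • τ ∈ Q) :
    (μ P).toReal + ∫ y in P, fderiv ℝ l y τ ∂μ ≤ (μ Q).toReal := by
  set D := {y | DifferentiableAt ℝ l y} with hD
  have hDm : MeasurableSet D := measurableSet_of_differentiableAt ℝ l
  have hDae : ∀ᵐ y ∂μ, y ∈ D := hl.ae_differentiableAt
  set s := P ∩ D with hs
  have hsm : MeasurableSet s := hP.measurableSet.inter hDm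
  have hsP : s =ᵐ[μ] P := by
    filter_upwards [hDae] with y hy
    apply propext
    exact ⟨fun h => h.1, fun h => ⟨h, hy⟩⟩
  set f : E → E := fun y => y + l y • τ with hf
  set f' : E → E →L[ℝ] E := fun y => ContinuousLinearMap.id ℝ E + (fderiv ℝ l y).smulRight τ with hf'
  have hder : ∀ y ∈ s, HasFDerivWithinAt f (f' y) s y := by
    intro y hy
    have h1 : HasFDerivAt l (fderiv ℝ l y) y := hy.2.hasFDerivAt
    exact ((hasFDerivAt_id y).add (h1.smul_const τ)).hasFDerivWithinAt
  have hinj : Set.InjOn f s := by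
    intro x hx y hy hxy
    by_contra hne
    have h1 : x - y = (l y - l x) • τ := by
      have : x + l x • τ = y + l y • τ := hxy
      rw [sub_smul, sub_eq_sub_iff_add_eq_add, this, add_comm]
    have h2 : ‖x - y‖ ≤ (L * ‖x - y‖) * ‖τ‖ := by
      conv_lhs => rw [h1, norm_smul]
      gcongr
      have := hl.dist_le_mul y x
      rwa [dist_eq_norm, dist_eq_norm, norm_sub_rev y x] at this
    have h3 : 0 < ‖x - y‖ := norm_pos_iff.2 (sub_ne_zero.2 hne)
    nlinarith
  have hnorm : ∀ y, |fderiv ℝ l y τ| ≤ L * ‖τ‖ := by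
    intro y
    rw [← Real.norm_eq_abs]
    exact (ContinuousLinearMap.le_opNorm _ _).trans (by gcongr; exact norm_fderiv_le_of_lipschitz ℝ hl)
  have hdet : ∀ y, (f' y).det = 1 + fderiv ℝ l y τ := by
    intro y
    exact LinearMap.transvection.det (fderiv ℝ l y).toLinearMap τ
  have hcv := lintegral_abs_det_fderiv_eq_addHaar_image μ hsm hder hinj
  have hmeas : Measurable fun y => fderiv ℝ l y τ := measurable_fderiv_apply_const ℝ l τ
  have hfin : μ P ≠ ⊤ := hP.measure_lt_top.ne
  have hint : IntegrableOn (fun y => fderiv ℝ l y τ) P μ := by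
    apply Measure.integrableOn_of_bounded hfin hmeas.aestronglyMeasurable (M := L * ‖τ‖)
    exact Filter.Eventually.of_forall fun y => hnorm y
  have hpos : ∀ y, 0 ≤ 1 + fderiv ℝ l y τ := fun y => by
    have := hnorm y; rw [abs_le] at this; linarith
  have e1 : ∫⁻ y in s, ENNReal.ofReal |(f' y).det| ∂μ = ENNReal.ofReal (∫ y in P, (1 + fderiv ℝ l y τ) ∂μ) := by
    rw [ofReal_integral_eq_lintegral_ofReal]
    · rw [setLIntegral_congr hsP]
      simp only [hdet, abs_of_nonneg (hpos _)]
    · exact (integrableOn_const hfin).add hint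
    · exact Filter.Eventually.of_forall hpos
  have e2 : ∫ y in P, (1 + fderiv ℝ l y τ) ∂μ = (μ P).toReal + ∫ y in P, fderiv ℝ l y τ ∂μ := by
    have h1 : IntegrableOn (fun _ : E => (1 : ℝ)) P μ := integrableOn_const hfin
    rw [integral_add h1 hint]
    simp [Measure.real]
  rw [← e2]
  rw [e1] at hcv
  have : ENNReal.ofReal (∫ y in P, (1 + fderiv ℝ l y τ) ∂μ) ≤ μ Q := by
    rw [hcv]
    apply measure_mono
    rintro _ ⟨y, hy, rfl⟩
    exact hPQ y hy.1
  rwa [ENNReal.ofReal_le_iff_le_toReal hQ.measure_lt_top.ne] at this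

theorem exists_lin {E : Type*} [NormedAddCommGroup E] [NormedSpace ℝ E] [FiniteDimensional ℝ E]
    [MeasurableSpace E] [BorelSpace E] (μ : Measure E) [μ.IsAddHaarMeasure]
    (P : Set E) (hP : IsCompact P) (l : E → ℝ) (L : NNReal)
    (hl : LipschitzWith L l) : ∃ m : E →ₗ[ℝ] ℝ, ∀ τ, m τ = ∫ y in P, fderiv ℝ l y τ ∂μ := by
  have hint : ∀ τ, IntegrableOn (fun y => fderiv ℝ l y τ) P μ := by
    intro τ
    apply Measure.integrableOn_of_bounded hP.measure_lt_top.ne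
      (measurable_fderiv_apply_const ℝ l τ).aestronglyMeasurable (M := L * ‖τ‖)
    refine Filter.Eventually.of_forall fun y => ?_
    exact (ContinuousLinearMap.le_opNorm _ _).trans (by gcongr; exact norm_fderiv_le_of_lipschitz ℝ hl)
  refine ⟨⟨⟨fun τ => ∫ y in P, fderiv ℝ l y τ ∂μ, ?_⟩, ?_⟩, fun τ => rfl⟩
  · intro x y
    simp only [map_add]
    exact integral_add (hint x) (hint y)
  · intro c x
    simp only [map_smul, smul_eq_mul, RingHom.id_apply]
    exact integral_const_mul _ _

theorem lower_bound {E : Type*} [NormedAddCommGroup E] [NormedSpace ℝ E] [FiniteDimensional ℝ E]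
    [MeasurableSpace E] [BorelSpace E] (μ : Measure E) [μ.IsAddHaarMeasure]
    (V : Set E) (hV : V.Finite) (v x : E) (l : E → ℝ) (L : NNReal)
    (hl : LipschitzWith L l)
    (hadm : ∀ y ∈ convexHull ℝ V, Adm (convexHull ℝ (V \ {v})) v (l y) y)
    (hx : L * ‖x - v‖ < 1) :
    (μ (convexHull ℝ V)).toReal + ∫ y in convexHull ℝ V, fderiv ℝ l y (x - v) ∂μ
      ≤ (μ (convexHull ℝ ((V \ {v}) ∪ {x}))).toReal := by
  refine volume_ineq μ _ _ (hV.isCompact_convexHull ℝ)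
    ((hV.sdiff.union (Set.finite_singleton x)).isCompact_convexHull ℝ) l L hl _ hx ?_
  intro y hy
  obtain ⟨h0, h1, k, hk, e⟩ := hadm y hy
  have e2 : y + l y • (x - v) = l y • x + (1 - l y) • k := by
    nth_rewrite 1 [e]
    module
  rw [e2]
  exact convex_convexHull ℝ _ (subset_convexHull ℝ _ (Set.mem_union_right _ (Set.mem_singleton x)))
    (convexHull_mono Set.subset_union_left hk) h0 (sub_nonneg.2 h1) (add_sub_cancel _ _)

theorem crit {E : Type*} [NormedAddCommGroup E] [InnerProductSpace ℝ E] [FiniteDimensional ℝ E]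
    [MeasurableSpace E] [BorelSpace E] (μ : Measure E) [μ.IsAddHaarMeasure]
    (V : Set E) (hV : V.Finite) (v : E) (hv : ‖v‖ = 1)
    (hZ : ∃ ε > (0 : ℝ), ∀ q ∈ Metric.sphere (0 : E) 1, dist q v < ε →
      μ (convexHull ℝ ((V \ {v}) ∪ {q})) ≤ μ (convexHull ℝ V))
    (l : E → ℝ) (L : NNReal) (hl : LipschitzWith L l)
    (hadm : ∀ y ∈ convexHull ℝ V, Adm (convexHull ℝ (V \ {v})) v (l y) y)
    (τ : E) (hτ : inner ℝ v τ = 0) :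
    ∫ y in convexHull ℝ V, fderiv ℝ l y τ ∂μ = 0 := by
  obtain ⟨m, hm⟩ := exists_lin μ (convexHull ℝ V) (hV.isCompact_convexHull ℝ) l L hl
  rw [← hm]
  by_cases hτ0 : τ = 0
  · simp [hτ0]
  have hτn : 0 < ‖τ‖ := norm_pos_iff.2 hτ0
  set σ : E := ‖τ‖⁻¹ • τ with hσ
  have hσn : ‖σ‖ = 1 := by rw [hσ, norm_smul, norm_inv, norm_norm, inv_mul_cancel₀ hτn.ne']
  have hσv : inner ℝ v σ = 0 := by rw [hσ, inner_smul_right, hτ, mul_zero]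
  suffices h : m σ = 0 by
    rw [hσ, map_smul, smul_eq_mul] at h
    exact (mul_eq_zero.1 h).resolve_left (inv_ne_zero hτn.ne')
  obtain ⟨ε, hε, hZ⟩ := hZ
  let q : ℝ → E := fun t => cos t • v + sin t • σ
  have hq0 : q 0 = v := by simp [q]
  have hqc : Continuous q := by fun_prop
  have hqs : ∀ t, q t ∈ Metric.sphere (0 : E) 1 := by
    intro t
    rw [mem_sphere_zero_iff_norm, ← sq_eq_sq₀ (norm_nonneg _) zero_le_one, norm_add_sq_real,
      norm_smul, norm_smul, inner_smul_left, inner_smul_right, hσv, hσn, hv]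
    simp
  have hmc : Continuous m := m.continuous_of_finiteDimensional
  have hloc : IsLocalMax (fun t => m (q t)) 0 := by
    have h1 : ∀ᶠ t in nhds (0 : ℝ), dist (q t) v < ε := by
      have : Filter.Tendsto (fun t => dist (q t) v) (nhds 0) (nhds (dist (q 0) v)) :=
        (hqc.dist continuous_const).tendsto 0
      rw [hq0, dist_self] at this
      exact this.eventually_lt_const hε
    have h2 : ∀ᶠ t in nhds (0 : ℝ), L * ‖q t - v‖ < 1 := by
      have : Filter.Tendsto (fun t => L * ‖q t - v‖) (nhds 0) (nhds (L * ‖q 0 - v‖)) :=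
        (continuous_const.mul (hqc.sub continuous_const).norm).tendsto 0
      rw [hq0, sub_self, norm_zero, mul_zero] at this
      exact this.eventually_lt_const one_pos
    filter_upwards [h1, h2] with t ht1 ht2
    have a1 := lower_bound μ V hV v (q t) l L hl hadm ht2
    have a2 := ENNReal.toReal_mono (hV.isCompact_convexHull ℝ).measure_lt_top.ne (hZ (q t) (hqs t) ht1)
    rw [← hm, map_sub] at a1
    rw [hq0]
    linarith
  have hder : HasDerivAt (fun t => m (q t)) (m σ) 0 := by
    have : (fun t => m (q t)) = fun t => cos t * m v + sin t * m σ := by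
      funext t
      simp [q]
    rw [this]
    have := ((hasDerivAt_cos 0).mul_const (m v)).fun_add ((hasDerivAt_sin 0).mul_const (m σ))
    simpa using this
  exact hloc.hasDerivAt_eq_zero hder

theorem nonzero {E : Type*} [NormedAddCommGroup E] [NormedSpace ℝ E] [FiniteDimensional ℝ E]
    [MeasurableSpace E] [BorelSpace E] (μ : Measure E) [μ.IsAddHaarMeasure]
    (V : Set E) (hV : V.Finite) (hspan : affineSpan ℝ V = ⊤) (v : E)
    (hv : v ∈ (convexHull ℝ V).extremePoints ℝ)
    (l : E → ℝ) (L : NNReal) (hl : LipschitzWith L l)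
    (hadm : ∀ y ∈ convexHull ℝ V, Adm (convexHull ℝ (V \ {v})) v (l y) y)
    (w : E) (hw : w ∈ V) (hwv : w ≠ v) :
    ∃ τ, ∫ y in convexHull ℝ V, fderiv ℝ l y τ ∂μ ≠ 0 := by
  by_contra! hcon
  have hint : (interior (convexHull ℝ V)).Nonempty :=
    interior_convexHull_nonempty_iff_affineSpan_eq_top.2 hspan
  have hwv' : 0 < ‖w - v‖ := norm_pos_iff.2 (sub_ne_zero.2 hwv)
  obtain ⟨t, ht0, ht1, htL⟩ : ∃ t : ℝ, 0 < t ∧ t ≤ 1 ∧ L * (t * ‖w - v‖) < 1 := by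
    refine ⟨min 1 (1 / (2 * (L + 1) * ‖w - v‖)), by positivity, min_le_left _ _, ?_⟩
    calc (L : ℝ) * (min 1 (1 / (2 * (L + 1) * ‖w - v‖)) * ‖w - v‖)
        ≤ L * ((1 / (2 * (L + 1) * ‖w - v‖)) * ‖w - v‖) := by
          gcongr; exact min_le_right _ _
      _ = L / (2 * (L + 1)) := by field_simp
      _ < 1 := by
          rw [div_lt_one (by positivity)]
          have := L.coe_nonneg
          linarith
  set x := v + t • (w - v) with hx
  have hxv : x - v = t • (w - v) := by rw [hx]; abel
  have hxne : x ≠ v := by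
    rw [← sub_ne_zero, hxv]
    exact smul_ne_zero ht0.ne' (sub_ne_zero.2 hwv)
  have hxP : x ∈ convexHull ℝ V :=
    (convex_convexHull ℝ V).add_smul_sub_mem hv.1 (subset_convexHull ℝ V hw) ⟨ht0.le, ht1⟩
  have hlb := lower_bound μ V hV v x l L hl hadm (by
    rw [hxv, norm_smul, Real.norm_of_nonneg ht0.le]; exact htL)
  rw [hcon, add_zero] at hlb
  set Q := convexHull ℝ ((V \ {v}) ∪ {x}) with hQ
  have hQP : Q ⊆ convexHull ℝ V := by
    apply convexHull_min _ (convex_convexHull ℝ V)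
    rintro y (hy | rfl)
    · exact subset_convexHull ℝ V hy.1
    · exact hxP
  have hQc : IsCompact Q := (hV.sdiff.union (Set.finite_singleton x)).isCompact_convexHull ℝ
  have hvQ : v ∉ Q := by
    intro hvQ
    have h1 : v ∈ Q.extremePoints ℝ := inter_extremePoints_subset_extremePoints_of_subset hQP ⟨hvQ, hv⟩
    have h2 := extremePoints_convexHull_subset h1
    rcases h2 with h2 | h2
    · exact h2.2 rfl
    · exact hxne h2.symm
  have hvc : v ∈ closure (interior (convexHull ℝ V)) := by
    rw [(convex_convexHull ℝ V).closure_interior_eq_closure_of_nonempty_interior hint]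
    exact subset_closure hv.1
  have hUo : IsOpen (Qᶜ ∩ interior (convexHull ℝ V)) :=
    hQc.isClosed.isOpen_compl.inter isOpen_interior
  have hUn : (Qᶜ ∩ interior (convexHull ℝ V)).Nonempty :=
    mem_closure_iff.1 hvc _ hQc.isClosed.isOpen_compl hvQ
  have hUpos := hUo.measure_pos μ hUn
  have hle : μ Q + μ (Qᶜ ∩ interior (convexHull ℝ V)) ≤ μ (convexHull ℝ V) := by
    rw [← measure_union (Set.disjoint_left.2 fun y hy hy' => hy'.1 hy) hUo.measurableSet]
    apply measure_mono
    rintro y (hy | hy)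
    · exact hQP hy
    · exact interior_subset hy.2
  have hPQ : μ (convexHull ℝ V) ≤ μ Q :=
    (ENNReal.toReal_le_toReal (hV.isCompact_convexHull ℝ).measure_lt_top.ne hQc.measure_lt_top.ne).1 hlb
  have hlt : μ Q < μ Q + μ (Qᶜ ∩ interior (convexHull ℝ V)) :=
    ENNReal.lt_add_right hQc.measure_lt_top.ne hUpos.ne'
  exact absurd (hlt.trans_le (hle.trans hPQ)) (lt_irrefl _)

/-- Every affine subspace inside a proper hyperplane has small dimension. -/
theorem finrank_face {E : Type*} [NormedAddCommGroup E] [NormedSpace ℝ E] [FiniteDimensional ℝ E]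
    (a : E →L[ℝ] ℝ) (b : ℝ) (ha : a ≠ 0) (W : Set E) (hW : ∀ w ∈ W, a w = b) :
    Module.finrank ℝ (affineSpan ℝ W).direction + 1 ≤ Module.finrank ℝ E := by
  have h1 : (affineSpan ℝ W).direction ≤ LinearMap.ker a.toLinearMap := by
    rw [direction_affineSpan, vectorSpan_def, Submodule.span_le]
    rintro _ ⟨x, hx, y, hy, rfl⟩
    simp [hW x hx, hW y hy]
  have h2 := Submodule.finrank_mono h1
  have h3 : LinearMap.ker a.toLinearMap ≠ ⊤ := by
    intro h
    apply ha
    rw [LinearMap.ker_eq_top] at h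
    ext x
    exact LinearMap.congr_fun h x
  have h4 := Submodule.finrank_lt h3
  omega

theorem lt_of_interior {E : Type*} [NormedAddCommGroup E] [NormedSpace ℝ E]
    (a : E →L[ℝ] ℝ) (b : ℝ) (ha : a ≠ 0) {P : Set E} (hP : ∀ y ∈ P, a y ≤ b) {c : E}
    (hc : c ∈ interior P) : a c < b := by
  have ho : IsOpen (a '' interior P) := a.isOpenMap_of_ne_zero ha _ isOpen_interior
  have hs : a '' interior P ⊆ Set.Iic b := by
    rintro _ ⟨y, hy, rfl⟩
    exact hP y (interior_subset hy)
  have := interior_maximal hs ho ⟨c, hc, rfl⟩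
  rwa [interior_Iic] at this

theorem hrep {E : Type*} [NormedAddCommGroup E] [NormedSpace ℝ E] [FiniteDimensional ℝ E]
    (V : Set E) (hV : V.Finite) (hspan : affineSpan ℝ V = ⊤) :
    ∃ (I : Finset (Set E)) (a : Set E → E →L[ℝ] ℝ) (b : Set E → ℝ),
      (∀ i ∈ I, a i ≠ 0) ∧ (∀ i ∈ I, ∀ y ∈ V, a i y ≤ b i) ∧
      (∀ i ∈ I, Module.finrank ℝ (affineSpan ℝ {y ∈ V | a i y = b i}).direction + 1
        = Module.finrank ℝ E) ∧
      (∀ y, (∀ i ∈ I, a i y ≤ b i) → y ∈ convexHull ℝ V) := by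
  classical
  have hint : (interior (convexHull ℝ V)).Nonempty :=
    interior_convexHull_nonempty_iff_affineSpan_eq_top.2 hspan
  have hPc : IsCompact (convexHull ℝ V) := hV.isCompact_convexHull ℝ
  let good : Set E → Prop := fun W => ∃ ab : (E →L[ℝ] ℝ) × ℝ, ab.1 ≠ 0 ∧ (∀ y ∈ V, ab.1 y ≤ ab.2) ∧
    W = {y ∈ V | ab.1 y = ab.2} ∧
    Module.finrank ℝ (affineSpan ℝ W).direction + 1 = Module.finrank ℝ E
  let f : Set E → (E →L[ℝ] ℝ) × ℝ := fun W => if h : good W then h.choose else 0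
  have hf : ∀ W, good W → (f W).1 ≠ 0 ∧ (∀ y ∈ V, (f W).1 y ≤ (f W).2) ∧
    W = {y ∈ V | (f W).1 y = (f W).2} ∧
    Module.finrank ℝ (affineSpan ℝ W).direction + 1 = Module.finrank ℝ E := by
    intro W hW
    have : f W = hW.choose := dif_pos hW
    rw [this]
    exact hW.choose_spec
  let I : Finset (Set E) := hV.finite_subsets.toFinset.filter good
  have hI : ∀ i ∈ I, good i := fun i hi => (Finset.mem_filter.1 hi).2
  refine ⟨I, fun W => (f W).1, fun W => (f W).2, fun i hi => (hf i (hI i hi)).1,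
    fun i hi => (hf i (hI i hi)).2.1, fun i hi => ?_, fun y hy => ?_⟩
  · have := (hf i (hI i hi)).2.2
    rw [← this.1]
    exact this.2
  · by_contra hyP
    obtain ⟨c, hc, hcgen⟩ : ∃ c ∈ interior (convexHull ℝ V), ∀ W ⊆ V,
        Module.finrank ℝ (affineSpan ℝ W).direction + 1 < Module.finrank ℝ E →
        c ∉ affineSpan ℝ (insert y W) := by
      let _ : MeasurableSpace E := borel E
      have _ : BorelSpace E := ⟨rfl⟩
      let μ : Measure E := MeasureTheory.Measure.addHaar
      by_contra! hcon
      have hsub : interior (convexHull ℝ V) ⊆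
          ⋃ W ∈ {W | W ⊆ V ∧ Module.finrank ℝ (affineSpan ℝ W).direction + 1 < Module.finrank ℝ E},
            (affineSpan ℝ (insert y W) : Set E) := by
        intro c hc
        obtain ⟨W, hW, h1, h2⟩ := hcon c hc
        exact Set.mem_biUnion (show W ∈ {W | W ⊆ V ∧ _} from ⟨hW, h1⟩) h2
      have hz : μ (⋃ W ∈ {W | W ⊆ V ∧ Module.finrank ℝ (affineSpan ℝ W).direction + 1 < Module.finrank ℝ E},
            (affineSpan ℝ (insert y W) : Set E)) = 0 := by
        rw [measure_biUnion_null_iff (hV.finite_subsets.subset fun W hW => hW.1).countable]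
        rintro W ⟨hW, h1⟩
        apply Measure.addHaar_affineSubspace
        intro htop
        have h2 : Module.finrank ℝ (affineSpan ℝ (insert y W)).direction = Module.finrank ℝ E := by
          rw [htop, AffineSubspace.direction_top, finrank_top]
        have h3 : Module.finrank ℝ (vectorSpan ℝ (insert y W)) ≤ Module.finrank ℝ (vectorSpan ℝ W) + 1 :=
          finrank_vectorSpan_insert_le_set ℝ W y
        rw [direction_affineSpan] at h1 h2
        omega
      have := isOpen_interior.measure_pos μ hint
      exact this.ne' (measure_mono_null hsub hz)
    obtain ⟨t, ht0, ht1, hzP, hzI⟩ : ∃ t : ℝ, 0 ≤ t ∧ t < 1 ∧ c + t • (y - c) ∈ convexHull ℝ V ∧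
        c + t • (y - c) ∉ interior (convexHull ℝ V) := by
      let g : ℝ → E := fun t => c + t • (y - c)
      have hg : Continuous g := by fun_prop
      have hcomp : IsCompact (Set.Icc (0 : ℝ) 1 ∩ g ⁻¹' (convexHull ℝ V)) :=
        isCompact_Icc.inter_right (hPc.isClosed.preimage hg)
      have hne : (Set.Icc (0 : ℝ) 1 ∩ g ⁻¹' (convexHull ℝ V)).Nonempty :=
        ⟨0, by simp, by simpa [g] using interior_subset hc⟩
      obtain ⟨t, ⟨⟨ht0, ht1⟩, htP⟩, hmax⟩ := hcomp.exists_isMaxOn hne continuousOn_id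
      have ht1' : t < 1 := by
        refine lt_of_le_of_ne ht1 ?_
        rintro rfl
        apply hyP
        simpa [g] using htP
      refine ⟨t, ht0, ht1', htP, ?_⟩
      intro hI
      have hnhds : ∀ᶠ s in nhds t, g s ∈ interior (convexHull ℝ V) :=
        hg.continuousAt.eventually (isOpen_interior.mem_nhds hI)
      have hlt : ∀ᶠ s in nhds t, s < 1 := eventually_lt_nhds ht1'
      obtain ⟨s, hs, hst⟩ := ((hnhds.and hlt).filter_mono nhdsWithin_le_nhds |>.and
        (self_mem_nhdsWithin (s := Set.Ioi t))).exists
      have : s ≤ t := hmax ⟨⟨ht0.trans (le_of_lt hst), hs.2.le⟩, show g s ∈ _ from interior_subset hs.1⟩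
      exact absurd hst (not_lt.2 this)
    set z := c + t • (y - c) with hz
    obtain ⟨φ, hφ⟩ := geometric_hahn_banach_open_point (convex_convexHull ℝ V).interior
      isOpen_interior hzI
    have hφ0 : φ ≠ 0 := by
      rintro rfl
      simpa using hφ c hc
    have hφV : ∀ w ∈ convexHull ℝ V, φ w ≤ φ z := by
      intro w hw
      have hcl : closure (interior (convexHull ℝ V)) ⊆ {w | φ w ≤ φ z} :=
        closure_minimal (fun w hw => (hφ w hw).le) (isClosed_le φ.continuous continuous_const)
      rw [(convex_convexHull ℝ V).closure_interior_eq_closure_of_nonempty_interior hint] at hcl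
      exact hcl (subset_closure hw)
    set W : Set E := {w ∈ V | φ w = φ z} with hW
    have hzW : z ∈ convexHull ℝ W :=
      face_mem φ (φ z) (fun w hw => hφV w (subset_convexHull ℝ V hw)) hzP rfl
    have hle := finrank_face φ (φ z) hφ0 W fun w hw => hw.2
    have hgoodW : good W := by
      refine ⟨(φ, φ z), hφ0, fun w hw => hφV w (subset_convexHull ℝ V hw), rfl, ?_⟩
      by_contra hne
      refine hcgen W (fun w hw => hw.1) (lt_of_le_of_ne hle hne) ?_
      have hzA : z ∈ affineSpan ℝ (insert y W) :=
        affineSpan_mono ℝ (Set.subset_insert y W) (convexHull_subset_affineSpan W hzW)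
      have hyA : y ∈ affineSpan ℝ (insert y W) := subset_affineSpan ℝ _ (Set.mem_insert y W)
      have hc' : c = AffineMap.lineMap y z (1 / (1 - t)) := by
        have : (1 - t) ≠ 0 := by linarith
        rw [AffineMap.lineMap_apply_module', hz]
        have e : c + t • (y - c) - y = (1 - t) • (c - y) := by module
        rw [e, smul_smul, one_div, inv_mul_cancel₀ this]
        simp
      rw [hc']
      exact AffineMap.lineMap_mem _ hyA hzA
    have hWI : W ∈ I := Finset.mem_filter.2 ⟨by
      rw [Set.Finite.mem_toFinset]; exact fun w hw => hw.1, hgoodW⟩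
    obtain ⟨hn0, hle', hWeq, -⟩ := hf W hgoodW
    have hzb : (f W).1 z = (f W).2 := by
      apply eq_on_span (V := W) _ _ _ (convexHull_subset_affineSpan W hzW)
      intro w hw
      rw [hWeq] at hw
      exact hw.2
    have hcb : (f W).1 c < (f W).2 :=
      lt_of_interior _ _ hn0 (fun w hw => le_on_hull _ _ hle' hw) hc
    have hyb := hy W hWI
    simp only at hyb
    rw [hz] at hzb
    simp only [map_add, map_smul, map_sub, smul_eq_mul] at hzb
    nlinarith

theorem exists_min {E ι : Type*} [NormedAddCommGroup E] (J : Finset ι) (hJ : J.Nonempty)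
    (g : ι → E → ℝ) (hg : ∀ i, ∃ L, LipschitzWith L (g i)) :
    ∃ (l : E → ℝ) (L : NNReal), LipschitzWith L l ∧
      ∀ y, (∀ i ∈ J, l y ≤ g i y) ∧ ∃ i ∈ J, l y = g i y := by
  classical
  induction hJ using Finset.Nonempty.cons_induction with
  | singleton i =>
    obtain ⟨L, hL⟩ := hg i
    exact ⟨g i, L, hL, fun y => by simp⟩
  | cons i J hi hJ ih =>
    obtain ⟨l, L, hl, h⟩ := ih
    obtain ⟨L', hL'⟩ := hg i
    refine ⟨fun y => min (g i y) (l y), max L' L, hL'.min hl, fun y => ?_⟩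
    obtain ⟨h1, j, hj, h2⟩ := h y
    refine ⟨fun k hk => ?_, ?_⟩
    · rcases Finset.mem_cons.1 hk with rfl | hk
      · exact min_le_left _ _
      · exact (min_le_right _ _).trans (h1 k hk)
    · rcases le_total (g i y) (l y) with h3 | h3
      · exact ⟨i, Finset.mem_cons_self i J, min_eq_left h3⟩
      · exact ⟨j, Finset.mem_cons.2 (Or.inr hj), (min_eq_right h3).trans h2⟩

theorem affine_lip {E : Type*} [NormedAddCommGroup E] [NormedSpace ℝ E] (a : E →L[ℝ] ℝ) (b c : ℝ) :
    ∃ L, LipschitzWith L (fun y => (b - a y) / c) := by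
  have h : (fun y => (b - a y) / c) = fun y => b / c - ((1 / c) • a) y := by
    funext y
    simp only [smul_apply, smul_eq_mul]
    ring
  rw [h]
  exact ⟨_, (LipschitzWith.const (b / c)).sub (((1 / c) • a).lipschitz)⟩

theorem exists_lam {E : Type*} [NormedAddCommGroup E] [NormedSpace ℝ E] [FiniteDimensional ℝ E]
    (V : Set E) (hV : V.Finite)
    (I : Finset (Set E)) (a : Set E → E →L[ℝ] ℝ) (b : Set E → ℝ)
    (h1 : ∀ i ∈ I, ∀ y ∈ V, a i y ≤ b i)
    (h2 : ∀ y, (∀ i ∈ I, a i y ≤ b i) → y ∈ convexHull ℝ V)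
    (v : E) (hv : v ∈ V) (w : E) (hw : w ∈ V) (hwv : w ≠ v) :
    ∃ (l : E → ℝ) (L : NNReal), LipschitzWith L l ∧
      (∀ y ∈ convexHull ℝ V, Adm (convexHull ℝ (V \ {v})) v (l y) y) ∧
      (∀ y s, Adm (convexHull ℝ (V \ {v})) v s y → s ≤ l y) ∧
      (∀ y, (∀ i ∈ I, a i v < b i → a i y < b i) → 0 < l y) := by
  classical
  set J := I.filter fun i => a i v < b i with hJ
  let g : Option (Set E) → E → ℝ := fun o => match o with
    | none => fun _ => 1
    | some i => fun y => (b i - a i y) / (b i - a i v)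
  obtain ⟨l, L, hl, hmin⟩ := exists_min (Finset.insertNone J)
    ⟨none, Finset.none_mem_insertNone⟩ g (by
      rintro (_ | i)
      · exact ⟨0, LipschitzWith.const 1⟩
      · exact affine_lip _ _ _)
  have hle1 : ∀ y, l y ≤ 1 := fun y => (hmin y).1 none Finset.none_mem_insertNone
  have hlei : ∀ y, ∀ i ∈ I, a i v < b i → l y * (b i - a i v) ≤ b i - a i y := by
    intro y i hi hiv
    have := (hmin y).1 (some i) (Finset.some_mem_insertNone.2 (Finset.mem_filter.2 ⟨hi, hiv⟩))
    rwa [le_div_iff₀ (by linarith)] at this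
  have hatt : ∀ y, l y = 1 ∨ ∃ i ∈ I, a i v < b i ∧ l y * (b i - a i v) = b i - a i y := by
    intro y
    obtain ⟨o, ho, he⟩ := (hmin y).2
    rcases o with _ | i
    · exact Or.inl he
    · have := Finset.mem_filter.1 (Finset.some_mem_insertNone.1 ho)
      refine Or.inr ⟨i, this.1, this.2, ?_⟩
      have h0 : b i - a i v ≠ 0 := by linarith [this.2]
      rw [he]
      exact div_mul_cancel₀ _ h0
  have hwK : w ∈ convexHull ℝ (V \ {v}) := subset_convexHull ℝ _ ⟨hw, hwv⟩
  refine ⟨l, L, hl, fun y hy => ?_, fun y s hs => ?_, fun y hy => ?_⟩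
  · have hyI : ∀ i ∈ I, a i y ≤ b i := fun i hi => le_on_hull _ _ (h1 i hi) hy
    have h0 : 0 ≤ l y := by
      rcases hatt y with h | ⟨i, hi, hiv, he⟩
      · rw [h]; exact zero_le_one
      · have := hyI i hi
        by_contra hneg
        nlinarith
    refine ⟨h0, hle1 y, ?_⟩
    by_cases h1' : l y = 1
    · skip
      have hyv : y = v := by
        by_contra hne
        have hray : ∀ r : ℝ, 0 ≤ r → v + r • (y - v) ∈ convexHull ℝ V := by
          intro r hr
          apply h2
          intro i hi
          simp only [map_add, map_smul, map_sub, smul_eq_mul]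
          rcases (h1 i hi v hv).eq_or_lt with e | hlt
          · have := hyI i hi
            nlinarith
          · have := hlei y i hi hlt
            rw [h1'] at this
            nlinarith
        obtain ⟨R, hR⟩ := (hV.isCompact_convexHull ℝ).isBounded.exists_norm_le
        have hpos : 0 < ‖y - v‖ := norm_pos_iff.2 (sub_ne_zero.2 hne)
        have hR0 : 0 ≤ R := (norm_nonneg v).trans (hR v (subset_convexHull ℝ V hv))
        have := hR _ (hray ((2 * R + 1) / ‖y - v‖) (by positivity))
        have h3 : ‖((2 * R + 1) / ‖y - v‖) • (y - v)‖ = 2 * R + 1 := by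
          rw [norm_smul, Real.norm_of_nonneg (by positivity), div_mul_cancel₀ _ hpos.ne']
        have h4 := norm_sub_le (v + ((2 * R + 1) / ‖y - v‖) • (y - v)) v
        rw [add_sub_cancel_left, h3] at h4
        have := hR v (subset_convexHull ℝ V hv)
        linarith
      refine ⟨w, hwK, ?_⟩
      rw [h1', hyv]; simp
    · have hlt : l y < 1 := lt_of_le_of_ne (hle1 y) h1'
      have hs : 0 < 1 - l y := by linarith
      obtain ⟨i, hi, hiv, he⟩ := (hatt y).resolve_left h1'
      set k := (1 - l y)⁻¹ • (y - l y • v) with hk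
      have hyk : y = l y • v + (1 - l y) • k := by
        rw [hk, smul_smul, mul_inv_cancel₀ hs.ne', one_smul]; abel
      have hak : ∀ φ : E →L[ℝ] ℝ, φ y = l y * φ v + (1 - l y) * φ k := by
        intro φ
        conv_lhs => rw [hyk]
        simp
      have hkP : k ∈ convexHull ℝ V := by
        apply h2
        intro j hj
        have e1 := hak (a j)
        rcases (h1 j hj v hv).eq_or_lt with e | hlt'
        · have := hyI j hj
          nlinarith
        · have := hlei y j hj hlt'
          nlinarith
      have hki : a i k = b i := by
        have e1 := hak (a i)
        have : (1 - l y) * (a i k - b i) = 0 := by linarith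
        have := (mul_eq_zero.1 this).resolve_left hs.ne'
        linarith
      refine ⟨k, ?_, hyk⟩
      refine convexHull_mono ?_ (face_mem (a i) (b i) (h1 i hi) hkP hki)
      rintro x ⟨hx, hxi⟩
      refine ⟨hx, ?_⟩
      rintro rfl
      exact hiv.ne hxi
  · obtain ⟨hs0, hs1, k, hk, e⟩ := hs
    rcases hatt y with h | ⟨i, hi, hiv, he⟩
    · rw [h]; exact hs1
    · have hki : a i k ≤ b i := le_on_hull _ _ (h1 i hi) (convexHull_mono Set.sdiff_subset hk)
      have e1 : a i y = s * a i v + (1 - s) * a i k := by rw [e]; simp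
      have : s * (b i - a i v) ≤ l y * (b i - a i v) := by
        rw [he, e1]
        nlinarith
      exact le_of_mul_le_mul_right this (by linarith)
  · rcases hatt y with h | ⟨i, hi, hiv, he⟩
    · rw [h]; exact one_pos
    · have := hy i hi hiv
      by_contra hneg
      nlinarith

theorem facet_point {E : Type*} [NormedAddCommGroup E] [NormedSpace ℝ E] [FiniteDimensional ℝ E]
    (W : Set E) (hWn : W.Nonempty) (a : E →L[ℝ] ℝ) (b : ℝ) (ha : a ≠ 0)
    (hW : ∀ w ∈ W, a w = b)
    (hdim : Module.finrank ℝ (affineSpan ℝ W).direction + 1 = Module.finrank ℝ E)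
    (w0 : E) (hw0 : a w0 < b) :
    ∃ k0 ∈ convexHull ℝ W, (∀ᶠ z in nhds k0, a z = b → z ∈ convexHull ℝ W) ∧
      (∀ᶠ y in nhds k0, a y ≤ b → y ∈ convexHull ℝ (insert w0 W)) := by
  have hspan : affineSpan ℝ (insert w0 W) = ⊤ := by
    have hlt : affineSpan ℝ W < affineSpan ℝ (insert w0 W) := by
      refine lt_of_le_of_ne (affineSpan_mono ℝ (Set.subset_insert _ _)) fun h => ?_
      have : w0 ∈ affineSpan ℝ W := by
        rw [h]; exact subset_affineSpan ℝ _ (Set.mem_insert _ _)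
      exact hw0.ne (eq_on_span a b hW this)
    have hne : (affineSpan ℝ W : Set E).Nonempty := hWn.mono (subset_affineSpan ℝ W)
    have hne' : (affineSpan ℝ (insert w0 W) : Set E).Nonempty := hne.mono hlt.le
    have h1 := Submodule.finrank_lt_finrank_of_lt (AffineSubspace.direction_lt_of_nonempty hlt hne)
    have h2 := Submodule.finrank_le (affineSpan ℝ (insert w0 W)).direction
    rw [← AffineSubspace.direction_eq_top_iff_of_nonempty hne']
    apply Submodule.eq_top_of_finrank_eq
    omega
  obtain ⟨c, hc⟩ := interior_convexHull_nonempty_iff_affineSpan_eq_top.2 hspan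
  have hjoin : ∀ x ∈ convexHull ℝ (insert w0 W), ∃ k ∈ convexHull ℝ W, ∃ α β : ℝ,
      0 ≤ α ∧ 0 ≤ β ∧ α + β = 1 ∧ α • w0 + β • k = x := by
    intro x hx
    rw [convexHull_insert hWn, mem_convexJoin] at hx
    obtain ⟨_, rfl, k, hk, α, β, h1, h2, h3, h4⟩ := hx
    exact ⟨k, hk, α, β, h1, h2, h3, h4⟩
  have hab : ∀ k ∈ convexHull ℝ W, a k = b := fun k hk =>
    eq_on_span a b hW (convexHull_subset_affineSpan W hk)
  obtain ⟨k0, hk0, α, β, hα, hβ, hαβ, hcc⟩ := hjoin c (interior_subset hc)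
  have hβ0 : 0 < β := by
    rcases hβ.eq_or_lt with h | h
    · exfalso
      have hα1 : α = 1 := by linarith
      rw [hα1, ← h] at hcc
      have hcw : c = w0 := by rw [← hcc]; simp
      have h1 : (-a) c < - a w0 := by
        refine lt_of_interior (-a) (- a w0) (neg_ne_zero.2 ha) ?_ hc
        intro y hy
        apply le_on_hull _ _ _ hy
        rintro x (rfl | hx)
        · simp
        · have := hW x hx
          simp only [neg_apply]
          linarith
      rw [hcw] at h1
      exact lt_irrefl _ h1
    · exact h
  have step3 : ∀ᶠ z in nhds k0, a z = b → z ∈ convexHull ℝ W := by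
    have hcont : Continuous fun z : E => α • w0 + β • z := by fun_prop
    have hev : ∀ᶠ z in nhds k0, α • w0 + β • z ∈ interior (convexHull ℝ (insert w0 W)) :=
      hcont.continuousAt.eventually (isOpen_interior.mem_nhds (by
        show α • w0 + β • k0 ∈ _
        rw [hcc]; exact hc))
    filter_upwards [hev] with z hz hzb
    obtain ⟨k, hk, α', β', h1, h2, h3, h4⟩ := hjoin _ (interior_subset hz)
    have e := congrArg a h4
    simp only [map_add, map_smul, smul_eq_mul, hab k hk, hzb] at e
    have hβ' : β' = 1 - α' := by linarith
    have hβ'' : β = 1 - α := by linarith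
    have hαα : α' = α := by
      have : (α' - α) * (a w0 - b) = 0 := by rw [hβ', hβ''] at e; linarith
      rcases mul_eq_zero.1 this with h | h <;> linarith
    have hββ : β' = β := by linarith
    rw [hαα, hββ] at h4
    have := smul_right_injective E hβ0.ne' (add_left_cancel h4)
    exact this ▸ hk
  refine ⟨k0, hk0, step3, ?_⟩
  let ρ : E → ℝ := fun y => (b - a y) / (b - a w0)
  have hρc : Continuous ρ := by fun_prop
  have hbw : 0 < b - a w0 := by linarith
  have hρ0 : ρ k0 = 0 := by simp [ρ, hab k0 hk0]
  let ζ : E → E := fun y => (1 - ρ y)⁻¹ • (y - ρ y • w0)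
  have hζ0 : ζ k0 = k0 := by simp [ζ, hρ0]
  have hζc : ContinuousAt ζ k0 := by
    apply ContinuousAt.smul
    · exact (continuous_const.sub hρc).continuousAt.inv₀ (by simp [hρ0])
    · exact (continuous_id.sub (hρc.smul continuous_const)).continuousAt
  have hev1 : ∀ᶠ y in nhds k0, a (ζ y) = b → ζ y ∈ convexHull ℝ W := by
    exact hζc.eventually (p := fun z => a z = b → z ∈ convexHull ℝ W) (by rw [hζ0]; exact step3)
  have hev2 : ∀ᶠ y in nhds k0, ρ y < 1 :=
    hρc.continuousAt.eventually_lt continuousAt_const (by rw [hρ0]; exact one_pos)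
  filter_upwards [hev1, hev2] with y h1 h2 hy
  have hρn : 0 ≤ ρ y := div_nonneg (by linarith) hbw.le
  have h1ρ : 0 < 1 - ρ y := by linarith
  have hζb : a (ζ y) = b := by
    have e : ρ y * (b - a w0) = b - a y := div_mul_cancel₀ _ hbw.ne'
    simp only [ζ, map_smul, map_sub, smul_eq_mul]
    rw [inv_mul_eq_iff_eq_mul₀ h1ρ.ne']
    linarith
  have hy' : y = ρ y • w0 + (1 - ρ y) • ζ y := by
    simp only [ζ]
    rw [smul_smul, mul_inv_cancel₀ h1ρ.ne', one_smul]; abel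
  rw [hy']
  exact convex_convexHull ℝ _ (subset_convexHull ℝ _ (Set.mem_insert _ _))
    (convexHull_mono (Set.subset_insert _ _) (h1 hζb)) hρn h1ρ.le (add_sub_cancel _ _)

theorem fderiv_lower {E : Type*} [NormedAddCommGroup E] [NormedSpace ℝ E] (g : E → ℝ) (y τ : E)
    (c : ℝ) (hg : DifferentiableAt ℝ g y) (h : ∀ t > 0, g y + c * t ≤ g (y + t • τ)) :
    c ≤ fderiv ℝ g y τ := by
  have h1 : HasDerivAt (fun t : ℝ => g (y + t • τ)) (fderiv ℝ g y τ) 0 :=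
    hg.hasFDerivAt.hasLineDerivAt τ
  have h2 := h1.tendsto_slope_zero_right
  refine ge_of_tendsto h2 ?_
  filter_upwards [self_mem_nhdsWithin] with t ht
  have ht' : 0 < t := ht
  have := h t ht'
  simp only [zero_add, zero_smul, add_zero, smul_eq_mul]
  rw [le_inv_mul_iff₀ ht']
  linarith

theorem fderiv_intOn {E : Type*} [NormedAddCommGroup E] [NormedSpace ℝ E] [FiniteDimensional ℝ E]
    [MeasurableSpace E] [BorelSpace E] (μ : Measure E) [μ.IsAddHaarMeasure]
    (P : Set E) (hP : IsCompact P) (l : E → ℝ) (L : NNReal)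
    (hl : LipschitzWith L l) (τ : E) : IntegrableOn (fun y => fderiv ℝ l y τ) P μ := by
  apply Measure.integrableOn_of_bounded hP.measure_lt_top.ne
    (measurable_fderiv_apply_const ℝ l τ).aestronglyMeasurable (M := L * ‖τ‖)
  refine Filter.Eventually.of_forall fun y => ?_
  exact (ContinuousLinearMap.le_opNorm _ _).trans (by gcongr; exact norm_fderiv_le_of_lipschitz ℝ hl)

theorem bump_pos {E : Type*} [NormedAddCommGroup E] [NormedSpace ℝ E] [FiniteDimensional ℝ E]
    [MeasurableSpace E] [BorelSpace E] (μ : Measure E) [μ.IsAddHaarMeasure]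
    (P : Set E) (hP : IsCompact P) (hPc : Convex ℝ P) (hPi : (interior P).Nonempty)
    (k0 : E) (hk0 : k0 ∈ P) (f : E → ℝ) (L : NNReal) (hf : LipschitzWith L f)
    (hδ : LipschitzWith L (fun y => max (f y) 0)) (τ : E)
    (hmono : ∀ y, ∀ t > 0, f y + t ≤ f (y + t • τ)) (hfk : 0 < f k0) :
    0 < ∫ y in P, fderiv ℝ (fun y => max (f y) 0) y τ ∂μ := by
  set δ : E → ℝ := fun y => max (f y) 0 with hδd
  have hnn : ∀ y, 0 ≤ fderiv ℝ δ y τ := by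
    intro y
    by_cases hd : DifferentiableAt ℝ δ y
    · apply fderiv_lower δ y τ 0 hd
      intro t ht
      have := hmono y t ht
      simp only [hδd, zero_mul, add_zero]
      apply max_le_max_right
      linarith
    · rw [fderiv_zero_of_not_differentiableAt hd]; simp
  have hae : ∀ᵐ y ∂μ, DifferentiableAt ℝ δ y := hδ.ae_differentiableAt
  let O : Set E := interior P ∩ {y | 0 < f y}
  have hO : IsOpen O := isOpen_interior.inter (isOpen_lt continuous_const hf.continuous)
  have hOP : O ⊆ P := fun y hy => interior_subset hy.1
  have hOn : O.Nonempty := by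
    have h1 : k0 ∈ closure (interior P) := by
      rw [hPc.closure_interior_eq_closure_of_nonempty_interior hPi]
      exact subset_closure hk0
    have := mem_closure_iff.1 h1 {y | 0 < f y} (isOpen_lt continuous_const hf.continuous) hfk
    rwa [Set.inter_comm] at this
  have hOpos : 0 < μ.real O := by
    apply ENNReal.toReal_pos (hO.measure_pos μ hOn).ne'
    exact ((measure_mono hOP).trans_lt hP.measure_lt_top).ne
  have hint := fderiv_intOn μ P hP δ L hδ τ
  calc 0 < μ.real O := hOpos
    _ = ∫ y in O, (1 : ℝ) ∂μ := by simp
    _ ≤ ∫ y in O, fderiv ℝ δ y τ ∂μ := by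
        apply setIntegral_mono_on_ae
        · exact integrableOn_const ((measure_mono hOP).trans_lt hP.measure_lt_top).ne
        · exact hint.mono_set hOP
        · exact hO.measurableSet
        · filter_upwards [hae] with y hy hyO
          apply fderiv_lower δ y τ 1 hy
          intro t ht
          have h1 := hmono y t ht
          have h2 : 0 < f y := hyO.2
          simp only [hδd]
          rw [max_eq_left h2.le, max_eq_left (by linarith)]
          linarith
    _ ≤ ∫ y in P, fderiv ℝ δ y τ ∂μ :=
        setIntegral_mono_set hint (Filter.Eventually.of_forall fun y => hnn y)
          (Filter.Eventually.of_forall hOP)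

theorem simplicial {E : Type*} [NormedAddCommGroup E] [InnerProductSpace ℝ E]
    [FiniteDimensional ℝ E]
    [MeasurableSpace E] [BorelSpace E] (μ : Measure E) [μ.IsAddHaarMeasure]
    (V : Set E) (hV : V.Finite) (hspan : affineSpan ℝ V = ⊤) (hsph : ∀ v ∈ V, ‖v‖ = 1)
    (I : Finset (Set E)) (a : Set E → E →L[ℝ] ℝ) (b : Set E → ℝ)
    (h0 : ∀ i ∈ I, a i ≠ 0)
    (h1 : ∀ i ∈ I, ∀ y ∈ V, a i y ≤ b i)
    (h2 : ∀ y, (∀ i ∈ I, a i y ≤ b i) → y ∈ convexHull ℝ V)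
    (h3 : ∀ i ∈ I, Module.finrank ℝ (affineSpan ℝ {y ∈ V | a i y = b i}).direction + 1
        = Module.finrank ℝ E)
    (v : E) (hv : v ∈ V)
    (hZ : ∃ ε > (0 : ℝ), ∀ q ∈ Metric.sphere (0 : E) 1, dist q v < ε →
      μ (convexHull ℝ ((V \ {v}) ∪ {q})) ≤ μ (convexHull ℝ V))
    (i : Set E) (hi : i ∈ I) (hiv : a i v = b i) :
    v ∉ affineSpan ℝ ({y ∈ V | a i y = b i} \ {v}) := by
  intro hvs
  set W : Set E := {y ∈ V | a i y = b i} \ {v} with hWd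
  have hWn : W.Nonempty := by
    rw [← affineSpan_nonempty ℝ]; exact ⟨v, hvs⟩
  have hWV : W ⊆ V \ {v} := fun y hy => ⟨hy.1.1, hy.2⟩
  have hWa : ∀ w ∈ W, a i w = b i := fun w hw => hw.1.2
  have hWspan : affineSpan ℝ W = affineSpan ℝ {y ∈ V | a i y = b i} := by
    apply le_antisymm
    · exact affineSpan_mono ℝ Set.sdiff_subset
    · rw [affineSpan_le]
      intro y hy
      by_cases hyv : y = v
      · rw [hyv]; exact hvs
      · exact subset_affineSpan ℝ _ ⟨hy, hyv⟩
  have hWdim : Module.finrank ℝ (affineSpan ℝ W).direction + 1 = Module.finrank ℝ E := by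
    rw [hWspan]; exact h3 i hi
  obtain ⟨w0, hw0V, hw0⟩ : ∃ w0 ∈ V, a i w0 < b i := by
    by_contra! hcon
    apply h0 i hi
    have hc : ∀ y, a i y = b i := fun y =>
      eq_on_span (a i) (b i) (fun w hw => le_antisymm (h1 i hi w hw) (hcon w hw))
        (V := V) (by rw [hspan]; trivial)
    ext y
    have e1 := hc 0
    have e2 := hc y
    simp only [map_zero] at e1
    rw [e2, ← e1]; rfl
  have hw0v : w0 ≠ v := by rintro rfl; linarith
  obtain ⟨k0, hk0, hk1, hk2⟩ := facet_point W hWn (a i) (b i) (h0 i hi) hWa hWdim w0 hw0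
  obtain ⟨l, L, hl, hadm, hmax, hpos⟩ := exists_lam V hV I a b h1 h2 v hv w0 hw0V hw0v
  have hWhull : ∀ k ∈ convexHull ℝ W, a i k = b i := fun k hk =>
    eq_on_span (a i) (b i) hWa (convexHull_subset_affineSpan W hk)
  have hWP : convexHull ℝ W ⊆ convexHull ℝ V := convexHull_mono (hWV.trans Set.sdiff_subset)
  have hlk0 : 0 < l k0 := by
    apply hpos
    intro j hj hjv
    have hle : ∀ k ∈ convexHull ℝ V, a j k ≤ b j := fun k hk => le_on_hull (a j) (b j) (h1 j hj) hk
    refine lt_of_le_of_ne (hle k0 (hWP hk0)) fun hjk => ?_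
    obtain ⟨w', hw', hw'j⟩ : ∃ w' ∈ W, a j w' < b j := by
      by_contra! hcon
      have := eq_on_span (a j) (b j) (fun w hw => le_antisymm (h1 j hj w (hWV hw).1) (hcon w hw)) hvs
      linarith
    have hc : ContinuousAt (fun s : ℝ => k0 + s • (k0 - w')) 0 := by fun_prop
    have hev := hc.eventually (p := fun z => a i z = b i → z ∈ convexHull ℝ W)
      (by simpa using hk1)
    obtain ⟨s, hs, hspos⟩ := ((hev.filter_mono nhdsWithin_le_nhds).and
      (self_mem_nhdsWithin (s := Set.Ioi (0:ℝ)))).exists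
    have hspos' : 0 < s := hspos
    have hmem := hs (by simp [hWhull k0 hk0, hWa w' hw'])
    have := hle _ (hWP hmem)
    simp only [map_add, map_smul, map_sub, smul_eq_mul, hjk] at this
    nlinarith [mul_pos hspos' (sub_pos.2 hw'j)]
  set n : E := (InnerProductSpace.toDual ℝ E).symm (a i) with hn
  have hain : ∀ y, a i y = inner ℝ n y := fun y =>
    (InnerProductSpace.toDual_symm_apply (𝕜 := ℝ) (x := y) (y := a i)).symm
  set τ : E := n - (inner ℝ v n) • v with hτd
  have hvv : inner ℝ v v = (1 : ℝ) := by rw [real_inner_self_eq_norm_sq, hsph v hv]; norm_num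
  have hvτ : inner ℝ v τ = 0 := by
    rw [hτd, inner_sub_right, inner_smul_right, hvv]; ring
  have haτ : a i τ = ‖τ‖ ^ 2 := by
    rw [hain, ← real_inner_self_eq_norm_sq]
    have : n = τ + (inner ℝ v n) • v := by rw [hτd]; abel
    conv_lhs => rw [this]
    rw [inner_add_left, inner_smul_left, hvτ]; simp
  have hτ0 : τ ≠ 0 := by
    intro h
    have hnv : n = (inner ℝ v n) • v := by rw [hτd] at h; exact sub_eq_zero.1 h
    obtain ⟨w, hw⟩ := hWn
    have e1 := hWa w hw
    rw [← hiv, hain, hain, hnv, inner_smul_left, inner_smul_left, hvv] at e1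
    simp only [conj_trivial] at e1
    have hc0 : inner ℝ v n ≠ 0 := by
      intro h'
      rw [h', zero_smul] at hnv
      apply h0 i hi
      ext y; rw [hain, hnv]; simp
    have e2 : inner ℝ v w = (1:ℝ) := mul_left_cancel₀ hc0 e1
    exact (hWV hw).2 ((inner_eq_one_iff_of_norm_eq_one (hsph v hv) (hsph w (hWV hw).1)).1 e2).symm
  have haτ0 : 0 < a i τ := by rw [haτ]; positivity
  obtain ⟨r1, hr1, hball1⟩ := Metric.eventually_nhds_iff.1 hk2
  obtain ⟨r2, hr2, hball2⟩ := Metric.eventually_nhds_iff.1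
    (continuousAt_const.eventually_lt hl.continuous.continuousAt (half_lt_self hlk0) :
      ∀ᶠ y in nhds k0, l k0 / 2 < l y)
  set ε := min (min r1 r2) (l k0 / 2) with hεd
  have hε : 0 < ε := by positivity
  set A := (1 + ‖τ‖) / a i τ with hA
  have hA0 : 0 < A := by positivity
  have hAτ : A * a i τ = 1 + ‖τ‖ := div_mul_cancel₀ _ haτ0.ne'
  set f : E → ℝ := fun y => ε + A * (a i y - b i) - ‖y - k0‖ with hfd
  obtain ⟨M, hfM⟩ : ∃ M, LipschitzWith M f := by
    have e1 := ((A • a i).lipschitz.add (LipschitzWith.const (α := E) (ε - A * b i)))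
    have e2 : LipschitzWith 1 fun y : E => dist y k0 := LipschitzWith.dist_left k0
    have hfe : f = fun y => ((A • a i) y + (ε - A * b i)) - dist y k0 := by
      ext y
      simp [hfd, dist_eq_norm]; ring
    rw [hfe]
    exact ⟨_, e1.sub e2⟩
  have hδM : LipschitzWith M (fun y => max (f y) 0) := hfM.max_const 0
  have hPcomp : IsCompact (convexHull ℝ V) := hV.isCompact_convexHull ℝ
  have hKconv : Convex ℝ (convexHull ℝ (V \ {v})) := convex_convexHull ℝ _
  have hbp := bump_pos μ (convexHull ℝ V) hPcomp (convex_convexHull ℝ _)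
    (interior_convexHull_nonempty_iff_affineSpan_eq_top.2 hspan) k0 (hWP hk0) f M hfM hδM τ
    (by
      intro y t ht
      have e1 : ‖y + t • τ - k0‖ ≤ ‖y - k0‖ + t * ‖τ‖ := by
        have : y + t • τ - k0 = (y - k0) + t • τ := by abel
        rw [this]
        refine (norm_add_le _ _).trans ?_
        rw [norm_smul, Real.norm_of_nonneg ht.le]
      simp only [hfd, map_add, map_smul, smul_eq_mul]
      have e2 : A * (a i y + t * a i τ - b i) = A * (a i y - b i) + t * (1 + ‖τ‖) := by
        rw [← hAτ]; ring
      linarith)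
    (by simp [hfd, hWhull k0 hk0, hε])
  have c1 := crit μ V hV v (hsph v hv) hZ l L hl hadm τ hvτ
  have c2 := crit μ V hV v (hsph v hv) hZ (fun y => l y - max (f y) 0) (L + M) (hl.sub hδM)
    (by
      intro y hy
      rcases le_or_gt (f y) 0 with hf0 | hf0
      · simp only [max_eq_right hf0, sub_zero]; exact hadm y hy
      · simp only [max_eq_left hf0.le]
        have hay : a i y ≤ b i := le_on_hull (a i) (b i) (h1 i hi) hy
        have hnn : A * (a i y - b i) ≤ 0 := mul_nonpos_of_nonneg_of_nonpos hA0.le (by linarith)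
        have hfy : f y = ε + A * (a i y - b i) - ‖y - k0‖ := rfl
        have hnorm := norm_nonneg (y - k0)
        have hdist : dist y k0 < ε := by rw [dist_eq_norm]; linarith
        have hyK : y ∈ convexHull ℝ (V \ {v}) := by
          have := hball1 (hdist.trans_le ((min_le_left _ _).trans (min_le_left _ _))) hay
          refine convexHull_mono ?_ this
          exact Set.insert_subset ⟨hw0V, hw0v⟩ hWV
        have hly : l k0 / 2 < l y :=
          hball2 (hdist.trans_le ((min_le_left _ _).trans (min_le_right _ _)))
        have hεl : ε ≤ l k0 / 2 := min_le_right _ _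
        have hly0 : 0 < l y := by linarith
        have hA1 : Adm (convexHull ℝ (V \ {v})) v 0 y := ⟨le_rfl, zero_le_one, y, hyK, by simp⟩
        have hA2 := hadm y hy
        have hfl : f y ≤ l y := by linarith
        have hα : 0 ≤ f y / l y := by positivity
        have hβ : 0 ≤ 1 - f y / l y := by rw [sub_nonneg, div_le_one hly0]; exact hfl
        have := Adm.combo hKconv hA1 hA2 hα hβ (by ring)
        rw [← add_smul] at this
        convert this using 1
        · field_simp; ring
        · simp)
    τ hvτ
  have hsub : ∫ y in convexHull ℝ V, fderiv ℝ (fun y => l y - max (f y) 0) y τ ∂μ =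
      ∫ y in convexHull ℝ V, (fderiv ℝ l y τ - fderiv ℝ (fun y => max (f y) 0) y τ) ∂μ := by
    apply integral_congr_ae
    apply ae_restrict_of_ae
    filter_upwards [hl.ae_differentiableAt (μ := μ), hδM.ae_differentiableAt (μ := μ)] with y e1 e2
    rw [fderiv_fun_sub e1 e2]; rfl
  rw [hsub, integral_sub (fderiv_intOn μ _ hPcomp l L hl τ) (fderiv_intOn μ _ hPcomp _ M hδM τ),
    c1] at c2
  linarith

theorem facet_card {E : Type*} [NormedAddCommGroup E] [NormedSpace ℝ E] [FiniteDimensional ℝ E]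
    (W : Set E) (hW : W.Finite) (p : E) (hp : p ∈ W)
    (hind : ∀ v ∈ W, v ∉ affineSpan ℝ (W \ {v})) :
    Module.finrank ℝ (affineSpan ℝ W).direction + 1 = W.ncard := by
  have hai : AffineIndependent ℝ (fun x : W => (x : E)) := by
    rw [affineIndependent_iff_linearIndependent_vsub ℝ _ (⟨p, hp⟩ : W)]
    rw [linearIndependent_iff_notMem_span]
    rintro ⟨j, hj⟩ hmem
    apply hind j j.2
    have hpj : p ∈ affineSpan ℝ (W \ {(j : E)}) := by
      apply subset_affineSpan
      refine ⟨hp, fun h => hj (Subtype.ext ?_)⟩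
      exact (Set.mem_singleton_iff.1 h).symm
    have hle : Submodule.span ℝ ((fun i : { x : W // x ≠ ⟨p, hp⟩ } => ((i : W) : E) -ᵥ p) ''
        (Set.univ \ {⟨j, hj⟩})) ≤ (affineSpan ℝ (W \ {(j : E)})).direction := by
      rw [Submodule.span_le]
      rintro _ ⟨k, hk, rfl⟩
      apply AffineSubspace.vsub_mem_direction _ hpj
      apply subset_affineSpan
      refine ⟨k.1.2, fun h => hk.2 ?_⟩
      exact Subtype.ext (Subtype.ext h)
    have := AffineSubspace.vadd_mem_of_mem_direction (hle hmem) hpj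
    simpa using this
  have := hW.fintype
  have : Nonempty W := ⟨⟨p, hp⟩⟩
  have h := hai.finrank_vectorSpan_add_one
  rw [Subtype.range_coe] at h
  rw [direction_affineSpan, h, Set.ncard_eq_toFinset_card', Set.toFinset_card]

theorem Adm.mem {E : Type*} [NormedAddCommGroup E] [NormedSpace ℝ E] {V : Set E} {v : E}
    (hv : v ∈ V) {s : ℝ} {y : E} (h : Adm (convexHull ℝ (V \ {v})) v s y) :
    y ∈ convexHull ℝ V := by
  obtain ⟨h0, h1, k, hk, rfl⟩ := h
  exact convex_convexHull ℝ V (subset_convexHull ℝ V hv)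
    (convexHull_mono Set.sdiff_subset hk) h0 (by linarith) (by ring)

theorem Adm.between {E : Type*} [NormedAddCommGroup E] [NormedSpace ℝ E] {K : Set E}
    (hK : Convex ℝ K) {v : E} {s : ℝ} {y u : E} {c1 c2 : ℝ} (hc1 : 0 ≤ c1) (hc2 : 0 ≤ c2)
    (h1 : Adm K v s (y + c1 • u)) (h2 : Adm K v s (y - c2 • u)) : Adm K v s y := by
  rcases eq_or_lt_of_le (add_nonneg hc1 hc2) with h | h
  · have : c1 = 0 := by linarith
    simpa [this] using h1
  · have := Adm.combo hK h1 h2 (α := c2 / (c1 + c2)) (β := c1 / (c1 + c2)) (by positivity)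
      (by positivity) (by field_simp; ring)
    convert this using 1
    · field_simp; ring
    · rw [smul_add, smul_sub, smul_smul, smul_smul]
      have e1 : c1 / (c1 + c2) * c2 = c2 / (c1 + c2) * c1 := by ring
      rw [e1]
      have e2 : (c2 / (c1 + c2)) • y + (c1 / (c1 + c2)) • y = y := by
        rw [← add_smul]
        have : c2 / (c1 + c2) + c1 / (c1 + c2) = 1 := by field_simp; ring
        rw [this, one_smul]
      nth_rewrite 1 [← e2]
      abel

theorem ray {E : Type*} [NormedAddCommGroup E] [NormedSpace ℝ E]
    (V : Set E) (I : Finset (Set E)) (a : Set E → E →L[ℝ] ℝ) (b : Set E → ℝ)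
    (h1 : ∀ i ∈ I, ∀ y ∈ V, a i y ≤ b i)
    (h2 : ∀ y, (∀ i ∈ I, a i y ≤ b i) → y ∈ convexHull ℝ V)
    (q1 q2 : E) (hq1 : q1 ∈ (convexHull ℝ V).extremePoints ℝ)
    (hq2 : q2 ∈ convexHull ℝ V) (hne : q1 ≠ q2) :
    ∃ (T : E → ℝ) (L : NNReal), LipschitzWith L T ∧
      (∀ y (r : ℝ), T (y + r • (q1 - q2)) = T y - r) ∧
      ∀ y ∈ convexHull ℝ V, 0 ≤ T y ∧ y + T y • (q1 - q2) ∈ convexHull ℝ V ∧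
        ∃ i ∈ I, a i q2 < a i q1 ∧ a i (y + T y • (q1 - q2)) = b i := by
  classical
  set u := q1 - q2 with hu
  let J := I.filter fun i => 0 < a i u
  have hle : ∀ i ∈ I, ∀ y ∈ convexHull ℝ V, a i y ≤ b i := fun i hi y hy =>
    le_on_hull (a i) (b i) (h1 i hi) hy
  have hJ : J.Nonempty := by
    by_contra hcon
    rw [Finset.not_nonempty_iff_eq_empty] at hcon
    have hJ' : ∀ i ∈ I, a i u ≤ 0 := by
      intro i hi
      by_contra! h
      have : i ∈ J := Finset.mem_filter.2 ⟨hi, h⟩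
      rw [hcon] at this
      simp at this
    have hmem : q1 + u ∈ convexHull ℝ V := h2 _ fun i hi => by
      have e1 := hle i hi q1 hq1.1
      have e2 := hJ' i hi
      rw [map_add]; linarith
    have hseg : q1 ∈ openSegment ℝ q2 (q1 + u) := by
      refine ⟨1/2, 1/2, by norm_num, by norm_num, by norm_num, ?_⟩
      rw [hu, ← smul_add]
      have : q2 + (q1 + (q1 - q2)) = (2:ℝ) • q1 := by rw [two_smul]; abel
      rw [this, smul_smul]; norm_num
    exact hne (hq1.2 hq2 hmem hseg).symm
  obtain ⟨T, L, hT, hTy⟩ := exists_min J hJ (fun i y => (b i - a i y) / a i u)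
    (fun i => affine_lip (a i) (b i) (a i u))
  have hJpos : ∀ i ∈ J, 0 < a i u := fun i hi => (Finset.mem_filter.1 hi).2
  have hJI : ∀ i ∈ J, i ∈ I := fun i hi => (Finset.mem_filter.1 hi).1
  have hg : ∀ i ∈ J, ∀ y (r : ℝ), (b i - a i (y + r • u)) / a i u = (b i - a i y) / a i u - r := by
    intro i hi y r
    have := (hJpos i hi).ne'
    rw [map_add, map_smul, smul_eq_mul]
    field_simp
    ring
  refine ⟨T, L, hT, ?_, ?_⟩
  · intro y r
    obtain ⟨i0, hi0, e0⟩ := (hTy y).2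
    obtain ⟨i1, hi1, e1⟩ := (hTy (y + r • u)).2
    have f0 := (hTy (y + r • u)).1 i0 hi0
    have f1 := (hTy y).1 i1 hi1
    simp only [hg i0 hi0] at f0
    simp only [hg i1 hi1] at e1
    linarith
  · intro y hy
    obtain ⟨i0, hi0, e0⟩ := (hTy y).2
    have hT0 : 0 ≤ T y := by
      rw [e0]
      exact div_nonneg (by linarith [hle i0 (hJI i0 hi0) y hy]) (hJpos i0 hi0).le
    refine ⟨hT0, h2 _ fun i hi => ?_, i0, hJI i0 hi0, ?_, ?_⟩
    · rw [map_add, map_smul, smul_eq_mul]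
      by_cases hui : 0 < a i u
      · have := (hTy y).1 i (Finset.mem_filter.2 ⟨hi, hui⟩)
        rw [le_div_iff₀ hui] at this
        linarith
      · have := mul_nonpos_of_nonneg_of_nonpos hT0 (not_lt.1 hui)
        linarith [hle i hi y hy]
    · have := hJpos i0 hi0
      rw [hu, map_sub] at this
      linarith
    · have := hJpos i0 hi0
      rw [map_add, map_smul, smul_eq_mul, e0]
      field_simp
      ring

theorem transfer {E : Type*} [NormedAddCommGroup E] [NormedSpace ℝ E]
    (V S : Set E) (a a' : E →L[ℝ] ℝ) (b b' : ℝ) (p q1 q2 : E) (hp : p ∈ V)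
    (h1 : ∀ y ∈ V, a y ≤ b) (h1' : ∀ y ∈ V, a' y ≤ b')
    (hq2 : q2 ∈ V) (hpq2 : q2 ≠ p)
    (hS : S ⊆ V \ {p}) (hface : {v ∈ V | a v = b} ⊆ S ∪ {p, q1})
    (hS' : ∀ x ∈ S, a' x = b') (hp' : a' p = b') (hq2' : a' q2 = b') (hq1' : a' q1 < b')
    (s : ℝ) (hs : 0 < s) (y : E) (hy : Adm (convexHull ℝ (V \ {p})) p s y) (hyb : a y = b) :
    ∃ r : ℝ, 0 ≤ r ∧ Adm (convexHull ℝ (V \ {p})) p s (y - r • (q1 - q2)) ∧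
      ∀ r' : ℝ, y - r' • (q1 - q2) ∈ convexHull ℝ V → r' ≤ r := by
  obtain ⟨hs0, hs1, k, hk, rfl⟩ := hy
  have hkle : a k ≤ b := le_on_hull a b (fun v hv => h1 v hv.1) hk
  have hple := h1 p hp
  have key : ∃ r : ℝ, 0 ≤ r ∧ ∃ k' ∈ convexHull ℝ (V \ {p}),
      (1 - s) • k - r • (q1 - q2) = (1 - s) • k' ∧ s * b' + (1 - s) * a' k' = b' := by
    rcases hs1.eq_or_lt with h | h
    · exact ⟨0, le_rfl, k, hk, by simp, by rw [h]; ring⟩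
    · have hak : a k = b := by
        simp only [map_add, map_smul, smul_eq_mul] at hyb
        by_contra hne
        have : a k < b := lt_of_le_of_ne hkle hne
        nlinarith [mul_pos (sub_pos.2 h) (sub_pos.2 this),
          mul_nonneg hs.le (sub_nonneg.2 hple)]
      have hk2 := face_mem a b (fun v hv => h1 v hv.1) hk hak
      have hsub : {v ∈ V \ {p} | a v = b} ⊆
          {x | ∃ r : ℝ, 0 ≤ r ∧ x - r • (q1 - q2) ∈ convexHull ℝ (insert q2 S)} := by
        rintro x ⟨⟨hxV, hxp⟩, hxb⟩
        rcases hface ⟨hxV, hxb⟩ with hx | hx | hx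
        · exact ⟨0, le_rfl, by simpa using subset_convexHull ℝ _ (Set.mem_insert_of_mem q2 hx)⟩
        · exact absurd hx hxp
        · refine ⟨1, zero_le_one, ?_⟩
          rw [Set.mem_singleton_iff.1 hx]
          simpa using subset_convexHull ℝ _ (Set.mem_insert q2 S)
      have hconv : Convex ℝ
          {x | ∃ r : ℝ, 0 ≤ r ∧ x - r • (q1 - q2) ∈ convexHull ℝ (insert q2 S)} := by
        rintro x ⟨r, hr, hx⟩ z ⟨t, ht, hz⟩ α β hα hβ hαβ
        refine ⟨α * r + β * t, by positivity, ?_⟩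
        have := convex_convexHull ℝ (insert q2 S) hx hz hα hβ hαβ
        convert this using 1
        module
      obtain ⟨r, hr, hk3⟩ := convexHull_min hsub hconv hk2
      refine ⟨(1 - s) * r, mul_nonneg (by linarith) hr, k - r • (q1 - q2), ?_, ?_, ?_⟩
      · have hins : insert q2 S ⊆ V \ {p} := Set.insert_subset ⟨hq2, hpq2⟩ hS
        exact convexHull_mono hins hk3
      · module
      · have : a' (k - r • (q1 - q2)) = b' := by
          apply eq_on_span a' b' _ (convexHull_subset_affineSpan _ hk3)
          rintro x (rfl | hx)
          · exact hq2'
          · exact hS' x hx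
        rw [this]; ring
  obtain ⟨r, hr, k', hk', e1, e2⟩ := key
  have e3 : s • p + (1 - s) • k - r • (q1 - q2) = s • p + (1 - s) • k' := by
    rw [← e1]; abel
  refine ⟨r, hr, ⟨hs0, hs1, k', hk', e3⟩, fun r' hr' => ?_⟩
  have e4 := le_on_hull a' b' h1' hr'
  have e5 := congrArg a' e3
  simp only [map_add, map_sub, map_smul, smul_eq_mul, hp', hq2', e2] at e4 e5
  by_contra! hlt
  nlinarith [mul_pos (sub_pos.2 hlt) (sub_pos.2 hq1')]

theorem swap (d : ℕ) (hd : 2 ≤ d)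
    (V : Set (EuclideanSpace ℝ (Fin d))) (hfin : V.Finite)
    (p q₁ q₂ : EuclideanSpace ℝ (Fin d)) (hpV : p ∈ V) (hq₁V : q₁ ∈ V) (hq₂V : q₂ ∈ V)
    (hpq₁ : p ≠ q₁) (hpq₂ : p ≠ q₂)
    (ha : ∀ F : Set (EuclideanSpace ℝ (Fin d)), IsFacet (convexHull ℝ V) F → p ∈ F →
      q₁ ∈ F ∨ q₂ ∈ F)
    (hb : ∀ S : Finset (EuclideanSpace ℝ (Fin d)), (S : Set (EuclideanSpace ℝ (Fin d))) ⊆ V →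
      S.card = d - 2 →
      ((IsFacet (convexHull ℝ V) (convexHull ℝ ((S : Set (EuclideanSpace ℝ (Fin d))) ∪ {p, q₁})) ∧
          q₂ ∉ convexHull ℝ ((S : Set (EuclideanSpace ℝ (Fin d))) ∪ {p, q₁})) →
        (IsFacet (convexHull ℝ V) (convexHull ℝ ((S : Set (EuclideanSpace ℝ (Fin d))) ∪ {p, q₂})) ∧
          q₁ ∉ convexHull ℝ ((S : Set (EuclideanSpace ℝ (Fin d))) ∪ {p, q₂}))))
    (a : EuclideanSpace ℝ (Fin d) →L[ℝ] ℝ) (b : ℝ) (h1 : ∀ y ∈ V, a y ≤ b)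
    (h3 : Module.finrank ℝ (affineSpan ℝ {y ∈ V | a y = b}).direction + 1
        = Module.finrank ℝ (EuclideanSpace ℝ (Fin d)))
    (hind : ∀ v ∈ {y ∈ V | a y = b}, v ∉ affineSpan ℝ ({y ∈ V | a y = b} \ {v}))
    (hap : a p = b) (haq : a q₂ < a q₁)
    (s : ℝ) (hs : 0 < s) (y : EuclideanSpace ℝ (Fin d))
    (hy : Adm (convexHull ℝ (V \ {p})) p s y) (hyb : a y = b) :
    ∃ r : ℝ, 0 ≤ r ∧ Adm (convexHull ℝ (V \ {p})) p s (y - r • (q₁ - q₂)) ∧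
      ∀ r' : ℝ, y - r' • (q₁ - q₂) ∈ convexHull ℝ V → r' ≤ r := by
  classical
  set W := {y ∈ V | a y = b} with hW
  have hle : ∀ y ∈ convexHull ℝ V, a y ≤ b := fun y hy => le_on_hull a b h1 hy
  have hWhull : ∀ k ∈ convexHull ℝ W, a k = b := fun k hk =>
    eq_on_span a b (fun w hw => hw.2) (convexHull_subset_affineSpan W hk)
  have hpW : p ∈ W := ⟨hpV, hap⟩
  have hWfin : W.Finite := hfin.subset fun y hy => hy.1
  have hWfacet : IsFacet (convexHull ℝ V) (convexHull ℝ W) := by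
    refine ⟨fun _ => ⟨a, ?_⟩, ?_⟩
    · ext x
      constructor
      · intro hx
        refine ⟨convexHull_mono (fun y hy => hy.1) hx, fun y hy => ?_⟩
        rw [hWhull x hx]; exact hle y hy
      · rintro ⟨hx, hx2⟩
        apply face_mem a b h1 hx
        apply le_antisymm (hle x hx)
        rw [← hap]
        exact hx2 p (subset_convexHull ℝ V hpV)
    · rw [affineSpan_convexHull]
      rw [finrank_euclideanSpace_fin] at h3
      omega
  have hq₂W : q₂ ∉ convexHull ℝ W := fun h => by
    have := hWhull _ h
    linarith [h1 q₁ hq₁V]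
  have hq₁W : q₁ ∈ W := by
    rcases ha _ hWfacet (subset_convexHull ℝ _ hpW) with h | h
    · exact ⟨hq₁V, hWhull _ h⟩
    · exact absurd h hq₂W
  have hcard : W.ncard = d := by
    rw [← facet_card W hWfin p hpW hind, h3, finrank_euclideanSpace_fin]
  let S : Finset (EuclideanSpace ℝ (Fin d)) := (hWfin.toFinset.erase p).erase q₁
  have hSW : (S : Set (EuclideanSpace ℝ (Fin d))) ∪ {p, q₁} = W := by
    ext x
    simp only [S, Finset.coe_erase, Set.Finite.coe_toFinset, Set.mem_union, Set.mem_sdiff,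
      Set.mem_singleton_iff, Set.mem_insert_iff]
    constructor
    · rintro (h | rfl | rfl)
      · exact h.1.1
      · exact hpW
      · exact hq₁W
    · tauto
  have hSV : (S : Set (EuclideanSpace ℝ (Fin d))) ⊆ V \ {p} := by
    intro x hx
    simp only [S, Finset.coe_erase, Set.Finite.coe_toFinset, Set.mem_sdiff,
      Set.mem_singleton_iff] at hx
    exact ⟨hx.1.1.1, hx.1.2⟩
  have hScard : S.card = d - 2 := by
    rw [Finset.card_erase_of_mem, Finset.card_erase_of_mem, ← Set.ncard_eq_toFinset_card W hWfin,
      hcard]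
    · omega
    · exact hWfin.mem_toFinset.2 hpW
    · exact Finset.mem_erase.2 ⟨hpq₁.symm, hWfin.mem_toFinset.2 hq₁W⟩
  obtain ⟨⟨hexp, -⟩, hq₁n⟩ := hb S (fun x hx => (hSV hx).1) hScard (by
    rw [hSW]; exact ⟨hWfacet, hq₂W⟩)
  have hpm : p ∈ convexHull ℝ ((S : Set (EuclideanSpace ℝ (Fin d))) ∪ {p, q₂}) :=
    subset_convexHull ℝ _ (by simp)
  obtain ⟨a', ha'⟩ := hexp ⟨p, hpm⟩
  have hpm' := hpm
  rw [ha'] at hpm'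
  have hP : ∀ x ∈ V, x ∈ convexHull ℝ V := fun x hx => subset_convexHull ℝ V hx
  have heq : ∀ x ∈ (S : Set (EuclideanSpace ℝ (Fin d))) ∪ {p, q₂}, a' x = a' p := by
    intro x hx
    have hxm := subset_convexHull ℝ _ hx
    rw [ha'] at hxm
    exact le_antisymm (hpm'.2 x hxm.1) (hxm.2 p (hP p hpV))
  refine transfer V S a a' b (a' p) p q₁ q₂ hpV h1 (fun y hy => hpm'.2 y (hP y hy)) hq₂V hpq₂.symm
    hSV hSW.ge (fun x hx => heq x (Or.inl hx)) rfl (heq q₂ (by simp)) ?_ s hs y hy hyb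
  by_contra! hcon
  apply hq₁n
  rw [ha']
  exact ⟨hP q₁ hq₁V, fun y hy => (hpm'.2 y hy).trans hcon⟩

theorem propertyZ_equal_edges (d : ℕ) (hd : 2 ≤ d)
    (V : Set (EuclideanSpace ℝ (Fin d))) (hfin : V.Finite)
    (hVsph : V ⊆ Metric.sphere 0 1)
    (hdim : affineSpan ℝ V = ⊤)
    (hvert : (convexHull ℝ V).extremePoints ℝ = V)
    (hZ : PropertyZ V)
    (p q₁ q₂ : EuclideanSpace ℝ (Fin d)) (hpV : p ∈ V) (hq₁V : q₁ ∈ V) (hq₂V : q₂ ∈ V)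
    (hpq₁ : p ≠ q₁) (hpq₂ : p ≠ q₂) (hq₁q₂ : q₁ ≠ q₂)
    (hadj₁ : Adjacent (convexHull ℝ V) p q₁) (hadj₂ : Adjacent (convexHull ℝ V) p q₂)
    (ha : ∀ F : Set (EuclideanSpace ℝ (Fin d)), IsFacet (convexHull ℝ V) F → p ∈ F →
      q₁ ∈ F ∨ q₂ ∈ F)
    (hb : ∀ S : Finset (EuclideanSpace ℝ (Fin d)), (S : Set (EuclideanSpace ℝ (Fin d))) ⊆ V →
      S.card = d - 2 →
      ((IsFacet (convexHull ℝ V) (convexHull ℝ ((S : Set (EuclideanSpace ℝ (Fin d))) ∪ {p, q₁})) ∧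
          q₂ ∉ convexHull ℝ ((S : Set (EuclideanSpace ℝ (Fin d))) ∪ {p, q₁})) ↔
        (IsFacet (convexHull ℝ V) (convexHull ℝ ((S : Set (EuclideanSpace ℝ (Fin d))) ∪ {p, q₂})) ∧
          q₁ ∉ convexHull ℝ ((S : Set (EuclideanSpace ℝ (Fin d))) ∪ {p, q₂})))) :
    ‖q₁ - p‖ = ‖q₂ - p‖ := by
  classical
  obtain ⟨I, a, b, h0, h1, h3, h2⟩ := hrep V hfin hdim
  have hsph : ∀ v ∈ V, ‖v‖ = 1 := fun v hv => by simpa using hVsph hv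
  have hle : ∀ i ∈ I, ∀ y ∈ convexHull ℝ V, a i y ≤ b i := fun i hi y hy =>
    le_on_hull (a i) (b i) (h1 i hi) hy
  have hind : ∀ i ∈ I, ∀ v ∈ {y ∈ V | a i y = b i},
      v ∉ affineSpan ℝ ({y ∈ V | a i y = b i} \ {v}) := fun i hi v hv =>
    simplicial volume V hfin hdim hsph I a b h0 h1 h2 h3 v hv.1 (hZ v hv.1) i hi hv.2
  have hP : ∀ x ∈ V, x ∈ convexHull ℝ V := fun x hx => subset_convexHull ℝ V hx
  have hext : ∀ x ∈ V, x ∈ (convexHull ℝ V).extremePoints ℝ := fun x hx => by rw [hvert]; exact hx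
  set K := convexHull ℝ (V \ {p}) with hK
  have hKc : Convex ℝ K := convex_convexHull ℝ _
  have hap : ∀ i ∈ I, ∀ s > 0, ∀ y, Adm K p s y → a i y = b i → a i p = b i := by
    rintro i hi s hs y ⟨-, hs1, k, hk, rfl⟩ hyb
    have e1 := le_on_hull (a i) (b i) (fun v hv => h1 i hi v hv.1) hk
    have e2 := h1 i hi p hpV
    simp only [map_add, map_smul, smul_eq_mul] at hyb
    by_contra hne
    have e3 : a i p < b i := lt_of_le_of_ne e2 hne
    nlinarith [mul_pos hs (sub_pos.2 e3), mul_nonneg (sub_nonneg.2 hs1) (sub_nonneg.2 e1)]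
  obtain ⟨l, L, hl, hadm, hmax, -⟩ := exists_lam V hfin I a b h1 h2 p hpV q₁ hq₁V hpq₁.symm
  obtain ⟨T, LT, hT, hTinv, hTy⟩ := ray V I a b h1 h2 q₁ q₂ (hext q₁ hq₁V) (hP q₂ hq₂V) hq₁q₂
  obtain ⟨B, LB, hB, hBinv, hBy⟩ := ray V I a b h1 h2 q₂ q₁ (hext q₂ hq₂V) (hP q₁ hq₁V) hq₁q₂.symm
  have sw1 : ∀ i ∈ I, a i q₂ < a i q₁ → ∀ s > 0, ∀ y, Adm K p s y → a i y = b i →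
      ∃ r : ℝ, 0 ≤ r ∧ Adm K p s (y - r • (q₁ - q₂)) ∧
        ∀ r' : ℝ, y - r' • (q₁ - q₂) ∈ convexHull ℝ V → r' ≤ r := fun i hi hq s hs y hy hyb =>
    swap d hd V hfin p q₁ q₂ hpV hq₁V hq₂V hpq₁ hpq₂ ha (fun S hS hc => (hb S hS hc).1)
      (a i) (b i) (h1 i hi) (h3 i hi) (hind i hi) (hap i hi s hs y hy hyb) hq s hs y hy hyb
  have sw2 : ∀ i ∈ I, a i q₁ < a i q₂ → ∀ s > 0, ∀ y, Adm K p s y → a i y = b i →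
      ∃ r : ℝ, 0 ≤ r ∧ Adm K p s (y - r • (q₂ - q₁)) ∧
        ∀ r' : ℝ, y - r' • (q₂ - q₁) ∈ convexHull ℝ V → r' ≤ r := fun i hi hq s hs y hy hyb =>
    swap d hd V hfin p q₂ q₁ hpV hq₂V hq₁V hpq₂ hpq₁ (fun F hF hpF => (ha F hF hpF).symm)
      (fun S hS hc => (hb S hS hc).2)
      (a i) (b i) (h1 i hi) (h3 i hi) (hind i hi) (hap i hi s hs y hy hyb) hq s hs y hy hyb
  set u := q₁ - q₂ with hu
  have hu' : q₂ - q₁ = -u := by rw [hu]; abel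
  rw [hu'] at hBinv hBy sw2
  let g : EuclideanSpace ℝ (Fin d) → ℝ := fun y => l (y + T y • u)
  obtain ⟨M, hM⟩ : ∃ M, LipschitzWith M g := by
    have e1 := (ContinuousLinearMap.toSpanSingleton ℝ u).lipschitz.comp hT
    have e2 := LipschitzWith.id.add e1
    exact ⟨_, hl.comp e2⟩
  have hginv : ∀ y (r : ℝ), g (y + r • u) = g y := by
    intro y r
    simp only [g]
    rw [hTinv]
    congr 1
    module
  have hgu : ∀ y, fderiv ℝ g y u = 0 := by
    intro y
    by_cases hd : DifferentiableAt ℝ g y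
    · have e1 : HasDerivAt (fun t : ℝ => g (y + t • u)) (fderiv ℝ g y u) 0 :=
        hd.hasFDerivAt.hasLineDerivAt u
      simp only [hginv] at e1
      exact e1.unique (hasDerivAt_const _ _)
    · rw [fderiv_zero_of_not_differentiableAt hd]; rfl
  have hgadm : ∀ y ∈ convexHull ℝ V, Adm K p (g y) y := by
    intro y hy
    obtain ⟨hT0, htop, i, hi, hiq, hib⟩ := hTy y hy
    obtain ⟨hB0, hbot, j, hj, hjq, hjb⟩ := hBy y hy
    have hA := hadm _ htop
    have hA0 : 0 ≤ g y := hA.1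
    rcases hA0.eq_or_lt with hz | hpos
    · have hA' := hadm _ hbot
      rcases hA'.1.eq_or_lt with hz' | hpos'
      · rw [← hz'] at hA'
        have hA2 : Adm K p 0 (y + T y • u) := by
          have : l (y + T y • u) = 0 := hz.symm
          rwa [this] at hA
        rw [← hz]
        refine Adm.between hKc hT0 hB0 hA2 ?_
        rwa [smul_neg, ← sub_eq_add_neg] at hA'
      · exfalso
        obtain ⟨r, hr, hAr, hmr⟩ := sw2 j hj hjq _ hpos' _ hA' hjb
        have e1 : T y + B y ≤ r := by
          apply hmr
          convert htop using 1
          module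
        have hmem := hle i hi _ (Adm.mem hpV hAr)
        have e2 : y + B y • -u - r • -u = (y + T y • u) + (r - (T y + B y)) • u := by module
        have hiu : 0 < a i u := by rw [hu, map_sub]; linarith
        rw [e2, map_add, hib, map_smul, smul_eq_mul] at hmem
        have e3 : r = T y + B y := by
          by_contra hne
          have : T y + B y < r := lt_of_le_of_ne e1 (Ne.symm hne)
          nlinarith [mul_pos (sub_pos.2 this) hiu]
        rw [e2, e3, sub_self, zero_smul, add_zero] at hAr
        have e4 := hmax _ _ hAr
        have e5 : g y = l (y + T y • u) := rfl
        linarith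
    · obtain ⟨r, hr, hAr, hmr⟩ := sw1 i hi hiq _ hpos _ hA hib
      have e1 : T y ≤ r := by
        apply hmr
        convert hy using 1
        module
      refine Adm.between hKc (c2 := r - T y) hT0 (by linarith) hA ?_
      convert hAr using 1
      module
  obtain ⟨m, hm⟩ := exists_lin volume (convexHull ℝ V) (hfin.isCompact_convexHull ℝ) g M hM
  have hmu : m u = 0 := by rw [hm]; simp [hgu]
  have hmt : ∀ τ, inner ℝ p τ = 0 → m τ = 0 := fun τ hτ => by
    rw [hm]; exact crit volume V hfin p (hsph p hpV) (hZ p hpV) g M hM hgadm τ hτ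
  obtain ⟨τ, hτ⟩ := nonzero volume V hfin hdim p (hext p hpV) g M hM hgadm q₁ hq₁V hpq₁.symm
  rw [← hm] at hτ
  have hpp : inner ℝ p p = (1 : ℝ) := by rw [real_inner_self_eq_norm_sq, hsph p hpV]; norm_num
  have hdec : ∀ x, m x = inner ℝ p x * m p := by
    intro x
    have := hmt (x - (inner ℝ p x) • p) (by rw [inner_sub_right, inner_smul_right, hpp]; ring)
    rw [map_sub, map_smul, smul_eq_mul] at this
    linarith
  have hmp : m p ≠ 0 := fun h => hτ (by rw [hdec, h, mul_zero])
  have hpu : inner ℝ p u = 0 := by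
    rw [hdec] at hmu
    exact (mul_eq_zero.1 hmu).resolve_right hmp
  rw [hu, inner_sub_right] at hpu
  have hn1 := norm_sub_sq_real q₁ p
  have hn2 := norm_sub_sq_real q₂ p
  rw [hsph q₁ hq₁V, real_inner_comm] at hn1
  rw [hsph q₂ hq₂V, real_inner_comm] at hn2
  rw [← sq_eq_sq₀ (norm_nonneg _) (norm_nonneg _)]
  linarith
end
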